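/- arXiv:1510.02812 — 4 statements merged into one kernel-verified Lean document; each statement's English description precedes it below -/
import Mathlib

section
/- Let N = 1 and s ∈ (0,1). Assume K satisfies (K1) and (K2) and W satisfies (W1)–(W4), and let u0 be the minimizer of Theorem 1 (odd, strictly increasing, u0 : ℝ → (−1,1) of class C^{1+2s+α}(ℝ) for some α > 0, lim_{x→±∞} u0(x) = ±1, solving L_K u0 = W'(u0) pointwise on ℝ). Then there exist constants C ≥ 1 and R1 > 0 such that for every R ≥ R1 one has ∫_{−R}^{R} ∫_{ℝ∖[−R,R]} |u0(x) − u0(y)|² K(x−y) dx dy ≤ C·R^{1−2s}, and moreover G*(u0) := limsup_{R→+∞} E_K(u0,[−R,R]) / Ψ_s(R) < +∞. -/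
open MeasureTheory Filter Topology Set
open scoped ENNReal NNReal

noncomputable section

/-- The non-local Gagliardo-type + potential energy `E_K(u, Ω)`. -/
def nlEnergy {E : Type*} [MeasurableSpace E] [Sub E] (μ : Measure E)
    (K : E → ℝ) (W : ℝ → ℝ) (u : E → ℝ) (Ω : Set E) : ℝ≥0∞ :=
  (1 / 4) * ∫⁻ p in ((Ωᶜ ×ˢ Ωᶜ)ᶜ : Set (E × E)),
      ENNReal.ofReal ((u p.1 - u p.2) ^ 2 * K (p.1 - p.2)) ∂(μ.prod μ)
    + ∫⁻ x in Ω, ENNReal.ofReal (W (u x)) ∂μ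

/-- `u` is a local minimizer of `E_K` in `Ω`. -/
def IsLocalMinimizer {E : Type*} [MeasurableSpace E] [Sub E] (μ : Measure E)
    (K : E → ℝ) (W : ℝ → ℝ) (u : E → ℝ) (Ω : Set E) : Prop :=
  nlEnergy μ K W u Ω ≠ ⊤ ∧
    ∀ v : E → ℝ, Measurable v → (∀ᵐ x ∂μ, x ∉ Ω → v x = u x) →
      nlEnergy μ K W u Ω ≤ nlEnergy μ K W v Ω

/-- `u` is a class A minimizer of `E_K`: a local minimizer in every bounded domain. -/
def IsClassAMinimizer {E : Type*} [NormedAddCommGroup E] [MeasurableSpace E] (μ : Measure E)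
    (K : E → ℝ) (W : ℝ → ℝ) (u : E → ℝ) : Prop :=
  ∀ Ω : Set E, IsOpen Ω → IsConnected Ω → Bornology.IsBounded Ω →
    IsLocalMinimizer μ K W u Ω

/-- The integro-differential operator `L_K`, in its non-singular form
`L_K u (x) = (1/2) ∫ (u(x+z) + u(x-z) - 2 u(x)) K(z) dz`. -/
def opLK {E : Type*} [NormedAddCommGroup E] [MeasurableSpace E] (μ : Measure E)
    (K : E → ℝ) (u : E → ℝ) (x : E) : ℝ :=
  (1 / 2) * ∫ z, (u (x + z) + u (x - z) - 2 * u x) * K z ∂μ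

/-- (K1): the kernel is symmetric. -/
def KernelSymm {E : Type*} [MeasurableSpace E] [Neg E] (μ : Measure E) (K : E → ℝ) : Prop :=
  ∀ᵐ z ∂μ, K (-z) = K z

/-- (K2): `λ χ_{B_{r0}}(z) |z|^{-N-2s} ≤ K(z) ≤ Λ |z|^{-N-2s}` for a.e. `z`. -/
def KernelK2 {E : Type*} [NormedAddCommGroup E] [MeasurableSpace E] (μ : Measure E)
    (K : E → ℝ) (N : ℕ) (s lam Lam r0 : ℝ) : Prop :=
  ∀ᵐ z ∂μ, K z ≤ Lam * ‖z‖ ^ (-(N : ℝ) - 2 * s) ∧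
    (‖z‖ < r0 → lam * ‖z‖ ^ (-(N : ℝ) - 2 * s) ≤ K z)

/-- (K2'): `λ |z|^{-N-2s} ≤ K(z) ≤ Λ |z|^{-N-2s}` for a.e. `z`. -/
def KernelK2' {E : Type*} [NormedAddCommGroup E] [MeasurableSpace E] (μ : Measure E)
    (K : E → ℝ) (N : ℕ) (s lam Lam : ℝ) : Prop :=
  ∀ᵐ z ∂μ, lam * ‖z‖ ^ (-(N : ℝ) - 2 * s) ≤ K z ∧ K z ≤ Lam * ‖z‖ ^ (-(N : ℝ) - 2 * s)

/-- `W` is of class `C^{2,β}_loc(ℝ)`. -/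
def IsC2HolderLoc (β : ℝ) (W : ℝ → ℝ) : Prop :=
  ContDiff ℝ 2 W ∧ ∀ R : ℝ, 0 < R → ∃ C : NNReal,
    HolderOnWith C β.toNNReal (deriv (deriv W)) (Icc (-R) R)

/-- `f` is of (global) class `C^γ`: it is `C^{⌊γ⌋}` and the `⌊γ⌋`-th derivative is
globally Hölder continuous with exponent `γ - ⌊γ⌋`. -/
def IsCHolder {E F : Type*} [NormedAddCommGroup E] [NormedSpace ℝ E]
    [NormedAddCommGroup F] [NormedSpace ℝ F] (γ : ℝ) (f : E → F) : Prop :=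
  ContDiff ℝ (⌊γ⌋₊ : ℕ) f ∧ ∃ C : NNReal,
    HolderWith C (γ - ⌊γ⌋₊).toNNReal (iteratedFDeriv ℝ ⌊γ⌋₊ f)

/-- `f` is of class `C^γ` on the set `Ω`. -/
def IsCHolderOn {E F : Type*} [NormedAddCommGroup E] [NormedSpace ℝ E]
    [NormedAddCommGroup F] [NormedSpace ℝ F] (γ : ℝ) (f : E → F) (Ω : Set E) : Prop :=
  ContDiffOn ℝ (⌊γ⌋₊ : ℕ) f Ω ∧ ∃ C : NNReal,
    HolderOnWith C (γ - ⌊γ⌋₊).toNNReal (iteratedFDerivWithin ℝ ⌊γ⌋₊ f Ω) Ω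

/-- The scaling factor `Ψ_s(R)`. -/
def Psi (s R : ℝ) : ℝ :=
  if s < 1 / 2 then R ^ (1 - 2 * s) else if s = 1 / 2 then Real.log R else 1

theorem exists_iteratedDeriv_succ_eq_sub {f : ℝ → ℝ} {k : ℕ} (hf : ContDiff ℝ (k + 1 : ℕ) f)
    (x : ℝ) : ∃ ξ ∈ Ioo x (x + 1),
      iteratedDeriv (k + 1) f ξ = iteratedDeriv k f (x + 1) - iteratedDeriv k f x := by
  have hd : Differentiable ℝ (iteratedDeriv k f) :=
    hf.differentiable_iteratedDeriv k (by exact_mod_cast Nat.lt_succ_self k)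
  obtain ⟨ξ, hξ, h⟩ := exists_deriv_eq_slope (iteratedDeriv k f) (lt_add_one x)
    hd.continuous.continuousOn hd.differentiableOn
  refine ⟨ξ, hξ, ?_⟩
  rw [iteratedDeriv_succ, h]
  simp

/-- A bounded function whose `k`-th derivative has bounded oscillation at unit scale has a bounded
`k`-th derivative. -/
theorem bounded_iteratedDeriv_of_bounded_osc (k : ℕ) : ∀ (f : ℝ → ℝ) (B C : ℝ),
    ContDiff ℝ k f → (∀ x, |f x| ≤ B) →
    (∀ x y, |x - y| ≤ 1 → |iteratedDeriv k f x - iteratedDeriv k f y| ≤ C) →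
    ∃ M, ∀ x, |iteratedDeriv k f x| ≤ M := by
  induction k with
  | zero => intro f B C _ hB _; exact ⟨B, by simpa using hB⟩
  | succ k ih =>
    intro f B C hf hB hC
    have hfk : ContDiff ℝ k f := hf.of_le (by exact_mod_cast Nat.le_succ k)
    have hshift : ContDiff ℝ k (fun x => f (x + 1)) := hfk.comp (contDiff_id.add contDiff_const)
    have hg : ∀ x, iteratedDeriv k (fun x => f (x + 1) - f x) x
        = iteratedDeriv k f (x + 1) - iteratedDeriv k f x := by
      intro x
      rw [iteratedDeriv_fun_sub hshift.contDiffAt hfk.contDiffAt, iteratedDeriv_comp_add_const]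
    have hslope := exists_iteratedDeriv_succ_eq_sub hf
    obtain ⟨M, hM⟩ := ih (fun x => f (x + 1) - f x) (B + B) (C + C + C) (hshift.sub hfk)
      (fun x => (abs_sub _ _).trans (add_le_add (hB _) (hB _))) (by
        intro x y hxy
        obtain ⟨ξ, hξ, h1⟩ := hslope x
        obtain ⟨η, hη, h2⟩ := hslope y
        rw [hg, hg, ← h1, ← h2]
        have e1 := hC ξ x (by rw [abs_le]; constructor <;> linarith [hξ.1, hξ.2])
        have e2 := hC x y hxy
        have e3 := hC y η (by rw [abs_le]; constructor <;> linarith [hη.1, hη.2])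
        rw [abs_le] at *
        constructor <;> linarith)
    refine ⟨M + C, fun x => ?_⟩
    obtain ⟨ξ, hξ, h1⟩ := hslope x
    have e1 := hC x ξ (by rw [abs_le]; constructor <;> linarith [hξ.1, hξ.2])
    have e2 := hM x
    rw [hg, ← h1] at e2
    rw [abs_le] at *
    constructor <;> linarith

theorem bounded_deriv_of_bounded_osc (n : ℕ) : ∀ (f : ℝ → ℝ) (B C : ℝ),
    ContDiff ℝ (n + 1 : ℕ) f → (∀ x, |f x| ≤ B) →
    (∀ x y, |x - y| ≤ 1 → |iteratedDeriv (n + 1) f x - iteratedDeriv (n + 1) f y| ≤ C) →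
    ∃ M, ∀ x, |deriv f x| ≤ M := by
  induction n with
  | zero =>
    intro f B C hf hB hC
    simpa [iteratedDeriv_one] using bounded_iteratedDeriv_of_bounded_osc _ f B C hf hB hC
  | succ n ih =>
    intro f B C hf hB hC
    obtain ⟨M, hM⟩ := bounded_iteratedDeriv_of_bounded_osc _ f B C hf hB hC
    refine ih f B M (hf.of_le (by exact_mod_cast Nat.le_succ _)) hB fun x y hxy => ?_
    have hd : Differentiable ℝ (iteratedDeriv (n + 1) f) :=
      hf.differentiable_iteratedDeriv (n + 1) (by exact_mod_cast Nat.lt_succ_self (n + 1))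
    have := Convex.norm_image_sub_le_of_norm_deriv_le (f := iteratedDeriv (n + 1) f) (s := univ)
      (C := M) (fun z _ => hd z) (fun z _ => by
        rw [← iteratedDeriv_succ]; exact hM z) convex_univ (mem_univ y) (mem_univ x)
    rw [Real.norm_eq_abs, Real.norm_eq_abs] at this
    have hM0 : 0 ≤ M := (abs_nonneg _).trans (hM 0)
    exact this.trans (mul_le_of_le_one_right hM0 hxy)

/-- A bounded function of class `C^γ` with `γ ≥ 1` is globally Lipschitz. -/
theorem IsCHolder.exists_abs_sub_le {γ B : ℝ} {f : ℝ → ℝ} (hγ : 1 ≤ γ) (hf : IsCHolder γ f)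
    (hB : ∀ x, |f x| ≤ B) : ∃ L, 0 ≤ L ∧ ∀ x y, |f x - f y| ≤ L * |x - y| := by
  obtain ⟨hcd, C, hC⟩ := hf
  obtain ⟨n, hn⟩ : ∃ n, ⌊γ⌋₊ = n + 1 :=
    Nat.exists_eq_succ_of_ne_zero (Nat.floor_pos.2 hγ).ne'
  rw [hn] at hcd hC
  obtain ⟨M, hM⟩ := bounded_deriv_of_bounded_osc n f B C hcd hB (by
    intro x y hxy
    have h1 := hC.dist_le x y
    have h2 : dist x y ^ (((γ - (n + 1 : ℕ)).toNNReal : NNReal) : ℝ) ≤ 1 :=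
      Real.rpow_le_one dist_nonneg (by rwa [Real.dist_eq]) (NNReal.coe_nonneg _)
    have h3 := (iteratedFDeriv ℝ (n + 1) f x - iteratedFDeriv ℝ (n + 1) f y).le_opNorm
      (fun _ => (1 : ℝ))
    simp only [iteratedDeriv_eq_iteratedFDeriv]
    rw [dist_eq_norm] at h1
    simp only [norm_one, Finset.prod_const_one, mul_one, sub_apply,
      Real.norm_eq_abs] at h3
    exact h3.trans (h1.trans (mul_le_of_le_one_right C.coe_nonneg h2)))
  refine ⟨M, (abs_nonneg _).trans (hM 0), fun x y => ?_⟩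
  have hd : Differentiable ℝ f := hcd.differentiable (by simp)
  exact Convex.norm_image_sub_le_of_norm_deriv_le (f := f) (s := univ)
      (C := M) (fun z _ => hd z) (fun z _ => hM z) convex_univ (mem_univ y) (mem_univ x)

theorem lintegral_Ioc_zero_rpow {a b : ℝ} (ha : -1 < a) (hb : 0 ≤ b) :
    ∫⁻ t in Ioc 0 b, ENNReal.ofReal (t ^ a) = ENNReal.ofReal (b ^ (a + 1) / (a + 1)) := by
  rw [← ofReal_integral_eq_lintegral_ofReal, ← intervalIntegral.integral_of_le hb,
    integral_rpow (Or.inl ha), Real.zero_rpow (by linarith), sub_zero]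
  · exact (intervalIntegrable_iff_integrableOn_Ioc_of_le hb).1
      (intervalIntegral.intervalIntegrable_rpow' ha)
  · filter_upwards [ae_restrict_mem measurableSet_Ioc] with t ht
    exact Real.rpow_nonneg ht.1.le _

theorem lintegral_Ioi_rpow {a b : ℝ} (ha : a < -1) (hb : 0 < b) :
    ∫⁻ t in Ioi b, ENNReal.ofReal (t ^ a) = ENNReal.ofReal (-b ^ (a + 1) / (a + 1)) := by
  rw [← ofReal_integral_eq_lintegral_ofReal, integral_Ioi_rpow_of_lt ha hb]
  · exact integrableOn_Ioi_rpow_of_lt ha hb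
  · filter_upwards [ae_restrict_mem measurableSet_Ioi] with t ht
    exact Real.rpow_nonneg (hb.trans ht).le _

theorem lintegral_Ioc_one_rpow_neg_one {b : ℝ} (hb : 1 ≤ b) :
    ∫⁻ t in Ioc 1 b, ENNReal.ofReal (t ^ (-1 : ℝ)) = ENNReal.ofReal (Real.log b) := by
  have h0 : (0 : ℝ) ∉ uIcc 1 b := by
    rw [uIcc_of_le hb]; intro h; linarith [h.1]
  simp only [Real.rpow_neg_one]
  rw [← ofReal_integral_eq_lintegral_ofReal, ← intervalIntegral.integral_of_le hb,
    integral_inv h0, div_one]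
  · refine (intervalIntegrable_iff_integrableOn_Ioc_of_le hb).1
      (intervalIntegral.intervalIntegrable_inv (fun x hx h => h0 (h ▸ hx)) continuousOn_id)
  · filter_upwards [ae_restrict_mem measurableSet_Ioc] with t ht
    exact inv_nonneg.2 (zero_le_one.trans ht.1.le)

/-- An even function bounds an integral over the line by twice its integral over the half-line. -/
theorem lintegral_le_two_mul_lintegral_Ioi {f h : ℝ → ℝ≥0∞} (hfh : ∀ᵐ t, f t ≤ h |t|) :
    ∫⁻ t, f t ≤ 2 * ∫⁻ t in Ioi 0, h t := by
  have e1 : ∫⁻ t in Ioi (0 : ℝ), h |t| = ∫⁻ t in Ioi 0, h t :=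
    setLIntegral_congr_fun measurableSet_Ioi fun t ht => by
      simp only [abs_of_pos (show (0 : ℝ) < t from ht)]
  have e2 : ∫⁻ t in Iio (0 : ℝ), h |t| = ∫⁻ t in Ioi 0, h t := by
    rw [← e1]
    have := (Measure.measurePreserving_neg (volume : Measure ℝ)).setLIntegral_comp_preimage_emb
      (MeasurableEquiv.neg ℝ).measurableEmbedding (fun t => h |t|) (Ioi 0)
    simpa using this
  calc ∫⁻ t, f t ≤ ∫⁻ t, h |t| := lintegral_mono_ae hfh
    _ = (∫⁻ t in Ioi (0 : ℝ), h |t|) + ∫⁻ t in Iic (0 : ℝ), h |t| := by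
      rw [← lintegral_add_compl _ (measurableSet_Ioi (a := (0 : ℝ))), compl_Ioi]
    _ = 2 * ∫⁻ t in Ioi 0, h t := by
      rw [setLIntegral_congr (Iio_ae_eq_Iic (a := (0 : ℝ))).symm, e1, e2, two_mul]

/-- Integral of a kernel dominated by one power near the origin and another one at infinity. -/
theorem lintegral_le_of_le_rpow {f : ℝ → ℝ≥0∞} {a b c d ρ : ℝ} (ha : -1 < a) (hb : b < -1)
    (hc : 0 ≤ c) (hd : 0 ≤ d) (hρ : 0 < ρ)
    (hnear : ∀ᵐ t, |t| ≤ ρ → f t ≤ ENNReal.ofReal (c * |t| ^ a))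
    (hfar : ∀ᵐ t, ρ < |t| → f t ≤ ENNReal.ofReal (d * |t| ^ b)) :
    ∫⁻ t, f t ≤ ENNReal.ofReal
      (2 * (c * (ρ ^ (a + 1) / (a + 1)) + d * (-ρ ^ (b + 1) / (b + 1)))) := by
  have hb' : 0 ≤ -ρ ^ (b + 1) / (b + 1) :=
    div_nonneg_of_nonpos (neg_nonpos.2 (Real.rpow_nonneg hρ.le _)) (by linarith)
  have ha' : 0 ≤ ρ ^ (a + 1) / (a + 1) := div_nonneg (Real.rpow_nonneg hρ.le _) (by linarith)
  refine (lintegral_le_two_mul_lintegral_Ioi (h := fun t => if t ≤ ρ then ENNReal.ofReal (c * t ^ a)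
    else ENNReal.ofReal (d * t ^ b)) ?_).trans ?_
  · filter_upwards [hnear, hfar] with t h1 h2
    split_ifs with h
    · exact h1 h
    · exact h2 (not_le.1 h)
  · have hu : Ioi (0 : ℝ) = Ioc 0 ρ ∪ Ioi ρ := (Ioc_union_Ioi_eq_Ioi hρ.le).symm
    rw [hu]
    rw [ENNReal.ofReal_mul zero_le_two, ENNReal.ofReal_add (by positivity) (by positivity),
      ENNReal.ofReal_mul hc, ENNReal.ofReal_mul hd, ← lintegral_Ioc_zero_rpow ha hρ.le,
      ← lintegral_Ioi_rpow hb hρ, ← lintegral_const_mul' _ _ ENNReal.ofReal_ne_top,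
      ← lintegral_const_mul' _ _ ENNReal.ofReal_ne_top, ENNReal.ofReal_ofNat]
    gcongr
    refine (lintegral_union_le _ _ _).trans (add_le_add (le_of_eq ?_) (le_of_eq ?_))
    · refine setLIntegral_congr_fun measurableSet_Ioc fun t ht => ?_
      simp only [if_pos ht.2, ENNReal.ofReal_mul hc]
    · refine setLIntegral_congr_fun measurableSet_Ioi fun t ht => ?_
      simp only [if_neg (not_le.2 (show ρ < t from ht)), ENNReal.ofReal_mul hd]

/-- Slicing an integral over the plane along the diagonals. -/
theorem setLIntegral_mul_sub_le {S : Set (ℝ × ℝ)} (hS : MeasurableSet S) {F : ℝ × ℝ → ℝ≥0∞}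
    (hF : Measurable F) {H : ℝ → ℝ≥0∞} (hH : Measurable H) {g : ℝ → ℝ≥0∞}
    (hg : ∀ t, ∫⁻ x in {x | (x + t, x) ∈ S}, F (x + t, x) ≤ g t) :
    ∫⁻ p in S, F p * H (p.1 - p.2) ≤ ∫⁻ t, g t * H t := by
  have hm : Measurable fun p : ℝ × ℝ => F p * H (p.1 - p.2) :=
    hF.mul (hH.comp (measurable_fst.sub measurable_snd))
  have hm' := hm.indicator hS
  rw [← lintegral_indicator hS, Measure.volume_eq_prod, lintegral_prod_symm' _ hm']
  have e : ∀ y : ℝ, ∫⁻ x, S.indicator (fun p : ℝ × ℝ => F p * H (p.1 - p.2)) (x, y)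
      = ∫⁻ t, S.indicator (fun p : ℝ × ℝ => F p * H (p.1 - p.2)) (y + t, y) := fun y =>
    (lintegral_add_left_eq_self
      (fun x => S.indicator (fun p : ℝ × ℝ => F p * H (p.1 - p.2)) (x, y)) y).symm
  simp only [e]
  rw [lintegral_lintegral_swap]
  · refine lintegral_mono fun t => ?_
    have hSt : MeasurableSet {x : ℝ | (x + t, x) ∈ S} :=
      ((measurable_id.add_const t).prodMk measurable_id) hS
    refine le_trans (le_of_eq ?_) (mul_le_mul_left (hg t) (H t))
    rw [← lintegral_indicator hSt, ← lintegral_mul_const]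
    · refine lintegral_congr fun x => ?_
      by_cases hx : (x + t, x) ∈ S
      · simp [hx]
      · simp [hx]
    · exact (hF.comp ((measurable_id.add_const t).prodMk measurable_id)).indicator hSt
  · refine (hm'.comp (f := fun q : ℝ × ℝ => (q.1 + q.2, q.1)) ?_).aemeasurable
    exact (measurable_fst.add measurable_snd).prodMk measurable_fst

theorem lintegral_abs_sub_shift_le {u : ℝ → ℝ} (hu : Monotone u) (hu1 : ∀ x, |u x| ≤ 1)
    {a b : ℝ} (hab : a ≤ b) (t : ℝ) :
    ∫⁻ x in Icc a b, ENNReal.ofReal |u (x + t) - u x| ≤ ENNReal.ofReal (2 * |t|) := by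
  have hint : ∀ c d : ℝ, IntervalIntegrable u volume c d := fun c d => hu.intervalIntegrable
  have hsh : Monotone fun x => u (x + t) := fun x y h => hu (by linarith)
  have hint' : ∀ c d : ℝ, IntervalIntegrable (fun x => u (x + t)) volume c d :=
    fun c d => hsh.intervalIntegrable
  have hI : ∫ x in a..b, (u (x + t) - u x) = (∫ x in b..b + t, u x) - ∫ x in a..a + t, u x := by
    rw [intervalIntegral.integral_sub (hint' a b) (hint a b),
      intervalIntegral.integral_comp_add_right (fun x => u x),
      intervalIntegral.integral_interval_sub_interval_comm (hint _ _) (hint _ _) (hint _ _),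
      intervalIntegral.integral_symm b (b + t), intervalIntegral.integral_symm a (a + t)]
    ring
  have hbd : ∀ c : ℝ, |∫ x in c..c + t, u x| ≤ |t| := fun c => by
    have := intervalIntegral.norm_integral_le_of_norm_le_const (f := u) (a := c) (b := c + t)
      (C := 1) (fun x _ => hu1 x)
    simpa using this
  have habs : |∫ x in a..b, (u (x + t) - u x)| ≤ 2 * |t| := by
    rw [hI]
    have := (abs_sub (∫ x in b..b + t, u x) (∫ x in a..a + t, u x)).trans
      (add_le_add (hbd b) (hbd a))
    linarith
  have hconst : ∫ x in a..b, |u (x + t) - u x| = |∫ x in a..b, (u (x + t) - u x)| := by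
    rcases le_total 0 t with ht | ht
    · have h0 : ∀ x, 0 ≤ u (x + t) - u x := fun x => sub_nonneg.2 (hu (by linarith))
      rw [abs_of_nonneg (intervalIntegral.integral_nonneg hab fun x _ => h0 x)]
      simp only [abs_of_nonneg (h0 _)]
    · have h0 : ∀ x, u (x + t) - u x ≤ 0 := fun x => sub_nonpos.2 (hu (by linarith))
      simp only [abs_of_nonpos (h0 _)]
      rw [intervalIntegral.integral_neg, abs_of_nonpos]
      have := intervalIntegral.integral_nonneg (f := fun x => -(u (x + t) - u x)) (μ := volume)
        hab fun x _ => neg_nonneg.2 (h0 x)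
      rw [intervalIntegral.integral_neg] at this
      linarith
  rw [setLIntegral_congr Ioc_ae_eq_Icc.symm, ← ofReal_integral_eq_lintegral_ofReal,
    ← intervalIntegral.integral_of_le hab, hconst]
  · exact ENNReal.ofReal_le_ofReal habs
  · exact (intervalIntegrable_iff_integrableOn_Ioc_of_le hab).1 (((hint' a b).sub (hint a b)).abs)
  · exact Eventually.of_forall fun x => abs_nonneg _

theorem measurableSet_compl_prod_compl {Ω : Set ℝ} (hΩ : MeasurableSet Ω) :
    MeasurableSet ((Ωᶜ ×ˢ Ωᶜ)ᶜ : Set (ℝ × ℝ)) :=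
  (hΩ.compl.prod hΩ.compl).compl

theorem slice_subset (R t : ℝ) :
    {x : ℝ | (x + t, x) ∈ (((Icc (-R) R)ᶜ ×ˢ (Icc (-R) R)ᶜ)ᶜ : Set (ℝ × ℝ))}
      ⊆ Icc (-R) R ∪ Icc (-R - t) (R - t) := by
  intro x hx
  by_contra hcon
  simp only [mem_union, not_or] at hcon
  refine hx ⟨fun h => hcon.2 ⟨?_, ?_⟩, hcon.1⟩
  · linarith [h.1]
  · linarith [h.2]

theorem volume_slice_le {R : ℝ} (hR : 0 ≤ R) (t : ℝ) :
    volume {x : ℝ | (x + t, x) ∈ (((Icc (-R) R)ᶜ ×ˢ (Icc (-R) R)ᶜ)ᶜ : Set (ℝ × ℝ))}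
      ≤ ENNReal.ofReal (4 * R) := by
  refine (measure_mono (slice_subset R t)).trans ((measure_union_le _ _).trans ?_)
  rw [Real.volume_Icc, Real.volume_Icc, ← ENNReal.ofReal_add (by linarith) (by linarith)]
  exact ENNReal.ofReal_le_ofReal (by linarith)

theorem lintegral_slice_le_of_le {R c : ℝ} (hR : 0 ≤ R) (hc : 0 ≤ c) (t : ℝ) {f : ℝ → ℝ}
    (hf : ∀ x, f x ≤ c) :
    ∫⁻ x in {x : ℝ | (x + t, x) ∈ (((Icc (-R) R)ᶜ ×ˢ (Icc (-R) R)ᶜ)ᶜ : Set (ℝ × ℝ))},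
      ENNReal.ofReal (f x) ≤ ENNReal.ofReal (c * (4 * R)) := by
  calc _ ≤ ∫⁻ _ in {x : ℝ | (x + t, x) ∈ (((Icc (-R) R)ᶜ ×ˢ (Icc (-R) R)ᶜ)ᶜ : Set (ℝ × ℝ))},
        ENNReal.ofReal c := lintegral_mono fun x => ENNReal.ofReal_le_ofReal (hf x)
    _ ≤ ENNReal.ofReal c * ENNReal.ofReal (4 * R) := by
      rw [setLIntegral_const]; gcongr; exact volume_slice_le hR t
    _ = _ := (ENNReal.ofReal_mul hc).symm

theorem lintegral_slice_le_of_le_abs_sub {u : ℝ → ℝ} (hu : Monotone u) (hu1 : ∀ x, |u x| ≤ 1)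
    {R c : ℝ} (hR : 0 ≤ R) (hc : 0 ≤ c) (t : ℝ) {f : ℝ → ℝ}
    (hf : ∀ x, f x ≤ c * |u (x + t) - u x|) :
    ∫⁻ x in {x : ℝ | (x + t, x) ∈ (((Icc (-R) R)ᶜ ×ˢ (Icc (-R) R)ᶜ)ᶜ : Set (ℝ × ℝ))},
      ENNReal.ofReal (f x) ≤ ENNReal.ofReal (c * (2 * |t|)) := by
  have hsub : {x : ℝ | (x + t, x) ∈ (((Icc (-R) R)ᶜ ×ˢ (Icc (-R) R)ᶜ)ᶜ : Set (ℝ × ℝ))}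
      ⊆ Icc (-R - |t|) (R + |t|) := by
    refine (slice_subset R t).trans (union_subset (Icc_subset_Icc ?_ ?_) (Icc_subset_Icc ?_ ?_)) <;>
    linarith [abs_nonneg t, le_abs_self t, neg_abs_le t]
  calc _ ≤ ∫⁻ x in Icc (-R - |t|) (R + |t|), ENNReal.ofReal (f x) := lintegral_mono_set hsub
    _ ≤ ∫⁻ x in Icc (-R - |t|) (R + |t|), ENNReal.ofReal c * ENNReal.ofReal |u (x + t) - u x| :=
      lintegral_mono fun x => by
        rw [← ENNReal.ofReal_mul hc]; exact ENNReal.ofReal_le_ofReal (hf x)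
    _ ≤ _ := by
      rw [lintegral_const_mul' _ _ ENNReal.ofReal_ne_top, ENNReal.ofReal_mul hc]
      gcongr
      exact lintegral_abs_sub_shift_le hu hu1 (by linarith [abs_nonneg t]) t

/-- One-sided first variation: a minimizer compared with its perturbations `u + ε φ`. -/
theorem IsLocalMinimizer.lintegral_mul_neg_deriv_le {K W u φ : ℝ → ℝ} {Ω : Set ℝ} {M : ℝ}
    (hmin : IsLocalMinimizer volume K W u Ω) (hK : Measurable K)
    (hΩv : volume Ω ≠ ⊤) (hWc : Continuous W) (hWn : ∀ r, 0 ≤ W r)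
    (hu : Measurable u) (hφ : Measurable φ) (hφ0 : ∀ x ∉ Ω, φ x = 0) (hM : 0 ≤ M)
    (hW : ∀ x, ∀ ε ∈ Icc (0 : ℝ) 1,
      W (u x + ε * φ x) ≤ W (u x) + ε * φ x * deriv W (u x) + M * ε ^ 2)
    (hpos : ∀ x, 0 ≤ φ x * -deriv W (u x))
    (hB : ∫⁻ p in (Ωᶜ ×ˢ Ωᶜ)ᶜ, ENNReal.ofReal ((φ p.1 - φ p.2) ^ 2)
      * ENNReal.ofReal (K (p.1 - p.2)) ≠ ⊤) :
    ∫⁻ x in Ω, ENNReal.ofReal (φ x * -deriv W (u x)) ≤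
      ∫⁻ p in (Ωᶜ ×ˢ Ωᶜ)ᶜ, ENNReal.ofReal (|u p.1 - u p.2| * |φ p.1 - φ p.2|)
      * ENNReal.ofReal (K (p.1 - p.2)) := by
  obtain ⟨hfin, hcomp⟩ := hmin
  set A := ∫⁻ p in (Ωᶜ ×ˢ Ωᶜ)ᶜ, ENNReal.ofReal (|u p.1 - u p.2| * |φ p.1 - φ p.2|)
      * ENNReal.ofReal (K (p.1 - p.2)) with hAdef
  set B := ∫⁻ p in (Ωᶜ ×ˢ Ωᶜ)ᶜ, ENNReal.ofReal ((φ p.1 - φ p.2) ^ 2)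
      * ENNReal.ofReal (K (p.1 - p.2)) with hBdef
  set G := ∫⁻ x in Ω, ENNReal.ofReal (φ x * -deriv W (u x)) with hGdef
  set X := ∫⁻ p in (Ωᶜ ×ˢ Ωᶜ)ᶜ, ENNReal.ofReal ((u p.1 - u p.2) ^ 2 * K (p.1 - p.2)) with hXdef
  set P := ∫⁻ x in Ω, ENNReal.ofReal (W (u x)) with hPdef
  have hE : nlEnergy volume K W u Ω = (1 / 4) * X + P := by
    simp only [nlEnergy, hXdef, hPdef, Measure.volume_eq_prod]
  rw [hE] at hfin hcomp
  obtain ⟨hX4, hP⟩ := ENNReal.add_ne_top.1 hfin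
  set D := B + ENNReal.ofReal M * volume Ω with hD
  have hDtop : D ≠ ⊤ := ENNReal.add_ne_top.2 ⟨hB, ENNReal.mul_ne_top ENNReal.ofReal_ne_top hΩv⟩
  have key : ∀ ε ∈ Ioc (0 : ℝ) 1, G ≤ A + ENNReal.ofReal ε * D := by
    intro ε hε
    have hε0 : ENNReal.ofReal ε ≠ 0 := by simpa using hε.1
    have hv := hcomp (fun x => u x + ε * φ x) (hu.add (hφ.const_mul ε))
      (Eventually.of_forall fun x hx => by simp [hφ0 x hx])
    rw [nlEnergy, ← Measure.volume_eq_prod] at hv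
    have hkm : Measurable fun p : ℝ × ℝ => ENNReal.ofReal (K (p.1 - p.2)) :=
      (hK.comp (measurable_fst.sub measurable_snd)).ennreal_ofReal
    have hu1 : Measurable fun p : ℝ × ℝ => u p.1 := hu.comp measurable_fst
    have hu2 : Measurable fun p : ℝ × ℝ => u p.2 := hu.comp measurable_snd
    have hφ1 : Measurable fun p : ℝ × ℝ => φ p.1 := hφ.comp measurable_fst
    have hφ2 : Measurable fun p : ℝ × ℝ => φ p.2 := hφ.comp measurable_snd
    have hY : ∫⁻ p in (Ωᶜ ×ˢ Ωᶜ)ᶜ, ENNReal.ofReal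
        ((u p.1 + ε * φ p.1 - (u p.2 + ε * φ p.2)) ^ 2 * K (p.1 - p.2)) ≤
        X + (2 * ENNReal.ofReal ε * A + ENNReal.ofReal ε ^ 2 * B) := by
      have hAm : Measurable fun p : ℝ × ℝ =>
          ENNReal.ofReal (|u p.1 - u p.2| * |φ p.1 - φ p.2|) * ENNReal.ofReal (K (p.1 - p.2)) := by
        refine Measurable.mul (Measurable.ennreal_ofReal ?_) hkm
        exact (measurable_norm.comp (hu1.sub hu2)).mul (measurable_norm.comp (hφ1.sub hφ2))
      have hXm : Measurable fun p : ℝ × ℝ =>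
          ENNReal.ofReal ((u p.1 - u p.2) ^ 2 * K (p.1 - p.2)) :=
        (((hu1.sub hu2).pow_const 2).mul
          (hK.comp (measurable_fst.sub measurable_snd))).ennreal_ofReal
      rw [hXdef, hAdef, hBdef, ← lintegral_const_mul' _ _ (by finiteness),
        ← lintegral_const_mul' _ _ (by finiteness), ← lintegral_add_left (hAm.const_mul _),
        ← lintegral_add_left hXm]
      refine lintegral_mono fun p => ?_
      have e2 : (2 : ℝ≥0∞) * ENNReal.ofReal ε = ENNReal.ofReal (2 * ε) := by
        rw [ENNReal.ofReal_mul zero_le_two, ENNReal.ofReal_ofNat]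
      have hε' := hε.1.le
      rw [ENNReal.ofReal_mul (sq_nonneg _), ENNReal.ofReal_mul (sq_nonneg _), ← mul_assoc,
        ← mul_assoc, ← add_mul, ← add_mul, e2, ← ENNReal.ofReal_pow hε.1.le,
        ← ENNReal.ofReal_mul (show 0 ≤ 2 * ε by positivity), ← ENNReal.ofReal_mul (sq_nonneg ε),
        ← ENNReal.ofReal_add (by positivity) (by positivity),
        ← ENNReal.ofReal_add (by positivity) (by positivity)]
      gcongr
      have h1 : (u p.1 - u p.2) * (φ p.1 - φ p.2) ≤ |u p.1 - u p.2| * |φ p.1 - φ p.2| := by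
        rw [← abs_mul]; exact le_abs_self _
      nlinarith [mul_le_mul_of_nonneg_left h1 hε.1.le]
    have hQ : (∫⁻ x in Ω, ENNReal.ofReal (W (u x + ε * φ x))) + ENNReal.ofReal ε * G ≤
        P + ENNReal.ofReal ε ^ 2 * (ENNReal.ofReal M * volume Ω) := by
      have hQm : Measurable fun x => ENNReal.ofReal (W (u x + ε * φ x)) :=
        (hWc.measurable.comp (hu.add (hφ.const_mul ε))).ennreal_ofReal
      have hPm : Measurable fun x => ENNReal.ofReal (W (u x)) :=
        (hWc.measurable.comp hu).ennreal_ofReal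
      rw [hGdef, hPdef, ← lintegral_const_mul' _ _ (by finiteness), ← lintegral_add_left hQm,
        ← ENNReal.ofReal_pow hε.1.le, ← mul_assoc, ← ENNReal.ofReal_mul (sq_nonneg _),
        ← setLIntegral_const, ← lintegral_add_left hPm]
      refine lintegral_mono fun x => ?_
      rw [← ENNReal.ofReal_mul hε.1.le, ← ENNReal.ofReal_add (hWn _)
        (mul_nonneg hε.1.le (hpos x)), ← ENNReal.ofReal_add (hWn _) (by positivity)]
      refine ENNReal.ofReal_le_ofReal ?_
      nlinarith [hW x ε ⟨hε.1.le, hε.2⟩]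
    set Q := ∫⁻ x in Ω, ENNReal.ofReal (W (u x + ε * φ x))
    have h4 : (1 / 4 : ℝ≥0∞) ≤ 1 := by
      rw [one_div]; exact ENNReal.inv_le_one.2 (by norm_num)
    have h42 : (1 / 4 : ℝ≥0∞) * 2 ≤ 1 := by
      rw [one_div, mul_comm, ← div_eq_mul_inv]
      exact ENNReal.div_le_of_le_mul (by norm_num)
    have hsum : (1 / 4) * X + P + ENNReal.ofReal ε * G ≤
        (1 / 4) * X + P + ENNReal.ofReal ε * (A + ENNReal.ofReal ε * D) := by
      calc (1 / 4) * X + P + ENNReal.ofReal ε * G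
          ≤ (1 / 4) * (X + (2 * ENNReal.ofReal ε * A + ENNReal.ofReal ε ^ 2 * B)) + Q
            + ENNReal.ofReal ε * G := by
            refine add_le_add_left ?_ _
            exact hv.trans (by gcongr)
        _ = (1 / 4) * X + ((1 / 4 * 2) * (ENNReal.ofReal ε * A)
            + (1 / 4) * (ENNReal.ofReal ε ^ 2 * B)) + (Q + ENNReal.ofReal ε * G) := by ring
        _ ≤ (1 / 4) * X + (1 * (ENNReal.ofReal ε * A) + 1 * (ENNReal.ofReal ε ^ 2 * B))
            + (P + ENNReal.ofReal ε ^ 2 * (ENNReal.ofReal M * volume Ω)) := by gcongr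
        _ = _ := by rw [hD]; ring
    rw [ENNReal.add_le_add_iff_left hfin] at hsum
    exact (ENNReal.mul_le_mul_iff_right hε0 ENNReal.ofReal_ne_top).1 hsum
  refine ENNReal.le_of_forall_pos_le_add fun δ hδ _ => ?_
  have hd : 0 < D.toReal + 1 := by positivity
  have hε : 0 < min 1 ((δ : ℝ) / (D.toReal + 1)) := by positivity
  refine (key _ ⟨hε, min_le_left _ _⟩).trans ?_
  gcongr
  rw [← ENNReal.ofReal_toReal hDtop, ENNReal.toReal_ofReal ENNReal.toReal_nonneg,
    ← ENNReal.ofReal_mul hε.le, ← ENNReal.ofReal_coe_nnreal]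
  refine ENNReal.ofReal_le_ofReal ?_
  calc min 1 ((δ : ℝ) / (D.toReal + 1)) * D.toReal
      ≤ (δ : ℝ) / (D.toReal + 1) * (D.toReal + 1) := by
        gcongr
        · exact min_le_right _ _
        · linarith
    _ = δ := div_mul_cancel₀ _ hd.ne'

theorem exists_taylor_upper_bound {W : ℝ → ℝ} (hW : ContDiff ℝ 2 W) :
    ∃ M, 0 ≤ M ∧ ∀ r ∈ Icc (-1 : ℝ) 1, ∀ h ∈ Icc (0 : ℝ) 1,
      W (r + h) ≤ W r + h * deriv W r + M * h ^ 2 := by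
  have hd : Differentiable ℝ W := hW.differentiable (by norm_num)
  have hW1 : ContDiff ℝ 1 (deriv W) := (contDiff_succ_iff_deriv (n := 1).1 hW).2.2
  have hd1 : Differentiable ℝ (deriv W) := hW1.differentiable (by norm_num)
  have hc2 : Continuous (deriv (deriv W)) := hW1.continuous_deriv (by norm_num)
  obtain ⟨M, hM⟩ := isCompact_Icc.exists_bound_of_continuousOn (s := Icc (-1 : ℝ) 2)
    hc2.continuousOn
  have hM0 : 0 ≤ M := (norm_nonneg _).trans (hM 0 (by norm_num))
  refine ⟨M, hM0, fun r hr h hh => ?_⟩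
  rcases hh.1.eq_or_lt with rfl | hpos
  · simp
  obtain ⟨ξ, hξ, e1⟩ := exists_deriv_eq_slope W (show r < r + h by linarith)
    hd.continuous.continuousOn hd.differentiableOn
  obtain ⟨η, hη, e2⟩ := exists_deriv_eq_slope (deriv W) hξ.1
    hd1.continuous.continuousOn hd1.differentiableOn
  have hM' := (le_abs_self _).trans (hM η ⟨by linarith [hη.1, hr.1],
    by linarith [hη.2, hξ.2, hr.2, hh.2]⟩)
  rw [add_sub_cancel_left, eq_div_iff hpos.ne'] at e1
  rw [eq_div_iff (by linarith [hξ.1])] at e2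
  have e3 : deriv (deriv W) η * (ξ - r) ≤ M * h :=
    mul_le_mul hM' (by linarith [hξ.2]) (by linarith [hξ.1]) hM0
  nlinarith

theorem exists_mul_one_sub_le_neg_deriv {W : ℝ → ℝ} (hW : ContDiff ℝ 2 W)
    (h1 : deriv W 1 = 0) (h2 : 0 < deriv (deriv W) 1) :
    ∃ c, 0 < c ∧ ∀ᶠ r in 𝓝 1, r ≤ 1 → c * (1 - r) ≤ -deriv W r := by
  have hW1 : ContDiff ℝ 1 (deriv W) := (contDiff_succ_iff_deriv (n := 1).1 hW).2.2
  have hd1 : Differentiable ℝ (deriv W) := hW1.differentiable (by norm_num)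
  have hc2 : Continuous (deriv (deriv W)) := hW1.continuous_deriv (by norm_num)
  refine ⟨deriv (deriv W) 1 / 2, by positivity, ?_⟩
  obtain ⟨δ, hδ, hball⟩ := Metric.eventually_nhds_iff.1
    (hc2.continuousAt.eventually_const_lt (half_lt_self h2))
  filter_upwards [Metric.ball_mem_nhds 1 hδ] with r hr hr1
  rcases hr1.eq_or_lt with rfl | hlt
  · simp [h1]
  obtain ⟨η, hη, e⟩ := exists_deriv_eq_slope (deriv W) hlt
    hd1.continuous.continuousOn hd1.differentiableOn
  have hη' := hball (y := η) (by
    rw [Metric.mem_ball, Real.dist_eq, abs_lt] at hr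
    rw [Real.dist_eq, abs_lt]
    constructor <;> linarith [hη.1, hη.2, hr.1])
  rw [eq_div_iff (by linarith), h1] at e
  nlinarith

theorem exists_le_mul_one_sub {W : ℝ → ℝ} (hW : ContDiff ℝ 2 W) (h1 : W 1 = 0) :
    ∃ M, 0 ≤ M ∧ ∀ r ∈ Icc (-1 : ℝ) 1, W r ≤ M * (1 - r) := by
  have hd : Differentiable ℝ W := hW.differentiable (by norm_num)
  have hc : Continuous (deriv W) := hW.continuous_deriv (by norm_num)
  obtain ⟨M, hM⟩ := isCompact_Icc.exists_bound_of_continuousOn (s := Icc (-1 : ℝ) 1)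
    hc.continuousOn
  refine ⟨M, (norm_nonneg _).trans (hM 0 (by norm_num)), fun r hr => ?_⟩
  have := (convex_Icc (-1 : ℝ) 1).norm_image_sub_le_of_norm_deriv_le (f := W)
    (fun z _ => hd z) hM (right_mem_Icc.2 (by norm_num)) hr
  rw [h1, sub_zero, Real.norm_eq_abs, Real.norm_eq_abs, abs_sub_comm,
    abs_of_nonneg (sub_nonneg.2 hr.2)] at this
  exact (le_abs_self _).trans this

/-- Bound of a nonlocal energy in terms of the growth of its slices along the diagonals. -/
theorem setLIntegral_kernel_le {K : ℝ → ℝ} {s Lam : ℝ} (hK : Measurable K)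
    (hKb : ∀ᵐ t, K t ≤ Lam * |t| ^ (-1 - 2 * s)) (hLam : 0 ≤ Lam)
    {S : Set (ℝ × ℝ)} (hS : MeasurableSet S) {F : ℝ × ℝ → ℝ} (hF : Measurable F)
    {p q c d ρ : ℝ} (hp : 2 * s < p) (hq : q < 2 * s) (hρ : 0 < ρ) (hc : 0 ≤ c) (hd : 0 ≤ d)
    (hnear : ∀ t, |t| ≤ ρ → ∫⁻ x in {x | (x + t, x) ∈ S}, ENNReal.ofReal (F (x + t, x))
      ≤ ENNReal.ofReal (c * |t| ^ p))
    (hfar : ∀ t, ρ < |t| → ∫⁻ x in {x | (x + t, x) ∈ S}, ENNReal.ofReal (F (x + t, x))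
      ≤ ENNReal.ofReal (d * |t| ^ q)) :
    ∫⁻ z in S, ENNReal.ofReal (F z) * ENNReal.ofReal (K (z.1 - z.2)) ≤
      ENNReal.ofReal (2 * Lam * (c * (ρ ^ (p - 2 * s) / (p - 2 * s))
        + d * (ρ ^ (q - 2 * s) / (2 * s - q)))) := by
  classical
  set g : ℝ → ℝ≥0∞ := fun t =>
    if |t| ≤ ρ then ENNReal.ofReal (c * |t| ^ p) else ENNReal.ofReal (d * |t| ^ q) with hg
  have hne : ∀ᵐ t : ℝ, t ≠ 0 := by simp [ae_iff]
  have hmul : ∀ e r t : ℝ, 0 ≤ e → t ≠ 0 → K t ≤ Lam * |t| ^ (-1 - 2 * s) →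
      ENNReal.ofReal (e * |t| ^ r) * ENNReal.ofReal (K t)
        ≤ ENNReal.ofReal (Lam * e * |t| ^ (r - 1 - 2 * s)) := by
    intro e r t he ht hKt
    have ht' : 0 < |t| := abs_pos.2 ht
    rw [← ENNReal.ofReal_mul (by positivity)]
    refine ENNReal.ofReal_le_ofReal ?_
    calc e * |t| ^ r * K t ≤ e * |t| ^ r * (Lam * |t| ^ (-1 - 2 * s)) := by gcongr
      _ = Lam * e * (|t| ^ r * |t| ^ (-1 - 2 * s)) := by ring
      _ = _ := by rw [← Real.rpow_add ht']; congr 2; ring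
  refine (setLIntegral_mul_sub_le hS hF.ennreal_ofReal hK.ennreal_ofReal (g := g) ?_).trans ?_
  · intro t
    by_cases h : |t| ≤ ρ
    · simpa only [hg, if_pos h] using hnear t h
    · simpa only [hg, if_neg h] using hfar t (not_le.1 h)
  · refine (lintegral_le_of_le_rpow (a := p - 1 - 2 * s) (b := q - 1 - 2 * s) (c := Lam * c)
      (d := Lam * d) (ρ := ρ) (by linarith) (by linarith) (by positivity) (by positivity) hρ
      ?_ ?_).trans (ENNReal.ofReal_le_ofReal (le_of_eq ?_))
    · filter_upwards [hne, hKb] with t ht hKt h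
      simpa only [hg, if_pos h] using hmul c p t hc ht hKt
    · filter_upwards [hne, hKb] with t ht hKt h
      simpa only [hg, if_neg (not_le.2 h)] using hmul d q t hd ht hKt
    · have e1 : p - 1 - 2 * s + 1 = p - 2 * s := by ring
      have e2 : q - 1 - 2 * s + 1 = -(2 * s - q) := by ring
      have e3 : q - 2 * s = -(2 * s - q) := by ring
      rw [e1, e2, e3, neg_div_neg_eq]
      ring

theorem abs_tent_sub_le {R : ℝ} (hR : 0 < R) (x y : ℝ) :
    |max (1 - |x - 2 * R| / R) 0 - max (1 - |y - 2 * R| / R) 0| ≤ |x - y| / R := by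
  refine (abs_max_sub_max_le_abs _ _ _).trans ?_
  rw [sub_sub_sub_cancel_left, ← sub_div, abs_div, abs_of_pos hR]
  refine div_le_div_of_nonneg_right
    ((abs_abs_sub_abs_le (y - 2 * R) (x - 2 * R)).trans (le_of_eq ?_)) hR.le
  rw [sub_sub_sub_cancel_right, abs_sub_comm]

theorem exists_one_sub_le_rpow {K W u : ℝ → ℝ} {s Lam : ℝ} (hs0 : 0 < s) (hs1 : s < 1)
    (hLam : 0 ≤ Lam) (hK : Measurable K) (hKb : ∀ᵐ t, K t ≤ Lam * |t| ^ (-1 - 2 * s))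
    (hW : ContDiff ℝ 2 W) (hWn : ∀ r, 0 ≤ W r) (hu : Monotone u) (hu1 : ∀ x, |u x| ≤ 1)
    (hmin : ∀ r > 0, IsLocalMinimizer volume K W u (Ioo (-r) r))
    {X c : ℝ} (hc : 0 < c) (hX : ∀ x ≥ X, c * (1 - u x) ≤ -deriv W (u x)) :
    ∃ C, 0 ≤ C ∧ ∀ x > 0, 1 - u x ≤ C * x ^ (-(2 * s)) := by
  obtain ⟨M, hM0, hM⟩ := exists_taylor_upper_bound hW
  set C0 : ℝ := 2 * Lam * (2 * (3 ^ (2 - 2 * s) / (2 - 2 * s)) + 24 * (3 ^ (-(2 * s)) / (2 * s)))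
    with hC0
  have h22 : 0 < 2 - 2 * s := by linarith
  have hC0n : 0 ≤ C0 := by positivity
  have hu1' : ∀ x, 0 ≤ 1 - u x := fun x => by linarith [le_abs_self (u x), hu1 x]
  have hu2 : ∀ x y, |u x - u y| ≤ 2 := fun x y =>
    (abs_sub _ _).trans (by linarith [hu1 x, hu1 y])
  have main : ∀ R, 0 < R → X ≤ R → 1 - u (5 / 2 * R) ≤ 2 * C0 / c * R ^ (-(2 * s)) := by
    intro R hR hXR
    set φ : ℝ → ℝ := fun x => max (1 - |x - 2 * R| / R) 0 with hφ
    have hφc : Continuous φ := by fun_prop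
    have hφL : ∀ x y, |φ x - φ y| ≤ |x - y| / R := abs_tent_sub_le hR
    have hφ0 : ∀ x, 0 ≤ φ x := fun x => le_max_right _ _
    have hφ1 : ∀ x, φ x ≤ 1 := fun x => max_le (by
      have : 0 ≤ |x - 2 * R| / R := by positivity
      linarith) zero_le_one
    have hφd : ∀ x y, |φ x - φ y| ≤ 1 := fun x y => by
      rw [abs_le]; constructor <;> linarith [hφ0 x, hφ0 y, hφ1 x, hφ1 y]
    have hφsupp : ∀ x, ¬ (R < x ∧ x < 3 * R) → φ x = 0 := by
      intro x hx
      refine max_eq_right (sub_nonpos.2 ((one_le_div hR).2 ?_))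
      rw [le_abs]
      by_contra! hcon
      exact hx ⟨by linarith [hcon.2], by linarith [hcon.1]⟩
    have hpos : ∀ x, 0 ≤ φ x * -deriv W (u x) := by
      intro x
      by_cases hx : R < x ∧ x < 3 * R
      · exact mul_nonneg (hφ0 x) ((mul_nonneg hc.le (hu1' x)).trans
          (hX x (hXR.trans hx.1.le)))
      · rw [hφsupp x hx, zero_mul]
    set Ω : Set ℝ := Ioo (-(3 * R)) (3 * R) with hΩ
    have hSsub : ((Ωᶜ ×ˢ Ωᶜ)ᶜ : Set (ℝ × ℝ)) ⊆
        ((Icc (-(3 * R)) (3 * R))ᶜ ×ˢ (Icc (-(3 * R)) (3 * R))ᶜ)ᶜ :=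
      compl_subset_compl.2 (prod_mono (compl_subset_compl.2 Ioo_subset_Icc_self)
        (compl_subset_compl.2 Ioo_subset_Icc_self))
    have hSm := measurableSet_compl_prod_compl (measurableSet_Icc (a := -(3 * R)) (b := 3 * R))
    have hA : ∫⁻ p in (Ωᶜ ×ˢ Ωᶜ)ᶜ, ENNReal.ofReal (|u p.1 - u p.2| * |φ p.1 - φ p.2|)
        * ENNReal.ofReal (K (p.1 - p.2)) ≤ ENNReal.ofReal (C0 * R ^ (1 - 2 * s)) := by
      refine (lintegral_mono_set hSsub).trans ((setLIntegral_kernel_le hK hKb hLam hSm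
        (F := fun p => |u p.1 - u p.2| * |φ p.1 - φ p.2|) ?_ (p := 2) (q := 0) (c := 2 / R)
        (d := 24 * R) (ρ := 3 * R) (by linarith) (by linarith) (by linarith) (by positivity)
        (by positivity) ?_ ?_).trans (ENNReal.ofReal_le_ofReal (le_of_eq ?_)))
      · have := hu.measurable
        have := hφc.measurable
        change Measurable fun p : ℝ × ℝ => ‖u p.1 - u p.2‖ * ‖φ p.1 - φ p.2‖
        fun_prop
      · intro t _
        refine (lintegral_slice_le_of_le_abs_sub hu hu1 (R := 3 * R) (c := |t| / R) (by linarith)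
          (by positivity) t (fun x => ?_)).trans (ENNReal.ofReal_le_ofReal (le_of_eq ?_))
        · have h1 := hφL (x + t) x
          rw [add_sub_cancel_left] at h1
          rw [mul_comm]
          exact mul_le_mul_of_nonneg_right h1 (abs_nonneg _)
        · rw [Real.rpow_two]; ring
      · intro t _
        refine (lintegral_slice_le_of_le (R := 3 * R) (c := 2) (by linarith) zero_le_two t
          (fun x => ?_)).trans (ENNReal.ofReal_le_ofReal (le_of_eq ?_))
        · have := mul_le_mul (hu2 (x + t) x) (hφd (x + t) x) (abs_nonneg _) zero_le_two
          linarith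
        · rw [Real.rpow_zero]; ring
      · rw [Real.mul_rpow (by norm_num) hR.le, Real.mul_rpow (by norm_num) hR.le, hC0]
        have e1 : R ^ (2 - 2 * s) = R * R ^ (1 - 2 * s) := by
          rw [show 2 - 2 * s = 1 + (1 - 2 * s) by ring, Real.rpow_add hR, Real.rpow_one]
        have e2 : R ^ (1 - 2 * s) = R * R ^ (0 - 2 * s) := by
          rw [show 1 - 2 * s = 1 + (0 - 2 * s) by ring, Real.rpow_add hR, Real.rpow_one]
        rw [e1, zero_sub, sub_zero, e2, zero_sub]
        field_simp
    have hB : ∫⁻ p in (Ωᶜ ×ˢ Ωᶜ)ᶜ, ENNReal.ofReal ((φ p.1 - φ p.2) ^ 2)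
        * ENNReal.ofReal (K (p.1 - p.2)) ≠ ⊤ := by
      refine ((lintegral_mono_set hSsub).trans (setLIntegral_kernel_le hK hKb hLam hSm
        (F := fun p => (φ p.1 - φ p.2) ^ 2) ?_ (p := 2) (q := 0) (c := (1 / R) ^ 2 * (12 * R))
        (d := 12 * R) (ρ := 1) (by linarith) (by linarith) one_pos (by positivity)
        (by positivity) ?_ ?_)).trans_lt ENNReal.ofReal_lt_top |>.ne
      · have := hφc.measurable
        fun_prop
      · intro t _
        refine (lintegral_slice_le_of_le (R := 3 * R) (c := (|t| / R) ^ 2) (by linarith)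
          (by positivity) t (fun x => ?_)).trans (ENNReal.ofReal_le_ofReal (le_of_eq ?_))
        · have h1 := hφL (x + t) x
          rw [add_sub_cancel_left] at h1
          rw [← sq_abs]
          gcongr
        · rw [Real.rpow_two]; ring
      · intro t _
        refine (lintegral_slice_le_of_le (R := 3 * R) (c := 1) (by linarith) zero_le_one t
          (fun x => ?_)).trans (ENNReal.ofReal_le_ofReal (le_of_eq ?_))
        · have := hφd (x + t) x
          rw [← sq_abs]
          exact pow_le_one₀ (abs_nonneg _) this
        · rw [Real.rpow_zero]; ring
    have hG := ((hmin (3 * R) (by positivity)).lintegral_mul_neg_deriv_le (φ := φ) (M := M) hK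
      (by simp) hW.continuous hWn hu.measurable hφc.measurable
      (fun x hx => hφsupp x fun h => hx ⟨by linarith [h.1], h.2⟩) hM0
      (fun x ε hε => by
        refine (hM (u x) (abs_le.1 (hu1 x)) (ε * φ x)
          ⟨mul_nonneg hε.1 (hφ0 x), mul_le_one₀ hε.2 (hφ0 x) (hφ1 x)⟩).trans ?_
        have := mul_le_of_le_one_right hε.1 (hφ1 x)
        have h0 := mul_nonneg hε.1 (hφ0 x)
        gcongr) hpos hB).trans hA
    have hlow : ENNReal.ofReal (c * (1 - u (5 / 2 * R)) / 2 * R) ≤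
        ∫⁻ x in Ω, ENNReal.ofReal (φ x * -deriv W (u x)) := by
      calc ENNReal.ofReal (c * (1 - u (5 / 2 * R)) / 2 * R)
          = ∫⁻ _ in Icc (3 / 2 * R) (5 / 2 * R),
              ENNReal.ofReal (c * (1 - u (5 / 2 * R)) / 2) := by
            rw [setLIntegral_const, Real.volume_Icc, ← ENNReal.ofReal_mul
              (div_nonneg (mul_nonneg hc.le (hu1' _)) zero_le_two)]
            congr 2; ring
        _ ≤ ∫⁻ x in Icc (3 / 2 * R) (5 / 2 * R), ENNReal.ofReal (φ x * -deriv W (u x)) := by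
            refine setLIntegral_mono' measurableSet_Icc fun x hx =>
              ENNReal.ofReal_le_ofReal ?_
            have h1 : 1 / 2 ≤ φ x := by
              refine le_max_of_le_left ?_
              have : |x - 2 * R| / R ≤ 1 / 2 := by
                rw [div_le_iff₀ hR, abs_le]
                constructor <;> linarith [hx.1, hx.2]
              linarith
            have h2 : c * (1 - u (5 / 2 * R)) ≤ -deriv W (u x) :=
              (mul_le_mul_of_nonneg_left (by linarith [hu hx.2]) hc.le).trans
                (hX x (by linarith [hx.1]))
            have h3 := mul_nonneg hc.le (hu1' (5 / 2 * R))
            calc c * (1 - u (5 / 2 * R)) / 2 = 1 / 2 * (c * (1 - u (5 / 2 * R))) := by ring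
              _ ≤ _ := mul_le_mul h1 h2 h3 (hφ0 x)
        _ ≤ _ := lintegral_mono_set (show Icc (3 / 2 * R) (5 / 2 * R) ⊆ Ω from
            fun x hx => ⟨by linarith [hx.1], by linarith [hx.2]⟩)
    have hfin := (ENNReal.ofReal_le_ofReal_iff (by positivity)).1 (hlow.trans hG)
    rw [show 1 - 2 * s = 1 + -(2 * s) by ring, Real.rpow_add hR, Real.rpow_one] at hfin
    have h5 : c * (1 - u (5 / 2 * R)) / 2 ≤ C0 * R ^ (-(2 * s)) := by
      refine le_of_mul_le_mul_right (hfin.trans (le_of_eq ?_)) hR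
      ring
    rw [show 2 * C0 / c * R ^ (-(2 * s)) = 2 * C0 * R ^ (-(2 * s)) / c by ring, le_div_iff₀ hc]
    linarith
  set Y := max X 1 with hY
  have hY0 : 0 < Y := zero_lt_one.trans_le (le_max_right _ _)
  set D1 := 2 * C0 / c * (2 / 5 : ℝ) ^ (-(2 * s))
  set D2 := 2 * (5 / 2 * Y) ^ (2 * s)
  have hD1 : 0 ≤ D1 := by positivity
  have hD2 : 0 ≤ D2 := by positivity
  refine ⟨max D1 D2, le_max_of_le_left hD1, fun x hx => ?_⟩
  rcases le_total (5 / 2 * Y) x with h | h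
  · have := main (2 / 5 * x) (by positivity) ((le_max_left X 1).trans (by linarith))
    rw [show 5 / 2 * (2 / 5 * x) = x by ring, Real.mul_rpow (by norm_num) hx.le,
      ← mul_assoc] at this
    exact this.trans (mul_le_mul_of_nonneg_right (le_max_left _ _) (by positivity))
  · have h1 : 1 - u x ≤ 2 := by linarith [neg_abs_le (u x), hu1 x]
    refine h1.trans (le_trans ?_ (mul_le_mul_of_nonneg_right (le_max_right _ _) (by positivity)))
    rw [Real.rpow_neg hx.le, ← div_eq_mul_inv, le_div_iff₀ (by positivity)]
    exact mul_le_mul_of_nonneg_left (Real.rpow_le_rpow hx.le h (by positivity)) zero_le_two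

theorem one_le_log_of_three_le {R : ℝ} (hR : 3 ≤ R) : 1 ≤ Real.log R := by
  rw [Real.le_log_iff_exp_le (by linarith)]
  linarith [Real.exp_one_lt_d9]

theorem one_le_Psi {s R : ℝ} (hR : 3 ≤ R) : 1 ≤ Psi s R := by
  unfold Psi
  split_ifs with h1 h2
  · exact Real.one_le_rpow (by linarith) (by linarith)
  · exact one_le_log_of_three_le hR
  · exact le_rfl

theorem lintegral_sq_sub_kernel_le_of_lt_half {K u : ℝ → ℝ} {s Lam : ℝ} (hs0 : 0 < s)
    (hs : s < 1 / 2) (hLam : 0 ≤ Lam) (hK : Measurable K)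
    (hKb : ∀ᵐ t, K t ≤ Lam * |t| ^ (-1 - 2 * s)) (hu : Monotone u) (hu1 : ∀ x, |u x| ≤ 1)
    {R : ℝ} (hR : 0 < R) :
    ∫⁻ p in ((Icc (-R) R)ᶜ ×ˢ (Icc (-R) R)ᶜ)ᶜ, ENNReal.ofReal ((u p.1 - u p.2) ^ 2)
      * ENNReal.ofReal (K (p.1 - p.2)) ≤
      ENNReal.ofReal (2 * Lam * (4 / (1 - 2 * s) + 16 / (2 * s)) * R ^ (1 - 2 * s)) := by
  have hum := hu.measurable
  have hu2 : ∀ x y, |u x - u y| ≤ 2 := fun x y =>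
    (abs_sub _ _).trans (by linarith [hu1 x, hu1 y])
  refine (setLIntegral_kernel_le hK hKb hLam (measurableSet_compl_prod_compl measurableSet_Icc)
    (F := fun p => (u p.1 - u p.2) ^ 2) (by fun_prop) (p := 1) (q := 0) (c := 4) (d := 16 * R)
    (ρ := R) (by linarith) (by linarith) hR (by norm_num) (by positivity) ?_ ?_).trans
    (ENNReal.ofReal_le_ofReal (le_of_eq ?_))
  · intro t _
    refine (lintegral_slice_le_of_le_abs_sub hu hu1 hR.le (c := 2) zero_le_two t
      (fun x => ?_)).trans (ENNReal.ofReal_le_ofReal (le_of_eq ?_))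
    · rw [← sq_abs, sq]
      exact mul_le_mul_of_nonneg_right (hu2 _ _) (abs_nonneg _)
    · rw [Real.rpow_one]; ring
  · intro t _
    refine (lintegral_slice_le_of_le hR.le (c := 4) (by norm_num) t
      (fun x => ?_)).trans (ENNReal.ofReal_le_ofReal (le_of_eq ?_))
    · rw [← sq_abs]
      nlinarith [hu2 (x + t) x, abs_nonneg (u (x + t) - u x)]
    · rw [Real.rpow_zero]; ring
  · have e : R ^ (1 - 2 * s) = R * R ^ (0 - 2 * s) := by
      rw [show 1 - 2 * s = 1 + (0 - 2 * s) by ring, Real.rpow_add hR, Real.rpow_one]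
    rw [e, sub_zero]
    ring

theorem le_rpow_mul_rpow_one_sub {a b m q : ℝ} (hq0 : 0 ≤ q) (hq1 : q ≤ 1) (hm : 0 ≤ m)
    (ha : m ≤ a) (hb : m ≤ b) : m ≤ a ^ q * b ^ (1 - q) := by
  rcases hm.eq_or_lt with rfl | hm'
  · exact mul_nonneg (Real.rpow_nonneg ha _) (Real.rpow_nonneg hb _)
  · calc m = m ^ q * m ^ (1 - q) := by
          rw [← Real.rpow_add hm', add_sub_cancel, Real.rpow_one]
      _ ≤ a ^ q * b ^ (1 - q) :=
          mul_le_mul (Real.rpow_le_rpow hm ha hq0) (Real.rpow_le_rpow hm hb (by linarith))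
            (by positivity) (Real.rpow_nonneg (hm.trans ha) _)

theorem lintegral_sq_sub_kernel_le {K u : ℝ → ℝ} {s Lam L q : ℝ} (hs1 : s < 1)
    (hLam : 0 ≤ Lam) (hK : Measurable K)
    (hKb : ∀ᵐ t, K t ≤ Lam * |t| ^ (-1 - 2 * s)) (hu : Monotone u) (hu1 : ∀ x, |u x| ≤ 1)
    (hL : 0 ≤ L) (huL : ∀ x y, |u x - u y| ≤ L * |x - y|)
    (hq0 : 0 ≤ q) (hq1 : q ≤ 1) (hqs : q < 2 * s) {R : ℝ} (hR : 0 < R) :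
    ∫⁻ p in ((Icc (-R) R)ᶜ ×ˢ (Icc (-R) R)ᶜ)ᶜ, ENNReal.ofReal ((u p.1 - u p.2) ^ 2)
      * ENNReal.ofReal (K (p.1 - p.2)) ≤
      ENNReal.ofReal (2 * Lam * (2 * L / (2 - 2 * s)
        + 4 * (4 * R) ^ (1 - q) / (2 * s - q))) := by
  have hum := hu.measurable
  have hu2 : ∀ x y, |u x - u y| ≤ 2 := fun x y =>
    (abs_sub _ _).trans (by linarith [hu1 x, hu1 y])
  refine (setLIntegral_kernel_le hK hKb hLam (measurableSet_compl_prod_compl measurableSet_Icc)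
    (F := fun p => (u p.1 - u p.2) ^ 2) (by fun_prop) (p := 2) (q := q) (c := 2 * L)
    (d := 4 * (4 * R) ^ (1 - q)) (ρ := 1) (by linarith) hqs one_pos (by positivity)
    (by positivity) ?_ ?_).trans (ENNReal.ofReal_le_ofReal (le_of_eq ?_))
  · intro t _
    refine (lintegral_slice_le_of_le_abs_sub hu hu1 hR.le (c := L * |t|) (by positivity) t
      (fun x => ?_)).trans (ENNReal.ofReal_le_ofReal (le_of_eq ?_))
    · have h := huL (x + t) x
      rw [add_sub_cancel_left] at h
      rw [← sq_abs, sq]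
      exact mul_le_mul_of_nonneg_right h (abs_nonneg _)
    · rw [Real.rpow_two]; ring
  · intro t _
    have h1 := lintegral_slice_le_of_le_abs_sub hu hu1 hR.le (c := 2) zero_le_two t
      (f := fun x => (u (x + t) - u x) ^ 2) (fun x => by
        rw [← sq_abs, sq]
        exact mul_le_mul_of_nonneg_right (hu2 _ _) (abs_nonneg _))
    have h2 := lintegral_slice_le_of_le hR.le (c := 4) (by norm_num) t
      (f := fun x => (u (x + t) - u x) ^ 2) (fun x => by
        rw [← sq_abs]
        nlinarith [hu2 (x + t) x, abs_nonneg (u (x + t) - u x)])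
    refine (le_min h1 h2).trans ?_
    rw [← ENNReal.ofReal_min]
    refine ENNReal.ofReal_le_ofReal ?_
    have h3 := le_rpow_mul_rpow_one_sub hq0 hq1 (m := min |t| (4 * R)) (by positivity)
      (min_le_left _ _) (min_le_right _ _)
    calc min (2 * (2 * |t|)) (4 * (4 * R)) = 4 * min |t| (4 * R) := by
          rw [mul_min_of_nonneg _ _ (by norm_num : (0 : ℝ) ≤ 4)]; congr 1; ring
      _ ≤ 4 * (|t| ^ q * (4 * R) ^ (1 - q)) := by linarith
      _ = _ := by ring
  · simp only [Real.one_rpow]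
    ring

theorem exists_lintegral_sq_sub_kernel_le_Psi {K u : ℝ → ℝ} {s Lam L : ℝ} (hs0 : 0 < s)
    (hs1 : s < 1) (hLam : 0 ≤ Lam) (hK : Measurable K)
    (hKb : ∀ᵐ t, K t ≤ Lam * |t| ^ (-1 - 2 * s)) (hu : Monotone u) (hu1 : ∀ x, |u x| ≤ 1)
    (hL : 0 ≤ L) (huL : ∀ x y, |u x - u y| ≤ L * |x - y|) :
    ∃ C, 0 ≤ C ∧ ∀ R, 3 ≤ R →
      ∫⁻ p in ((Icc (-R) R)ᶜ ×ˢ (Icc (-R) R)ᶜ)ᶜ, ENNReal.ofReal ((u p.1 - u p.2) ^ 2)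
        * ENNReal.ofReal (K (p.1 - p.2)) ≤ ENNReal.ofReal (C * Psi s R) := by
  rcases lt_trichotomy s (1 / 2) with h | h | h
  · have : 0 < 1 - 2 * s := by linarith
    refine ⟨2 * Lam * (4 / (1 - 2 * s) + 16 / (2 * s)), by positivity, fun R hR => ?_⟩
    rw [Psi, if_pos h]
    exact lintegral_sq_sub_kernel_le_of_lt_half hs0 h hLam hK hKb hu hu1 (by linarith)
  · refine ⟨2 * Lam * (2 * L + 4 * Real.exp (Real.log 4 + 1)), by positivity, fun R hR => ?_⟩
    have hlog := one_le_log_of_three_le hR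
    have hR0 : 0 < R := by linarith
    have hinv : 1 / Real.log R ≤ 1 := by rwa [div_le_one₀ (by linarith)]
    have hinv0 : 0 < 1 / Real.log R := by positivity
    refine (lintegral_sq_sub_kernel_le (q := 1 - 1 / Real.log R) hs1 hLam hK hKb hu hu1 hL huL
      (by linarith) (by linarith) (by rw [h]; linarith) hR0).trans
      (ENNReal.ofReal_le_ofReal ?_)
    rw [Psi, if_neg h.not_lt, if_pos h, sub_sub_cancel, h, mul_assoc (2 * Lam)]
    refine mul_le_mul_of_nonneg_left ?_ (by positivity)
    have e1 : (4 * R) ^ (1 / Real.log R) ≤ Real.exp (Real.log 4 + 1) := by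
      rw [Real.rpow_def_of_pos (by positivity), Real.log_mul (by norm_num) hR0.ne']
      refine Real.exp_le_exp.2 ?_
      have h4 : 0 ≤ Real.log 4 := Real.log_nonneg (by norm_num)
      rw [add_mul, mul_one_div_cancel (by linarith)]
      linarith [mul_le_of_le_one_right h4 hinv]
    have e2 : 4 * (4 * R) ^ (1 / Real.log R) / (2 * (1 / 2) - (1 - 1 / Real.log R))
        = 4 * (4 * R) ^ (1 / Real.log R) * Real.log R := by
      rw [show 2 * (1 / 2) - (1 - 1 / Real.log R) = 1 / Real.log R by ring, div_div_eq_mul_div,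
        div_one]
    rw [e2, add_mul]
    refine add_le_add ?_ (by gcongr)
    rw [show 2 * L / (2 - 2 * (1 / 2)) = 2 * L by ring]
    exact le_mul_of_one_le_right (by positivity) hlog
  · have h1 : 0 < 2 - 2 * s := by linarith
    have h2 : 0 < 2 * s - 1 := by linarith
    refine ⟨2 * Lam * (2 * L / (2 - 2 * s) + 4 / (2 * s - 1)), by positivity, fun R hR => ?_⟩
    refine (lintegral_sq_sub_kernel_le (q := 1) hs1 hLam hK hKb hu hu1 hL huL
      zero_le_one le_rfl (by linarith) (by linarith)).trans
      (ENNReal.ofReal_le_ofReal (le_of_eq ?_))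
    rw [Psi, if_neg h.not_gt, if_neg h.ne', sub_self, Real.rpow_zero, mul_one, mul_one]

theorem exists_lintegral_Ioc_one_rpow_le_Psi {s : ℝ} :
    ∃ A, 0 ≤ A ∧ ∀ R, 3 ≤ R →
      ∫⁻ t in Ioc 1 R, ENNReal.ofReal (t ^ (-(2 * s))) ≤ ENNReal.ofReal (A * Psi s R) := by
  rcases lt_trichotomy s (1 / 2) with h | h | h
  · have : 0 < -(2 * s) + 1 := by linarith
    refine ⟨1 / (-(2 * s) + 1), by positivity, fun R hR => ?_⟩
    refine (lintegral_mono_set (Ioc_subset_Ioc_left zero_le_one)).trans ?_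
    rw [lintegral_Ioc_zero_rpow (by linarith) (by linarith), Psi, if_pos h,
      show 1 - 2 * s = -(2 * s) + 1 by ring]
    exact ENNReal.ofReal_le_ofReal (le_of_eq (by ring))
  · refine ⟨1, zero_le_one, fun R hR => ?_⟩
    rw [Psi, if_neg h.not_lt, if_pos h, one_mul, h, show -(2 * (1 / 2)) = (-1 : ℝ) by norm_num,
      lintegral_Ioc_one_rpow_neg_one (by linarith)]
  · refine ⟨-1 / (-(2 * s) + 1), div_nonneg_of_nonpos (by norm_num) (by linarith),
      fun R hR => ?_⟩
    refine (lintegral_mono_set Ioc_subset_Ioi_self).trans ?_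
    rw [lintegral_Ioi_rpow (by linarith) one_pos, Psi, if_neg h.not_gt, if_neg h.ne', mul_one,
      Real.one_rpow]

theorem exists_setLIntegral_le_Psi {w : ℝ → ℝ} {s M B : ℝ} (hM : 0 ≤ M) (hB : 0 ≤ B)
    (hwM : ∀ x, w x ≤ M) (hwB : ∀ x, 1 < |x| → w x ≤ B * |x| ^ (-(2 * s))) :
    ∃ C, 0 ≤ C ∧ ∀ R, 3 ≤ R →
      ∫⁻ x in Icc (-R) R, ENNReal.ofReal (w x) ≤ ENNReal.ofReal (C * Psi s R) := by
  obtain ⟨A, hA, hAR⟩ := exists_lintegral_Ioc_one_rpow_le_Psi (s := s)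
  refine ⟨2 * (M + B * A), by positivity, fun R hR => ?_⟩
  have hPsi := one_le_Psi (s := s) hR
  classical
  set h : ℝ → ℝ≥0∞ := fun t => (Ioc 0 1).indicator (fun _ => ENNReal.ofReal M) t
    + (Ioc 1 R).indicator (fun t => ENNReal.ofReal (B * t ^ (-(2 * s)))) t with hh
  rw [← lintegral_indicator measurableSet_Icc]
  have hne : ∀ᵐ t : ℝ, t ≠ 0 := by simp [ae_iff]
  refine (lintegral_le_two_mul_lintegral_Ioi (h := h) ?_).trans ?_
  · filter_upwards [hne] with x hx
    by_cases hxR : x ∈ Icc (-R) R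
    · rw [indicator_of_mem hxR]
      rcases le_or_gt |x| 1 with h1 | h1
      · refine le_add_right ?_
        rw [indicator_of_mem (show |x| ∈ Ioc 0 1 from ⟨abs_pos.2 hx, h1⟩)]
        exact ENNReal.ofReal_le_ofReal (hwM x)
      · refine le_add_left ?_
        rw [indicator_of_mem (show |x| ∈ Ioc 1 R from ⟨h1, abs_le.2 hxR⟩)]
        exact ENNReal.ofReal_le_ofReal (hwB x h1)
    · rw [indicator_of_notMem hxR]
      exact zero_le
  · have e1 : ∫⁻ t in Ioi 0, h t ≤ ENNReal.ofReal M + ENNReal.ofReal B *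
        ∫⁻ t in Ioc 1 R, ENNReal.ofReal (t ^ (-(2 * s))) := by
      refine (setLIntegral_le_lintegral _ _).trans (le_of_eq ?_)
      rw [hh, lintegral_add_left (measurable_const.indicator measurableSet_Ioc),
        lintegral_indicator measurableSet_Ioc, lintegral_indicator measurableSet_Ioc,
        setLIntegral_const, Real.volume_Ioc]
      simp only [ENNReal.ofReal_mul hB, sub_zero, ENNReal.ofReal_one, mul_one]
      rw [lintegral_const_mul _ (by fun_prop)]
    calc 2 * ∫⁻ t in Ioi 0, h t
        ≤ 2 * (ENNReal.ofReal M + ENNReal.ofReal B * ENNReal.ofReal (A * Psi s R)) := by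
          gcongr
          exact e1.trans (by gcongr; exact hAR R hR)
      _ = ENNReal.ofReal (2 * (M + B * (A * Psi s R))) := by
          rw [← ENNReal.ofReal_mul hB, ← ENNReal.ofReal_add hM (by positivity),
            ENNReal.ofReal_mul zero_le_two, ENNReal.ofReal_ofNat]
      _ ≤ _ := by
          refine ENNReal.ofReal_le_ofReal ?_
          nlinarith [mul_le_mul_of_nonneg_left hPsi hM]

theorem lintegral_slice_prod_compl_le {u : ℝ → ℝ} {L δ R t : ℝ} (hu : Monotone u)
    (hu1 : ∀ x, |u x| ≤ 1) (hodd : ∀ x, u (-x) = -u x) (hL : 0 ≤ L)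
    (huL : ∀ x y, |u x - u y| ≤ L * |x - y|) (hδ : 1 - u (R / 2) ≤ δ) (hδ0 : 0 ≤ δ)
    (ht : |t| ≤ R / 2) :
    ∫⁻ x in {x | (x + t, x) ∈ Icc (-R) R ×ˢ (Icc (-R) R)ᶜ}, ENNReal.ofReal ((u (x + t) - u x) ^ 2)
      ≤ ENNReal.ofReal (2 * (δ * L) * |t| ^ (2 : ℝ)) := by
  have ht1 := le_abs_self t
  have ht2 := neg_abs_le t
  have hsub : {x | (x + t, x) ∈ Icc (-R) R ×ˢ (Icc (-R) R)ᶜ} ⊆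
      Icc (-R - |t|) (-R) ∪ Icc R (R + |t|) := by
    rintro x ⟨⟨h1, h2⟩, h3⟩
    simp only at h1 h2 h3
    rcases lt_or_ge x (-R) with h | h
    · exact Or.inl ⟨by linarith, h.le⟩
    · have : R < x := not_le.1 fun h' => h3 ⟨h, h'⟩
      exact Or.inr ⟨this.le, by linarith⟩
  refine (lintegral_mono_set hsub).trans ?_
  calc _ ≤ ∫⁻ _ in Icc (-R - |t|) (-R) ∪ Icc R (R + |t|), ENNReal.ofReal (δ * (L * |t|)) := by
        refine setLIntegral_mono' (measurableSet_Icc.union measurableSet_Icc) fun x hx =>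
          ENNReal.ofReal_le_ofReal ?_
        have h1 := huL (x + t) x
        rw [add_sub_cancel_left] at h1
        have h2 : |u (x + t) - u x| ≤ δ := by
          have ha := abs_le.1 (hu1 x)
          have hb := abs_le.1 (hu1 (x + t))
          rw [abs_le]
          rcases hx with hx | hx
          · have e1 := hu (show x ≤ -(R / 2) by linarith [hx.2, abs_nonneg t])
            have e2 := hu (show x + t ≤ -(R / 2) by linarith [hx.2])
            rw [hodd] at e1 e2
            constructor <;> linarith
          · have e1 := hu (show R / 2 ≤ x by linarith [hx.1, abs_nonneg t])
            have e2 := hu (show R / 2 ≤ x + t by linarith [hx.1])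
            constructor <;> linarith
        rw [← sq_abs, sq]
        exact mul_le_mul h2 h1 (abs_nonneg _) hδ0
    _ ≤ ENNReal.ofReal (δ * (L * |t|)) * ENNReal.ofReal (2 * |t|) := by
        rw [setLIntegral_const]
        gcongr
        refine (measure_union_le _ _).trans ?_
        rw [Real.volume_Icc, Real.volume_Icc, ← ENNReal.ofReal_add (by linarith [abs_nonneg t])
          (by linarith [abs_nonneg t])]
        exact ENNReal.ofReal_le_ofReal (by linarith)
    _ = _ := by
        rw [← ENNReal.ofReal_mul (by positivity), Real.rpow_two]
        congr 1
        ring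

theorem prod_compl_subset_compl_prod_compl {α : Type*} (Ω : Set α) :
    Ω ×ˢ Ωᶜ ⊆ (Ωᶜ ×ˢ Ωᶜ)ᶜ := fun _ hp hq => hq.1 hp.1

theorem lintegral_prod_compl_kernel_le {K u : ℝ → ℝ} {s Lam L C : ℝ} (hs : 1 / 2 ≤ s)
    (hs1 : s < 1) (hLam : 0 ≤ Lam) (hK : Measurable K)
    (hKb : ∀ᵐ t, K t ≤ Lam * |t| ^ (-1 - 2 * s)) (hu : Monotone u) (hu1 : ∀ x, |u x| ≤ 1)
    (hodd : ∀ x, u (-x) = -u x) (hL : 0 ≤ L) (huL : ∀ x y, |u x - u y| ≤ L * |x - y|)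
    (hC : 0 ≤ C) (hdec : ∀ x > 0, 1 - u x ≤ C * x ^ (-(2 * s))) {R : ℝ} (hR : 2 ≤ R) :
    ∫⁻ p in Icc (-R) R ×ˢ (Icc (-R) R)ᶜ, ENNReal.ofReal ((u p.1 - u p.2) ^ 2)
      * ENNReal.ofReal (K (p.1 - p.2)) ≤
      ENNReal.ofReal (2 * Lam * (2 * C * L / (2 - 2 * s) + 32 / (2 * s)) * 2
        * R ^ (1 - 2 * s)) := by
  have hum := hu.measurable
  have hR0 : 0 < R := by linarith
  have hu2 : ∀ x y, |u x - u y| ≤ 2 := fun x y =>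
    (abs_sub _ _).trans (by linarith [hu1 x, hu1 y])
  have h22 : 0 < 2 - 2 * s := by linarith
  refine (setLIntegral_kernel_le hK hKb hLam (measurableSet_Icc.prod measurableSet_Icc.compl)
    (F := fun p => (u p.1 - u p.2) ^ 2) (by fun_prop) (p := 2) (q := 0)
    (c := 2 * (C * (R / 2) ^ (-(2 * s)) * L)) (d := 16 * R)
    (ρ := R / 2) (by linarith) (by linarith) (by linarith) (by positivity) (by positivity)
    ?_ ?_).trans (ENNReal.ofReal_le_ofReal ?_)
  · intro t ht
    exact lintegral_slice_prod_compl_le hu hu1 hodd hL huL (hdec _ (by linarith))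
      (by positivity) ht
  · intro t _
    refine (lintegral_mono_set (preimage_mono (f := fun x => (x + t, x))
      (prod_compl_subset_compl_prod_compl (Icc (-R) R)))).trans
      ((lintegral_slice_le_of_le hR0.le (c := 4) (by norm_num) t
      (fun x => ?_)).trans (ENNReal.ofReal_le_ofReal (le_of_eq ?_)))
    · rw [← sq_abs]
      nlinarith [hu2 (x + t) x, abs_nonneg (u (x + t) - u x)]
    · rw [Real.rpow_zero]; ring
  · obtain ⟨y, rfl⟩ : ∃ y, R = 2 * y := ⟨R / 2, by ring⟩
    have hy : 1 ≤ y := by linarith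
    have hy0 : 0 < y := by linarith
    rw [mul_div_cancel_left₀ y two_ne_zero]
    have e1 : y ^ (-(2 * s)) * y ^ (2 - 2 * s) ≤ y ^ (1 - 2 * s) := by
      rw [← Real.rpow_add hy0]
      exact Real.rpow_le_rpow_of_exponent_le hy (by linarith)
    have e2 : y * y ^ (0 - 2 * s) = y ^ (1 - 2 * s) := by
      rw [show 1 - 2 * s = 1 + (0 - 2 * s) by ring, Real.rpow_add hy0, Real.rpow_one]
    have e3 : y ^ (1 - 2 * s) ≤ 2 * (2 * y) ^ (1 - 2 * s) := by
      rw [Real.mul_rpow zero_le_two hy0.le, ← mul_assoc]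
      refine le_mul_of_one_le_left (by positivity) ?_
      calc (1 : ℝ) ≤ 2 ^ (1 + (1 - 2 * s)) := Real.one_le_rpow one_le_two (by linarith)
        _ = _ := by rw [Real.rpow_add two_pos, Real.rpow_one]
    calc _ = 2 * Lam * (2 * C * L / (2 - 2 * s) * (y ^ (-(2 * s)) * y ^ (2 - 2 * s))
            + 32 / (2 * s) * (y * y ^ (0 - 2 * s))) := by rw [sub_zero]; ring
      _ ≤ 2 * Lam * (2 * C * L / (2 - 2 * s) * y ^ (1 - 2 * s)
            + 32 / (2 * s) * y ^ (1 - 2 * s)) := by rw [e2]; gcongr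
      _ = 2 * Lam * (2 * C * L / (2 - 2 * s) + 32 / (2 * s)) * y ^ (1 - 2 * s) := by ring
      _ ≤ 2 * Lam * (2 * C * L / (2 - 2 * s) + 32 / (2 * s)) * (2 * (2 * y) ^ (1 - 2 * s)) := by
          gcongr
      _ = _ := by ring

/-- Tail-energy upper bound `∫_{-R}^R ∫_{ℝ∖[-R,R]} |u₀(x)-u₀(y)|² K(x-y) ≤ C R^{1-2s}` for
large `R`, and finiteness of `G*(u₀) = limsup_{R→∞} E_K(u₀,[-R,R])/Ψ_s(R)`. -/
theorem theorem1_upper_tail_energy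
    (s lam Lam r0 : ℝ) (hs0 : 0 < s) (hs1 : s < 1)
    (hlam : 0 < lam) (hlamLam : lam ≤ Lam) (hr0 : 0 < r0)
    (K : ℝ → ℝ) (hKmeas : Measurable K)
    (hK1 : KernelSymm volume K) (hK2 : KernelK2 volume K 1 s lam Lam r0)
    (W : ℝ → ℝ) (hWreg : ∃ β > 0, IsC2HolderLoc β W)
    (hWnonneg : ∀ r, 0 ≤ W r)
    (hW1 : ∀ r ∈ Ioo (-1 : ℝ) 1, 0 < W r)
    (hW2a : W 1 = 0) (hW2b : W (-1) = 0)
    (hW2c : deriv W 1 = 0) (hW2d : deriv W (-1) = 0)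
    (hW3a : 0 < deriv (deriv W) 1) (hW3b : 0 < deriv (deriv W) (-1))
    (hW4 : ∀ r ∈ Icc (-1 : ℝ) 1, W (-r) = W r)
    -- `u₀` is the minimizer given by Theorem 1:
    (u0 : ℝ → ℝ)
    (hu0range : ∀ x, u0 x ∈ Ioo (-1 : ℝ) 1)
    (hu0odd : ∀ x, u0 (-x) = -u0 x)
    (hu0mono : StrictMono u0)
    (hu0zero : u0 0 = 0)
    (hu0top : Tendsto u0 atTop (𝓝 1)) (hu0bot : Tendsto u0 atBot (𝓝 (-1)))
    (hu0reg : ∃ α > 0, IsCHolder (1 + 2 * s + α) u0)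
    (hu0min : IsClassAMinimizer volume K W u0)
    (hu0sol : ∀ x : ℝ, opLK volume K u0 x = deriv W (u0 x))
    :
    (∃ C : ℝ, 1 ≤ C ∧ ∃ R1 : ℝ, 0 < R1 ∧ ∀ R : ℝ, R1 ≤ R →
      (∫⁻ p : ℝ × ℝ in (Icc (-R) R ×ˢ (Icc (-R) R)ᶜ),
          ENNReal.ofReal ((u0 p.1 - u0 p.2) ^ 2 * K (p.1 - p.2)))
        ≤ ENNReal.ofReal (C * R ^ (1 - 2 * s))) ∧
    Filter.limsup
        (fun R : ℝ => nlEnergy volume K W u0 (Icc (-R) R) / ENNReal.ofReal (Psi s R)) atTop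
      < ⊤ := by
  obtain ⟨β, -, hWc2, -⟩ := hWreg
  obtain ⟨α, hα, hreg⟩ := hu0reg
  have hLam : 0 ≤ Lam := hlam.le.trans hlamLam
  have hu : Monotone u0 := hu0mono.monotone
  have hu1 : ∀ x, |u0 x| ≤ 1 := fun x => abs_le.2 ⟨(hu0range x).1.le, (hu0range x).2.le⟩
  have hKb : ∀ᵐ t, K t ≤ Lam * |t| ^ (-1 - 2 * s) := by
    filter_upwards [hK2] with t ht
    simpa using ht.1
  obtain ⟨L, hL, huL⟩ := IsCHolder.exists_abs_sub_le (by linarith) hreg hu1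
  obtain ⟨c, hc, hcW⟩ := exists_mul_one_sub_le_neg_deriv hWc2 hW2c hW3a
  obtain ⟨X, hX⟩ := eventually_atTop.1 (hu0top.eventually hcW)
  obtain ⟨C, hC, hdec⟩ := exists_one_sub_le_rpow hs0 hs1 hLam hKmeas hKb hWc2 hWnonneg hu hu1
    (fun r hr => hu0min _ isOpen_Ioo (isConnected_Ioo (by linarith)) (Metric.isBounded_Ioo _ _))
    hc (fun x hx => hX x hx (hu0range x).2.le)
  obtain ⟨M, hM, hWM⟩ := exists_le_mul_one_sub hWc2 hW2a
  obtain ⟨A, hA, hkin⟩ := exists_lintegral_sq_sub_kernel_le_Psi hs0 hs1 hLam hKmeas hKb hu hu1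
    hL huL
  have hrange : ∀ x, u0 x ∈ Icc (-1 : ℝ) 1 := fun x => Ioo_subset_Icc_self (hu0range x)
  have hWabs : ∀ x, W (u0 x) = W (u0 |x|) := fun x => by
    rcases abs_choice x with h | h
    · rw [h]
    · rw [h, hu0odd, hW4 _ (hrange x)]
  obtain ⟨B, hB, hpot⟩ := exists_setLIntegral_le_Psi (w := fun x => W (u0 x)) (s := s)
    (M := M * 2) (B := M * C) (by positivity) (by positivity)
    (fun x => (hWM _ (hrange x)).trans
      (mul_le_mul_of_nonneg_left (by linarith [(hu0range x).1]) hM))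
    (fun x hx => by
      rw [hWabs, mul_assoc]
      exact (hWM _ (hrange _)).trans
        (mul_le_mul_of_nonneg_left (hdec _ (zero_lt_one.trans hx)) hM))
  have hsplit : ∀ p : ℝ × ℝ, ENNReal.ofReal ((u0 p.1 - u0 p.2) ^ 2 * K (p.1 - p.2)) =
      ENNReal.ofReal ((u0 p.1 - u0 p.2) ^ 2) * ENNReal.ofReal (K (p.1 - p.2)) :=
    fun p => ENNReal.ofReal_mul (sq_nonneg _)
  refine ⟨?_, ?_⟩
  · simp only [hsplit]
    obtain ⟨D, hD⟩ : ∃ D, ∀ R, 3 ≤ R → (∫⁻ p : ℝ × ℝ in (Icc (-R) R ×ˢ (Icc (-R) R)ᶜ),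
        ENNReal.ofReal ((u0 p.1 - u0 p.2) ^ 2) * ENNReal.ofReal (K (p.1 - p.2)))
        ≤ ENNReal.ofReal (D * R ^ (1 - 2 * s)) := by
      rcases lt_or_ge s (1 / 2) with h | h
      · refine ⟨A, fun R hR => (lintegral_mono_set
          (prod_compl_subset_compl_prod_compl _)).trans ((hkin R hR).trans (le_of_eq ?_))⟩
        rw [Psi, if_pos h]
      · exact ⟨_, fun R hR => lintegral_prod_compl_kernel_le h hs1 hLam hKmeas hKb hu hu1
          hu0odd hL huL hC hdec (by linarith)⟩
    refine ⟨max 1 D, le_max_left _ _, 3, by norm_num, fun R hR => (hD R hR).trans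
      (ENNReal.ofReal_le_ofReal ?_)⟩
    exact mul_le_mul_of_nonneg_right (le_max_right _ _) (Real.rpow_nonneg (by linarith) _)
  · refine (limsup_le_of_le (a := ENNReal.ofReal (A + B)) isCobounded_le_of_bot
      (eventually_atTop.2 ⟨3, fun R hR => ?_⟩)).trans_lt ENNReal.ofReal_lt_top
    have hPsi := one_le_Psi (s := s) hR
    have hPsi0 : 0 ≤ Psi s R := by linarith
    refine ENNReal.div_le_of_le_mul ?_
    rw [← ENNReal.ofReal_mul (by positivity), add_mul,
      ENNReal.ofReal_add (by positivity) (by positivity), nlEnergy]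
    simp only [hsplit, ← Measure.volume_eq_prod]
    refine add_le_add ((mul_le_of_le_one_left (by positivity) ?_).trans (hkin R hR)) (hpot R hR)
    rw [one_div]
    exact ENNReal.inv_le_one.2 (by norm_num)

end
end

section
/- Let N = 1 and s ∈ (0,1). Assume K satisfies (K1) and the stronger ellipticity condition (K2'), and W satisfies (W1)–(W4); let u0 be the minimizer of Theorem 1 (odd, strictly increasing, u0 : ℝ → (−1,1) of class C^{1+2s+α}(ℝ) for some α > 0, lim_{x→±∞} u0(x) = ±1, solving L_K u0 = W'(u0) pointwise on ℝ). Then there exist constants C ≥ 1 and R1 > 0 such that for every R ≥ R1 one has ∫_{−R}^{R} ∫_{ℝ∖[−R,R]} |u0(x) − u0(y)|² K(x−y) dx dy ≥ C^{−1}·R^{1−2s}, and moreover G_*(u0) := liminf_{R→+∞} E_K(u0,[−R,R]) / Ψ_s(R) > 0. -/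
open MeasureTheory Filter Topology Set
open scoped ENNReal NNReal

noncomputable section

lemma KernelK2'.ae_prod_sub {K : ℝ → ℝ} {s lam Lam : ℝ} (hK : KernelK2' volume K 1 s lam Lam) :
    ∀ᵐ p : ℝ × ℝ, lam * |p.1 - p.2| ^ (-1 - 2 * s) ≤ K (p.1 - p.2) := by
  have hsub : Measure.QuasiMeasurePreserving (fun p : ℝ × ℝ => p.1 - p.2)
      ((volume : Measure ℝ).prod volume) volume := quasiMeasurePreserving_sub _ _
  have hae : ∀ᵐ z : ℝ, lam * |z| ^ (-1 - 2 * s) ≤ K z := by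
    filter_upwards [hK] with z hz
    simpa using hz.1
  exact hsub.ae hae

/-- Lower bound for the interaction density at a point of the product, given bounds on the
increment of `u` and on the distance. -/
lemma sq_mul_kernel_ge {s lam d δ r k v : ℝ} (hs : 0 < s) (hlam : 0 < lam) (hδ : 0 ≤ δ)
    (hr : 0 < |r|) (hd : |r| ≤ d) (hv : δ ≤ v) (hk : lam * |r| ^ (-1 - 2 * s) ≤ k) :
    δ ^ 2 * (lam * d ^ (-1 - 2 * s)) ≤ v ^ 2 * k := by
  have hpow : d ^ (-1 - 2 * s) ≤ |r| ^ (-1 - 2 * s) :=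
    Real.rpow_le_rpow_of_nonpos hr hd (by linarith)
  have hd0 : 0 ≤ d ^ (-1 - 2 * s) := Real.rpow_nonneg (hr.le.trans hd) _
  have hkd : lam * d ^ (-1 - 2 * s) ≤ k :=
    (mul_le_mul_of_nonneg_left hpow hlam.le).trans hk
  have : δ ^ 2 ≤ v ^ 2 := pow_le_pow_left₀ hδ hv 2
  exact mul_le_mul this hkd (by positivity) (by positivity)

section Interaction

variable {s lam Lam M : ℝ} {K u : ℝ → ℝ}

/-- The interaction between `[-R, R]` and its complement is at least of order `R ^ (1 - 2 s)`. -/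
lemma tail_interaction_ge (hs : 0 < s) (hlam : 0 < lam)
    (hK : KernelK2' volume K 1 s lam Lam) (hodd : ∀ x, u (-x) = -u x)
    (hnn : ∀ x, 0 ≤ x → 0 ≤ u x) (hM : ∀ x, M ≤ x → 1 / 2 ≤ u x)
    {R : ℝ} (hR0 : 0 < R) (hR : M ≤ R) :
    ENNReal.ofReal (1 / 4 * lam * 3 ^ (-1 - 2 * s) * R ^ (1 - 2 * s))
      ≤ ∫⁻ p : ℝ × ℝ in (Icc (-R) R ×ˢ (Icc (-R) R)ᶜ),
          ENNReal.ofReal ((u p.1 - u p.2) ^ 2 * K (p.1 - p.2)) := by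
  set c : ℝ := (1 / 2) ^ 2 * (lam * (3 * R) ^ (-1 - 2 * s)) with hc
  have hc0 : 0 ≤ c := by positivity
  have hsub : Icc 0 R ×ˢ Ico (-(2 * R)) (-R) ⊆ Icc (-R) R ×ˢ (Icc (-R) R)ᶜ := by
    rintro ⟨x, y⟩ ⟨⟨hx0, hx1⟩, hy0, hy1⟩
    refine ⟨⟨by linarith, hx1⟩, fun h => ?_⟩
    exact absurd h.1 (not_le.2 hy1)
  have hval : 1 / 4 * lam * 3 ^ (-1 - 2 * s) * R ^ (1 - 2 * s) = c * (R * R) := by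
    have h1 : R ^ (1 - 2 * s) = R ^ (-1 - 2 * s) * (R * R) := by
      rw [show 1 - 2 * s = (-1 - 2 * s) + 2 by ring, Real.rpow_add hR0, Real.rpow_two, sq]
    rw [hc, Real.mul_rpow (by norm_num) hR0.le, h1]
    ring
  calc ENNReal.ofReal (1 / 4 * lam * 3 ^ (-1 - 2 * s) * R ^ (1 - 2 * s))
      = ∫⁻ _ in Icc 0 R ×ˢ Ico (-(2 * R)) (-R), ENNReal.ofReal c
          ∂(volume : Measure (ℝ × ℝ)) := by
        rw [setLIntegral_const, Measure.volume_eq_prod, Measure.prod_prod, Real.volume_Icc,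
          Real.volume_Ico, hval, ENNReal.ofReal_mul hc0, ENNReal.ofReal_mul hR0.le]
        ring_nf
    _ ≤ ∫⁻ p : ℝ × ℝ in Icc 0 R ×ˢ Ico (-(2 * R)) (-R),
          ENNReal.ofReal ((u p.1 - u p.2) ^ 2 * K (p.1 - p.2)) := by
        refine lintegral_mono_ae ?_
        filter_upwards [ae_restrict_of_ae hK.ae_prod_sub,
          ae_restrict_mem (measurableSet_Icc.prod measurableSet_Ico)] with p hp hmem
        obtain ⟨⟨hx0, hx1⟩, hy0, hy1⟩ := hmem
        have habs : |p.1 - p.2| = p.1 - p.2 := abs_of_pos (by linarith)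
        have hu := hM (-p.2) (by linarith)
        rw [hodd] at hu
        have hu' := hnn p.1 hx0
        exact ENNReal.ofReal_le_ofReal (sq_mul_kernel_ge hs hlam (by norm_num)
          (by rw [habs]; linarith) (by rw [habs]; linarith) (by linarith) hp)
    _ ≤ _ := lintegral_mono_set hsub

/-- In the critical case `s = 1 / 2` the interaction on `[-R, R]` grows at least
logarithmically. -/
lemma log_interaction_ge (hlam : 0 < lam)
    (hK : KernelK2' volume K 1 (1 / 2) lam Lam) (hodd : ∀ x, u (-x) = -u x)
    (hM0 : 0 < M) (hM : ∀ x, M ≤ x → 1 / 2 ≤ u x) {R : ℝ} (hR : M ≤ R) :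
    ENNReal.ofReal (lam / 9 * Real.log (R / M))
      ≤ ∫⁻ p in (((Icc (-R) R)ᶜ ×ˢ (Icc (-R) R)ᶜ)ᶜ : Set (ℝ × ℝ)),
          ENNReal.ofReal ((u p.1 - u p.2) ^ 2 * K (p.1 - p.2)) := by
  set T : Set (ℝ × ℝ) := {p | p.1 ∈ Icc M R ∧ p.2 ∈ Icc (-(2 * p.1)) (-p.1)} with hT
  have hTm : MeasurableSet T := by
    have h₁ : IsClosed {p : ℝ × ℝ | -(2 * p.1) ≤ p.2} := isClosed_le (by fun_prop) (by fun_prop)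
    have h₂ : IsClosed {p : ℝ × ℝ | p.2 ≤ -p.1} := isClosed_le (by fun_prop) (by fun_prop)
    exact ((isClosed_Icc.preimage continuous_fst).inter (h₁.inter h₂)).measurableSet
  have hsub : T ⊆ ((Icc (-R) R)ᶜ ×ˢ (Icc (-R) R)ᶜ)ᶜ := by
    rintro ⟨x, y⟩ ⟨⟨hx0, hx1⟩, -⟩ h
    simp only [mem_prod, mem_compl_iff, mem_Icc] at h hx0 hx1
    exact h.1 ⟨by linarith, hx1⟩
  have hslice : ∀ x ∈ Icc M R,
      ∫⁻ y, T.indicator (fun p => ENNReal.ofReal (lam / 9 * (p.1 ^ 2)⁻¹)) (x, y)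
        = ENNReal.ofReal (lam / 9 * x⁻¹) := by
    intro x hx
    have hx0 : 0 < x := hM0.trans_le hx.1
    have heq : (fun y => T.indicator (fun p => ENNReal.ofReal (lam / 9 * (p.1 ^ 2)⁻¹)) (x, y))
        = (Icc (-(2 * x)) (-x)).indicator
            (fun _ => ENNReal.ofReal (lam / 9 * (x ^ 2)⁻¹)) := by
      ext y
      by_cases hy : y ∈ Icc (-(2 * x)) (-x)
      · rw [indicator_of_mem hy, indicator_of_mem (show (x, y) ∈ T from ⟨hx, hy⟩)]
      · rw [indicator_of_notMem hy, indicator_of_notMem (fun h : (x, y) ∈ T => hy h.2)]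
    rw [heq, lintegral_indicator_const measurableSet_Icc, Real.volume_Icc,
      ← ENNReal.ofReal_mul (by positivity)]
    congr 1
    field_simp
    ring
  have hint : ∫ x in Icc M R, lam / 9 * x⁻¹ = lam / 9 * Real.log (R / M) := by
    rw [integral_const_mul, integral_Icc_eq_integral_Ioc,
      ← intervalIntegral.integral_of_le hR, integral_inv_of_pos hM0 (hM0.trans_le hR)]
  have hintble : IntegrableOn (fun x : ℝ => lam / 9 * x⁻¹) (Icc M R) := by
    refine ContinuousOn.integrableOn_compact isCompact_Icc ?_
    exact continuousOn_const.mul (continuousOn_id.inv₀ fun x hx => (hM0.trans_le hx.1).ne')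
  calc ENNReal.ofReal (lam / 9 * Real.log (R / M))
      = ∫⁻ x in Icc M R, ENNReal.ofReal (lam / 9 * x⁻¹) := by
        rw [← hint, ofReal_integral_eq_lintegral_ofReal hintble]
        filter_upwards [ae_restrict_mem measurableSet_Icc] with x hx
        have := hM0.trans_le hx.1
        simp only [Pi.zero_apply]
        positivity
    _ = ∫⁻ x in Icc M R,
          ∫⁻ y, T.indicator (fun p => ENNReal.ofReal (lam / 9 * (p.1 ^ 2)⁻¹)) (x, y) :=
        (setLIntegral_congr_fun measurableSet_Icc hslice).symm
    _ ≤ ∫⁻ x, ∫⁻ y, T.indicator (fun p => ENNReal.ofReal (lam / 9 * (p.1 ^ 2)⁻¹)) (x, y) :=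
        setLIntegral_le_lintegral _ _
    _ = ∫⁻ p : ℝ × ℝ in T, ENNReal.ofReal (lam / 9 * (p.1 ^ 2)⁻¹) := by
        rw [← lintegral_indicator hTm, Measure.volume_eq_prod, lintegral_prod]
        exact (Measurable.indicator (by fun_prop) hTm).aemeasurable
    _ ≤ ∫⁻ p : ℝ × ℝ in T, ENNReal.ofReal ((u p.1 - u p.2) ^ 2 * K (p.1 - p.2)) := by
        refine lintegral_mono_ae ?_
        filter_upwards [ae_restrict_of_ae hK.ae_prod_sub, ae_restrict_mem hTm] with p hp hmem
        obtain ⟨⟨hx0, hx1⟩, hy0, hy1⟩ := hmem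
        have habs : |p.1 - p.2| = p.1 - p.2 := abs_of_pos (by linarith)
        have hu := hM (-p.2) (by linarith)
        rw [hodd] at hu
        have hu' := hM p.1 hx0
        refine ENNReal.ofReal_le_ofReal (le_trans (le_of_eq ?_)
          (sq_mul_kernel_ge (d := 3 * p.1) (δ := 1) one_half_pos hlam zero_le_one
          (by rw [habs]; linarith) (by rw [habs]; linarith) (by linarith) hp))
        have hx : 0 ≤ p.1 := hM0.le.trans hx0
        rw [show (-1 - 2 * (1 / 2) : ℝ) = -(2 : ℝ) by norm_num,
          Real.rpow_neg (by linarith), Real.rpow_two, mul_pow, mul_inv]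
        ring
    _ ≤ _ := lintegral_mono_set hsub

end Interaction

/-- Tail-energy lower bound under (K2'): `∫_{-R}^R ∫_{ℝ∖[-R,R]} |u₀(x)-u₀(y)|² K(x-y) dx dy ≥ R^{1-2s}/C`
for large `R`, and positivity of `G_*(u₀) = liminf_{R→∞} E_K(u₀,[-R,R])/Ψ_s(R)`. -/
theorem theorem1_lower_tail_energy
    (s lam Lam : ℝ) (hs0 : 0 < s) (hs1 : s < 1)
    (hlam : 0 < lam) (hlamLam : lam ≤ Lam)
    (K : ℝ → ℝ) (hKmeas : Measurable K)
    (hK1 : KernelSymm volume K) (hK2' : KernelK2' volume K 1 s lam Lam)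
    (W : ℝ → ℝ) (hWreg : ∃ β > 0, IsC2HolderLoc β W)
    (hWnonneg : ∀ r, 0 ≤ W r)
    (hW1 : ∀ r ∈ Ioo (-1 : ℝ) 1, 0 < W r)
    (hW2a : W 1 = 0) (hW2b : W (-1) = 0)
    (hW2c : deriv W 1 = 0) (hW2d : deriv W (-1) = 0)
    (hW3a : 0 < deriv (deriv W) 1) (hW3b : 0 < deriv (deriv W) (-1))
    (hW4 : ∀ r ∈ Icc (-1 : ℝ) 1, W (-r) = W r)
    -- `u₀` is the minimizer given by Theorem 1:
    (u0 : ℝ → ℝ)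
    (hu0range : ∀ x, u0 x ∈ Ioo (-1 : ℝ) 1)
    (hu0odd : ∀ x, u0 (-x) = -u0 x)
    (hu0mono : StrictMono u0)
    (hu0zero : u0 0 = 0)
    (hu0top : Tendsto u0 atTop (𝓝 1)) (hu0bot : Tendsto u0 atBot (𝓝 (-1)))
    (hu0reg : ∃ α > 0, IsCHolder (1 + 2 * s + α) u0)
    (hu0min : IsClassAMinimizer volume K W u0)
    (hu0sol : ∀ x : ℝ, opLK volume K u0 x = deriv W (u0 x))
    :
    (∃ C : ℝ, 1 ≤ C ∧ ∃ R1 : ℝ, 0 < R1 ∧ ∀ R : ℝ, R1 ≤ R →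
      ENNReal.ofReal (C⁻¹ * R ^ (1 - 2 * s))
        ≤ ∫⁻ p : ℝ × ℝ in (Icc (-R) R ×ˢ (Icc (-R) R)ᶜ),
            ENNReal.ofReal ((u0 p.1 - u0 p.2) ^ 2 * K (p.1 - p.2))) ∧
    0 < Filter.liminf
        (fun R : ℝ => nlEnergy volume K W u0 (Icc (-R) R) / ENNReal.ofReal (Psi s R)) atTop := by
  have hnn : ∀ x, 0 ≤ x → 0 ≤ u0 x := fun x hx => hu0zero ▸ hu0mono.monotone hx
  obtain ⟨M, hM1, hM⟩ : ∃ M : ℝ, 1 ≤ M ∧ ∀ x, M ≤ x → 1 / 2 ≤ u0 x := by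
    obtain ⟨M, hM⟩ := eventually_atTop.1
      (hu0top.eventually (eventually_ge_nhds (show (1 / 2 : ℝ) < 1 by norm_num)))
    exact ⟨max 1 M, le_max_left _ _, fun x hx => hM x ((le_max_right _ _).trans hx)⟩
  have hM0 : 0 < M := one_pos.trans_le hM1
  set c : ℝ := 1 / 4 * lam * 3 ^ (-1 - 2 * s) with hc
  have hc0 : 0 < c := by positivity
  have htail : ∀ R, M ≤ R → ENNReal.ofReal (c * R ^ (1 - 2 * s))
      ≤ ∫⁻ p : ℝ × ℝ in (Icc (-R) R ×ˢ (Icc (-R) R)ᶜ),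
          ENNReal.ofReal ((u0 p.1 - u0 p.2) ^ 2 * K (p.1 - p.2)) := fun R hR =>
    tail_interaction_ge hs0 hlam hK2' hu0odd hnn hM (hM0.trans_le hR) hR
  have hlim : ∀ c' : ℝ, 0 < c' → (∀ᶠ R : ℝ in atTop, 0 < Psi s R ∧
      ENNReal.ofReal (c' * Psi s R) ≤ nlEnergy volume K W u0 (Icc (-R) R)) →
      0 < Filter.liminf
        (fun R : ℝ => nlEnergy volume K W u0 (Icc (-R) R) / ENNReal.ofReal (Psi s R)) atTop := by
    intro c' hc' h
    refine (ENNReal.ofReal_pos.2 hc').trans_le (le_liminf_of_le (by isBoundedDefault) ?_)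
    filter_upwards [h] with R hR
    rw [ENNReal.le_div_iff_mul_le (Or.inl (ENNReal.ofReal_pos.2 hR.1).ne')
      (Or.inl ENNReal.ofReal_ne_top), ← ENNReal.ofReal_mul hc'.le]
    exact hR.2
  have henergy : ∀ (a R : ℝ), ENNReal.ofReal a ≤
      ∫⁻ p in (((Icc (-R) R)ᶜ ×ˢ (Icc (-R) R)ᶜ)ᶜ : Set (ℝ × ℝ)),
        ENNReal.ofReal ((u0 p.1 - u0 p.2) ^ 2 * K (p.1 - p.2)) →
      ENNReal.ofReal (1 / 4 * a) ≤ nlEnergy volume K W u0 (Icc (-R) R) := by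
    intro a R h
    refine le_trans ?_ le_self_add
    rw [ENNReal.ofReal_mul (by norm_num), ENNReal.ofReal_div_of_pos (by norm_num)]
    simp only [ENNReal.ofReal_one, ENNReal.ofReal_ofNat]
    exact mul_le_mul_right h _
  refine ⟨⟨max 1 c⁻¹, le_max_left _ _, M, hM0, fun R hR => ?_⟩, ?_⟩
  · refine le_trans (ENNReal.ofReal_le_ofReal ?_) (htail R hR)
    have hR0 : 0 ≤ R ^ (1 - 2 * s) := Real.rpow_nonneg (hM0.le.trans hR) _
    exact mul_le_mul_of_nonneg_right
      (inv_le_of_inv_le₀ hc0 (le_max_right _ _)) hR0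
  rcases lt_trichotomy s (1 / 2) with hs | hs | hs
  · refine hlim (1 / 4 * c) (by positivity) ?_
    filter_upwards [eventually_ge_atTop M] with R hR
    have hR0 : 0 < R := hM0.trans_le hR
    rw [Psi, if_pos hs, mul_assoc]
    refine ⟨Real.rpow_pos_of_pos hR0 _,
      henergy _ _ ((htail R hR).trans (lintegral_mono_set ?_))⟩
    rintro ⟨x, y⟩ hp h
    exact h.1 hp.1
  · refine hlim (1 / 4 * (lam / 9 * (1 / 2))) (by positivity) ?_
    filter_upwards [eventually_ge_atTop (M ^ 2), eventually_gt_atTop 1] with R hR hR1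
    have hMR : M ≤ R := by nlinarith
    have hR0 : 0 < R := hM0.trans_le hMR
    have hlog : 2 * Real.log M ≤ Real.log R := by
      rw [show 2 * Real.log M = Real.log (M ^ 2) by simp]
      exact Real.log_le_log (by positivity) hR
    rw [Psi, if_neg hs.not_lt, if_pos hs, mul_assoc]
    refine ⟨Real.log_pos hR1, henergy _ _ (le_trans (ENNReal.ofReal_le_ofReal ?_)
      (log_interaction_ge hlam (hs ▸ hK2') hu0odd hM0 hM hMR))⟩
    rw [mul_assoc, Real.log_div hR0.ne' hM0.ne']
    exact mul_le_mul_of_nonneg_left (by linarith) (by positivity)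
  · set I : ℝ≥0∞ := ∫⁻ x in Icc (-1 : ℝ) 1, ENNReal.ofReal (W (u0 x)) with hI
    have hIpos : 0 < I := by
      have hWm : Measurable fun x => ENNReal.ofReal (W (u0 x)) := by
        obtain ⟨β, -, hW, -⟩ := hWreg
        exact (hW.continuous.measurable.comp hu0mono.monotone.measurable).ennreal_ofReal
      rw [hI, setLIntegral_pos_iff hWm]
      have : Function.support (fun x => ENNReal.ofReal (W (u0 x))) = univ := by
        ext x
        simpa using hW1 _ (hu0range x)
      rw [this, univ_inter, Real.volume_Icc]
      simp
    obtain ⟨r, hr0, hr⟩ : ∃ r : ℝ, 0 < r ∧ ENNReal.ofReal r ≤ I := by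
      obtain ⟨r, hr0, hr⟩ := ENNReal.lt_iff_exists_nnreal_btwn.1 hIpos
      exact ⟨r, by exact_mod_cast hr0, by simpa using hr.le⟩
    refine hlim r hr0 ?_
    filter_upwards [eventually_ge_atTop 1] with R hR
    rw [Psi, if_neg hs.le.not_gt, if_neg hs.ne', mul_one]
    refine ⟨one_pos, hr.trans (le_trans (lintegral_mono_set ?_) le_add_self)⟩
    exact Icc_subset_Icc (by linarith) hR

end
end

section
/- Let N = 1 and s = 1/2, and assume K(z) = λ⋆·|z|^{−2} for a.e. z ∈ ℝ, for some constant λ⋆ > 0 (the 1-dimensional homogeneous form (K2'')). Assume W satisfies (W1)–(W4), and let u0 be the minimizer of Theorem 1 (odd, strictly increasing, u0 : ℝ → (−1,1) of class C^{1+2s+α}(ℝ) for some α > 0, lim_{x→±∞} u0(x) = ±1, solving L_K u0 = W'(u0) pointwise on ℝ). Then the limit G(u0) := lim_{R→+∞} E_K(u0,[−R,R]) / log R exists, is finite, and equals (λ⋆/2)·(lim_{x→+∞} u0(x) − lim_{x→−∞} u0(x))² = 2λ⋆. -/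
open MeasureTheory Filter Topology Set
open scoped ENNReal NNReal

noncomputable section

lemma lintegral_Ici_inv_sub_sq {x c : ℝ} (h : x < c) :
    ∫⁻ y in Ici c, ENNReal.ofReal (((x - y) ^ 2)⁻¹) = ENNReal.ofReal ((c - x)⁻¹) := by
  have hd : ∀ y ∈ Ici c, HasDerivAt (fun y : ℝ => -(y - x)⁻¹) (((x - y) ^ 2)⁻¹) y := by
    intro y hy
    have hyx : y - x ≠ 0 := by have := mem_Ici.1 hy; linarith
    refine (((hasDerivAt_id y).sub_const x).inv hyx).neg.congr_deriv ?_
    rw [neg_div, neg_neg, one_div, ← neg_sub y x, neg_sq]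
    rfl
  have ht : Tendsto (fun y : ℝ => -(y - x)⁻¹) atTop (𝓝 0) := by
    simpa [← sub_eq_add_neg] using (tendsto_inv_atTop_zero.comp (tendsto_atTop_add_const_right _ (-x) tendsto_id)).neg
  have hnn : ∀ y ∈ Ioi c, 0 ≤ ((x - y) ^ 2)⁻¹ := fun y _ => by positivity
  rw [setLIntegral_congr Ioi_ae_eq_Ici.symm,
    ← ofReal_integral_eq_lintegral_ofReal (integrableOn_Ioi_deriv_of_nonneg' hd hnn ht)
      (.of_forall fun y => by dsimp only [Pi.zero_apply]; positivity),
    integral_Ioi_of_hasDerivAt_of_nonneg' hd hnn ht]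
  simp

lemma lintegral_Icc_inv_const_sub {A B c : ℝ} (hAB : A ≤ B) (hBc : B < c) :
    ∫⁻ x in Icc A B, ENNReal.ofReal ((c - x)⁻¹) =
      ENNReal.ofReal (Real.log ((c - A) / (c - B))) := by
  have hint : IntegrableOn (fun x : ℝ => (c - x)⁻¹) (Icc A B) := by
    refine ContinuousOn.integrableOn_Icc (ContinuousOn.inv₀ (by fun_prop) fun x hx => ?_)
    have := hx.2
    linarith
  rw [← ofReal_integral_eq_lintegral_ofReal hint, integral_Icc_eq_integral_Ioc,
    ← intervalIntegral.integral_of_le hAB,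
    intervalIntegral.integral_comp_sub_left (fun x => x⁻¹) c,
    integral_inv_of_pos (by linarith) (by linarith)]
  refine (ae_restrict_iff' measurableSet_Icc).2 (.of_forall fun x hx => ?_)
  have := hx.2
  exact inv_nonneg.2 (by linarith)

/-- Mutual interaction of an interval with a half-line to its right, for the kernel `|z|⁻²`. -/
lemma lintegral_Icc_prod_Ici {A B c : ℝ} (hAB : A ≤ B) (hBc : B < c) :
    ∫⁻ p in Icc A B ×ˢ Ici c, ENNReal.ofReal (((p.1 - p.2) ^ 2)⁻¹) ∂(volume.prod volume) =
      ENNReal.ofReal (Real.log ((c - A) / (c - B))) := by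
  rw [setLIntegral_prod _ (by fun_prop), ← lintegral_Icc_inv_const_sub hAB hBc]
  refine setLIntegral_congr_fun measurableSet_Icc fun x hx => ?_
  exact lintegral_Ici_inv_sub_sq (hx.2.trans_lt hBc)

/-- Mutual interaction of an interval with a half-line to its left, for the kernel `|z|⁻²`. -/
lemma lintegral_Icc_prod_Iic {A B c : ℝ} (hAB : A ≤ B) (hcA : c < A) :
    ∫⁻ p in Icc A B ×ˢ Iic c, ENNReal.ofReal (((p.1 - p.2) ^ 2)⁻¹) ∂(volume.prod volume) =
      ENNReal.ofReal (Real.log ((B - c) / (A - c))) := by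
  have h := lintegral_Icc_prod_Ici (neg_le_neg hAB) (neg_lt_neg hcA)
  rw [show -c - -B = B - c by ring, show -c - -A = A - c by ring] at h
  have hneg := (Measure.measurePreserving_neg (volume : Measure ℝ)).prod
    (Measure.measurePreserving_neg (volume : Measure ℝ))
  rw [← h, ← hneg.setLIntegral_comp_preimage (measurableSet_Icc.prod measurableSet_Ici)
    (by fun_prop)]
  have hset : Prod.map Neg.neg Neg.neg ⁻¹' (Icc (-B) (-A) ×ˢ Ici (-c)) = Icc A B ×ˢ Iic c := by
    ext p
    simp [and_comm]
  rw [hset]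
  refine lintegral_congr fun p => ?_
  simp only [Prod.map_fst, Prod.map_snd]
  congr 2
  ring

lemma lintegral_prod_univ_inv_one_add_sq {J : Set ℝ} (c : ℝ) (hc : 0 ≤ c) :
    ∫⁻ p in J ×ˢ univ, ENNReal.ofReal (c * (1 + (p.1 - p.2) ^ 2)⁻¹) ∂(volume.prod volume) =
      ENNReal.ofReal (c * Real.pi) * volume J := by
  rw [setLIntegral_prod _ (by fun_prop)]
  have hx : ∀ x : ℝ, ∫⁻ y in univ, ENNReal.ofReal (c * (1 + (x - y) ^ 2)⁻¹) =
      ENNReal.ofReal (c * Real.pi) := by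
    intro x
    rw [Measure.restrict_univ,
      lintegral_sub_left_eq_self (fun z => ENNReal.ofReal (c * (1 + z ^ 2)⁻¹)) x,
      ← ofReal_integral_eq_lintegral_ofReal (integrable_inv_one_add_sq.const_mul c)
        (.of_forall fun z => by dsimp only [Pi.zero_apply]; positivity), integral_const_mul,
      integral_univ_inv_one_add_sq]
  simp only [hx, setLIntegral_const]

lemma setLIntegral_preimage_swap {f : ℝ × ℝ → ℝ≥0∞} (hf : Measurable f)
    (hsymm : ∀ p, f p.swap = f p) {T : Set (ℝ × ℝ)} (hT : MeasurableSet T) :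
    ∫⁻ p in Prod.swap ⁻¹' T, f p ∂(volume.prod volume) = ∫⁻ p in T, f p ∂(volume.prod volume) := by
  rw [← Measure.measurePreserving_swap.setLIntegral_comp_preimage hT hf]
  simp only [hsymm]

/-- The squared-difference density of `u` against the kernel `c |z|⁻²`. -/
def gagliardoDensity (c : ℝ) (u : ℝ → ℝ) (p : ℝ × ℝ) : ℝ≥0∞ :=
  ENNReal.ofReal ((u p.1 - u p.2) ^ 2 * (c * ((p.1 - p.2) ^ 2)⁻¹))

lemma measurable_gagliardoDensity (c : ℝ) {u : ℝ → ℝ} (hu : Measurable u) :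
    Measurable (gagliardoDensity c u) := by
  unfold gagliardoDensity
  fun_prop

lemma gagliardoDensity_swap (c : ℝ) (u : ℝ → ℝ) (p : ℝ × ℝ) :
    gagliardoDensity c u p.swap = gagliardoDensity c u p := by
  simp only [gagliardoDensity, Prod.fst_swap, Prod.snd_swap]
  congr 1
  rw [← neg_sub (u p.1), ← neg_sub p.1 p.2, neg_sq, neg_sq]

lemma gagliardoDensity_le {c d : ℝ} (hc : 0 ≤ c) {u : ℝ → ℝ} {p : ℝ × ℝ}
    (h : |u p.1 - u p.2| ≤ d) :
    gagliardoDensity c u p ≤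
      ENNReal.ofReal (c * d ^ 2) * ENNReal.ofReal (((p.1 - p.2) ^ 2)⁻¹) := by
  have hd : 0 ≤ d := (abs_nonneg _).trans h
  rw [← ENNReal.ofReal_mul (by positivity)]
  refine ENNReal.ofReal_le_ofReal ?_
  have := sq_le_sq' (abs_le.1 h).1 (abs_le.1 h).2
  calc _ = (u p.1 - u p.2) ^ 2 * (c * ((p.1 - p.2) ^ 2)⁻¹) := rfl
    _ ≤ d ^ 2 * (c * ((p.1 - p.2) ^ 2)⁻¹) := by gcongr
    _ = _ := by ring

lemma le_gagliardoDensity {c d : ℝ} (hc : 0 ≤ c) (hd : 0 ≤ d) {u : ℝ → ℝ} {p : ℝ × ℝ}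
    (h : d ≤ u p.1 - u p.2) :
    ENNReal.ofReal (c * d ^ 2) * ENNReal.ofReal (((p.1 - p.2) ^ 2)⁻¹) ≤
      gagliardoDensity c u p := by
  rw [← ENNReal.ofReal_mul (by positivity)]
  refine ENNReal.ofReal_le_ofReal ?_
  calc _ = d ^ 2 * (c * ((p.1 - p.2) ^ 2)⁻¹) := by ring
    _ ≤ _ := by gcongr

lemma gagliardoDensity_le_of_lipschitz {c : ℝ} (hc : 0 ≤ c) {u : ℝ → ℝ} {p : ℝ × ℝ}
    (h : |u p.1 - u p.2| ≤ 2) (h' : |u p.1 - u p.2| ≤ |p.1 - p.2|) :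
    gagliardoDensity c u p ≤ ENNReal.ofReal (5 * c * (1 + (p.1 - p.2) ^ 2)⁻¹) := by
  refine ENNReal.ofReal_le_ofReal ?_
  have h4 := sq_le_sq' (abs_le.1 h).1 (abs_le.1 h).2
  have ht := sq_le_sq.2 h'
  set D := (u p.1 - u p.2) ^ 2
  set t := (p.1 - p.2) ^ 2
  have hD : 0 ≤ D := sq_nonneg _
  have ht0 : 0 ≤ t := sq_nonneg _
  rcases ht0.eq_or_lt with h0 | h0
  · rw [← h0]
    simp only [inv_zero, mul_zero]
    positivity
  · have : D * t⁻¹ ≤ 5 * (1 + t)⁻¹ := by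
      rw [← div_eq_mul_inv, ← div_eq_mul_inv, div_le_div_iff₀ h0 (by positivity)]
      nlinarith
    calc _ = c * (D * t⁻¹) := by ring
      _ ≤ c * (5 * (1 + t)⁻¹) := by gcongr
      _ = _ := by ring

lemma nlEnergy_eq {c : ℝ} {K : ℝ → ℝ} (hK : ∀ᵐ z : ℝ, K z = c * |z| ^ (-(2 : ℝ)))
    (W u : ℝ → ℝ) (Ω : Set ℝ) :
    nlEnergy volume K W u Ω =
      (1 / 4) * ∫⁻ p in ((Ωᶜ ×ˢ Ωᶜ)ᶜ : Set (ℝ × ℝ)), gagliardoDensity c u p ∂(volume.prod volume)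
        + ∫⁻ x in Ω, ENNReal.ofReal (W (u x)) := by
  have hae := (quasiMeasurePreserving_sub (volume : Measure ℝ) (volume : Measure ℝ)).ae hK
  unfold nlEnergy
  congr 2
  refine lintegral_congr_ae (ae_restrict_of_ae ?_)
  filter_upwards [hae] with p hp
  rw [hp, Real.rpow_neg (abs_nonneg _), Real.rpow_two, sq_abs]
  rfl

lemma nlEnergy_mono_set (K W u : ℝ → ℝ) {Ω Ω' : Set ℝ} (h : Ω ⊆ Ω') :
    nlEnergy volume K W u Ω ≤ nlEnergy volume K W u Ω' := by
  unfold nlEnergy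
  gcongr

/-- Lower bound: only the interaction between the two ends counts. -/
lemma le_nlEnergy_Icc {c : ℝ} (hc : 0 < c) {K : ℝ → ℝ}
    (hK : ∀ᵐ z : ℝ, K z = c * |z| ^ (-(2 : ℝ))) (W : ℝ → ℝ) {u : ℝ → ℝ} (hmono : Monotone u)
    (hodd : ∀ x, u (-x) = -u x) {A R : ℝ} (hA : 0 < A) (hAR : A ≤ R) (huA : 0 ≤ u A) :
    ENNReal.ofReal (2 * c * u A ^ 2 * Real.log ((R + A) / (2 * A))) ≤
      nlEnergy volume K W u (Icc (-R) R) := by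
  set T : Set (ℝ × ℝ) := Icc A R ×ˢ Iic (-A) with hTdef
  have hT : MeasurableSet T := measurableSet_Icc.prod measurableSet_Iic
  have hsub : T ∪ Prod.swap ⁻¹' T ⊆ (((Icc (-R) R)ᶜ ×ˢ (Icc (-R) R)ᶜ)ᶜ : Set (ℝ × ℝ)) := by
    rintro p (⟨hp1, hp2⟩ | ⟨hp1, hp2⟩) ⟨h1, h2⟩
    · exact h1 ⟨by linarith [hp1.1], hp1.2⟩
    · exact h2 ⟨by linarith [hp1.1, Prod.fst_swap (p := p)], hp1.2⟩
  have hdisj : Disjoint T (Prod.swap ⁻¹' T) := by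
    rw [Set.disjoint_left]
    rintro p ⟨hp1, hp2⟩ ⟨hp3, hp4⟩
    have h1 := hp1.1
    have h2 : p.1 ≤ -A := hp4
    linarith
  have hTle : ENNReal.ofReal (c * (2 * u A) ^ 2 * Real.log ((R + A) / (2 * A))) ≤
      ∫⁻ p in T, gagliardoDensity c u p ∂(volume.prod volume) := by
    have hrect := lintegral_Icc_prod_Iic hAR (show -A < A by linarith)
    rw [show R - -A = R + A by ring, show A - -A = 2 * A by ring] at hrect
    rw [ENNReal.ofReal_mul (by positivity), ← hrect, ← lintegral_const_mul _ (by fun_prop)]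
    refine setLIntegral_mono' hT fun p hp => le_gagliardoDensity hc.le (by positivity) ?_
    have h1 := hmono hp.1.1
    have h2 := hmono (mem_Iic.1 hp.2)
    rw [hodd] at h2
    linarith
  have hmeas := measurable_gagliardoDensity c hmono.measurable
  rw [nlEnergy_eq hK]
  refine le_trans ?_ le_self_add
  calc ENNReal.ofReal (2 * c * u A ^ 2 * Real.log ((R + A) / (2 * A)))
      = (1 / 4) * (2 * ENNReal.ofReal (c * (2 * u A) ^ 2 * Real.log ((R + A) / (2 * A)))) := by
        rw [show (1 / 4 : ℝ≥0∞) = ENNReal.ofReal (1 / 4) by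
            rw [ENNReal.ofReal_div_of_pos (by norm_num)]; simp,
          show (2 : ℝ≥0∞) = ENNReal.ofReal 2 by simp,
          ← ENNReal.ofReal_mul (by norm_num), ← ENNReal.ofReal_mul (by norm_num)]
        congr 1
        ring
    _ ≤ (1 / 4) * ∫⁻ p in T ∪ Prod.swap ⁻¹' T, gagliardoDensity c u p ∂(volume.prod volume) := by
        rw [lintegral_union (measurable_swap hT) hdisj,
          setLIntegral_preimage_swap hmeas (gagliardoDensity_swap c u) hT, ← two_mul]
        gcongr
    _ ≤ _ := by gcongr

/-- Odd competitor: on `(-ρ, ρ)` the identity clamped to `[-1, 1]`, with a linear transition to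
`u (±ρ)` near the endpoints; it agrees with `u` outside `(-ρ, ρ)`. -/
def competitor (u : ℝ → ℝ) (ρ x : ℝ) : ℝ :=
  if |x| < ρ then max (-min 1 (u ρ + ρ - |x|)) (min (min 1 (u ρ + ρ - |x|)) x) else u x

section Competitor

variable {u : ℝ → ℝ} {ρ : ℝ}

lemma measurable_competitor (hu : Measurable u) : Measurable (competitor u ρ) := by
  unfold competitor
  refine Measurable.ite (measurableSet_lt (by fun_prop) (by fun_prop)) (by fun_prop) hu

lemma competitor_of_le (x : ℝ) (hx : ρ ≤ |x|) : competitor u ρ x = u x :=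
  if_neg hx.not_gt

lemma competitor_neg (hodd : ∀ x, u (-x) = -u x) (hρ : 0 ≤ u ρ) (x : ℝ) :
    competitor u ρ (-x) = -competitor u ρ x := by
  unfold competitor
  rw [abs_neg]
  split_ifs with h
  · have hm : 0 ≤ min 1 (u ρ + ρ - |x|) := le_min zero_le_one (by linarith)
    generalize min 1 (u ρ + ρ - |x|) = m at hm
    rcases le_total x m with h1 | h1 <;> rcases le_total (-x) m with h2 | h2 <;>
      simp only [min_eq_left h1, min_eq_left h2, min_eq_right h1, min_eq_right h2]
    · rw [max_eq_right (by linarith), max_eq_right (by linarith)]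
    · rw [max_eq_right (by linarith), max_eq_left (by linarith), neg_neg]
    · rw [max_eq_left (by linarith), max_eq_right (by linarith)]
    · rw [show m = 0 by linarith]; simp
  · exact hodd x

lemma abs_competitor_le_one (hbd : ∀ x, |u x| ≤ 1) (hρ : 0 ≤ u ρ) (x : ℝ) :
    |competitor u ρ x| ≤ 1 := by
  unfold competitor
  split_ifs with h
  · have hm : 0 ≤ min 1 (u ρ + ρ - |x|) := le_min zero_le_one (by linarith)
    have hm1 : min 1 (u ρ + ρ - |x|) ≤ 1 := min_le_left _ _
    generalize min 1 (u ρ + ρ - |x|) = m at hm hm1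
    exact abs_le.2 ⟨(neg_le_neg hm1).trans (le_max_left _ _),
      max_le (by linarith) ((min_le_left _ _).trans hm1)⟩
  · exact hbd x

lemma competitor_eq_one (hρ : 0 ≤ u ρ) {x : ℝ} (hx : 1 ≤ x) (hx' : x ≤ ρ - 2) :
    competitor u ρ x = 1 := by
  have habs : |x| = x := abs_of_nonneg (by linarith)
  rw [competitor, if_pos (by rw [habs]; linarith), habs,
    min_eq_left (show 1 ≤ u ρ + ρ - x by linarith), min_eq_left hx]
  norm_num

lemma abs_competitor_sub_le_of_ge (hmono : Monotone u) (hbd : ∀ x, |u x| ≤ 1)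
    (hρ : 0 ≤ u ρ) (hρ2 : 2 ≤ ρ) (hgrow : ∀ y, ρ ≤ y → u y ≤ u ρ + (y - ρ)) {x y : ℝ}
    (hx : |x| < ρ) (hy : ρ ≤ y) : |competitor u ρ x - competitor u ρ y| ≤ y - x := by
  have hy' : ρ ≤ |y| := hy.trans (le_abs_self y)
  rw [competitor_of_le y hy', competitor, if_pos hx]
  have h1 := hgrow y hy
  have h2 := hmono hy
  have h3 := (abs_le.1 (hbd y)).2
  have h4 := le_abs_self x
  have hm0 : 0 ≤ min 1 (u ρ + ρ - |x|) := le_min zero_le_one (by linarith)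
  have hm1 : min 1 (u ρ + ρ - |x|) ≤ u ρ + ρ - |x| := min_le_right _ _
  have hm2 : u y - (y - x) ≤ min 1 (u ρ + ρ - |x|) := le_min (by linarith) (by linarith)
  generalize min 1 (u ρ + ρ - |x|) = m at hm0 hm1 hm2
  rw [abs_le]
  constructor
  · have : u y - (y - x) ≤ max (-m) (min m x) :=
      (le_min hm2 (by linarith)).trans (le_max_right _ _)
    linarith
  · have : max (-m) (min m x) ≤ m := max_le (by linarith) (min_le_left _ _)
    linarith

lemma abs_competitor_sub_le (hmono : Monotone u) (hodd : ∀ x, u (-x) = -u x)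
    (hbd : ∀ x, |u x| ≤ 1) (hρ : 0 ≤ u ρ) (hρ2 : 2 ≤ ρ)
    (hgrow : ∀ y, ρ ≤ y → u y ≤ u ρ + (y - ρ)) {x : ℝ} (hx : |x| < ρ) (y : ℝ) :
    |competitor u ρ x - competitor u ρ y| ≤ |x - y| := by
  rcases lt_or_ge |y| ρ with hy | hy
  · rw [competitor, competitor, if_pos hx, if_pos hy]
    have h0 : |(|y| - |x|)| ≤ |x - y| := by
      rw [abs_sub_comm x y]
      exact abs_abs_sub_abs_le_abs_sub y x
    have hm : |min 1 (u ρ + ρ - |x|) - min 1 (u ρ + ρ - |y|)| ≤ |x - y| := by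
      refine (abs_min_sub_min_le_max _ _ _ _).trans (max_le (by simp) ?_)
      rwa [show u ρ + ρ - |x| - (u ρ + ρ - |y|) = |y| - |x| by ring]
    refine (abs_max_sub_max_le_max _ _ _ _).trans (max_le ?_ ?_)
    · rwa [neg_sub_neg, abs_sub_comm]
    · exact (abs_min_sub_min_le_max _ _ _ _).trans (max_le hm le_rfl)
  · rcases le_total 0 y with h0 | h0
    · rw [abs_of_nonneg h0] at hy
      refine (abs_competitor_sub_le_of_ge hmono hbd hρ hρ2 hgrow hx hy).trans ?_
      rw [abs_sub_comm]
      exact le_abs_self _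
    · rw [abs_of_nonpos h0] at hy
      have h := abs_competitor_sub_le_of_ge hmono hbd hρ hρ2 hgrow (x := -x)
        (by rwa [abs_neg]) hy
      rw [competitor_neg hodd hρ, competitor_neg hodd hρ, neg_sub_neg, abs_sub_comm] at h
      refine h.trans ?_
      rw [neg_sub_neg]
      exact le_abs_self _

end Competitor

/-- A monotone-growth point: from some `ρ ∈ [R, R + 1]` on, `u` grows with slope at most one. -/
lemma exists_slope_le_one {u : ℝ → ℝ} (hcont : Continuous u) (hbd : ∀ x, u x ≤ 1) {R : ℝ}
    (hR : 0 ≤ u R) : ∃ ρ ∈ Icc R (R + 1), ∀ y, ρ ≤ y → u y ≤ u ρ + (y - ρ) := by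
  obtain ⟨ρ, hρ, hmax⟩ := (isCompact_Icc (a := R) (b := R + 1)).exists_isMaxOn
    ⟨R, by simp⟩ (f := fun x => u x - x) (by fun_prop)
  refine ⟨ρ, hρ, fun y hy => ?_⟩
  rcases le_total y (R + 1) with h | h
  · have := isMaxOn_iff.1 hmax y ⟨hρ.1.trans hy, h⟩
    linarith
  · have := isMaxOn_iff.1 hmax R (by simp)
    linarith [hbd y]

/-- The part of `(-ρ, ρ)` where the competitor is in transition. -/
def transitionSet (ρ : ℝ) : Set ℝ := Icc (-1) 1 ∪ (Ico (ρ - 2) ρ ∪ Ioc (-ρ) (2 - ρ))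

lemma measurableSet_transitionSet (ρ : ℝ) : MeasurableSet (transitionSet ρ) :=
  measurableSet_Icc.union (measurableSet_Ico.union measurableSet_Ioc)

lemma volume_transitionSet_le (ρ : ℝ) : volume (transitionSet ρ) ≤ ENNReal.ofReal 6 := by
  calc volume (transitionSet ρ)
      ≤ volume (Icc (-1 : ℝ) 1) + (volume (Ico (ρ - 2) ρ) + volume (Ioc (-ρ) (2 - ρ))) :=
        (measure_union_le _ _).trans (add_le_add_right (measure_union_le _ _) _)
    _ = _ := by
        rw [Real.volume_Icc, Real.volume_Ico, Real.volume_Ioc,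
          ← ENNReal.ofReal_add (by linarith) (by linarith),
          ← ENNReal.ofReal_add (by linarith) (by linarith)]
        congr 1
        ring

lemma abs_lt_of_mem_transitionSet {ρ x : ℝ} (hρ : 4 ≤ ρ) (hx : x ∈ transitionSet ρ) :
    |x| < ρ := by
  rw [abs_lt]
  rcases hx with ⟨h1, h2⟩ | ⟨h1, h2⟩ | ⟨h1, h2⟩ <;> constructor <;> linarith

lemma mem_Ioo_of_notMem_transitionSet {ρ x : ℝ} (hx : x ∈ Ioo (-ρ) ρ)
    (hx' : x ∉ transitionSet ρ) : x ∈ Ioo 1 (ρ - 2) ∨ x ∈ Ioo (2 - ρ) (-1) := by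
  simp only [transitionSet, mem_union, mem_Icc, mem_Ico, mem_Ioc, not_or, not_and, not_le,
    not_lt] at hx'
  obtain ⟨h1, h2, h3⟩ := hx'
  have h3 := h3 hx.1
  rcases le_or_gt (-1) x with h | h
  · refine Or.inl ⟨h1 h, ?_⟩
    by_contra! hcon
    linarith [h2 hcon, hx.2]
  · exact Or.inr ⟨h3, h⟩

section CompetitorEnergy

variable {u : ℝ → ℝ} {ρ : ℝ}

lemma competitor_eq_neg_one (hodd : ∀ x, u (-x) = -u x) (hρ : 0 ≤ u ρ) {x : ℝ} (hx : x ≤ -1)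
    (hx' : 2 - ρ ≤ x) : competitor u ρ x = -1 := by
  rw [← neg_neg x, competitor_neg hodd hρ, competitor_eq_one hρ (by linarith) (by linarith)]

lemma lintegral_potential_competitor_le {W : ℝ → ℝ} {M : ℝ} (hWM : ∀ r, |r| ≤ 1 → W r ≤ M)
    (hM : 0 ≤ M) (hWp : W 1 = 0) (hWm : W (-1) = 0) (hodd : ∀ x, u (-x) = -u x)
    (hbd : ∀ x, |u x| ≤ 1) (hρ : 0 ≤ u ρ) :
    ∫⁻ x in Ioo (-ρ) ρ, ENNReal.ofReal (W (competitor u ρ x)) ≤ ENNReal.ofReal (6 * M) := by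
  set J := transitionSet ρ
  have hJ : MeasurableSet J := measurableSet_transitionSet ρ
  have hzero : ∫⁻ x in Ioo (-ρ) ρ \ J, ENNReal.ofReal (W (competitor u ρ x)) = 0 := by
    rw [← lintegral_zero (μ := volume.restrict (Ioo (-ρ) ρ \ J))]
    refine setLIntegral_congr_fun (measurableSet_Ioo.diff hJ) fun x hx => ?_
    rcases mem_Ioo_of_notMem_transitionSet hx.1 hx.2 with h | h
    · simp only [competitor_eq_one hρ h.1.le h.2.le, hWp, ENNReal.ofReal_zero]
    · simp only [competitor_eq_neg_one hodd hρ h.2.le h.1.le, hWm, ENNReal.ofReal_zero]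
  calc ∫⁻ x in Ioo (-ρ) ρ, ENNReal.ofReal (W (competitor u ρ x))
      ≤ ∫⁻ x in J ∪ Ioo (-ρ) ρ \ J, ENNReal.ofReal (W (competitor u ρ x)) :=
        lintegral_mono_set (by rw [union_sdiff_self]; exact subset_union_right)
    _ ≤ ∫⁻ x in J, ENNReal.ofReal (W (competitor u ρ x)) := by
        refine (lintegral_union_le _ _ _).trans ?_
        rw [hzero, add_zero]
    _ ≤ ∫⁻ _ in J, ENNReal.ofReal M := lintegral_mono fun x =>
        ENNReal.ofReal_le_ofReal (hWM _ (abs_competitor_le_one hbd hρ x))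
    _ ≤ ENNReal.ofReal M * ENNReal.ofReal 6 := by
        rw [setLIntegral_const]
        gcongr
        exact volume_transitionSet_le ρ
    _ = ENNReal.ofReal (6 * M) := by rw [← ENNReal.ofReal_mul hM, mul_comm]

lemma setLIntegral_gagliardoDensity_le {c d : ℝ} (hc : 0 ≤ c) {v : ℝ → ℝ} {T : Set (ℝ × ℝ)}
    (hT : MeasurableSet T) (h : ∀ p ∈ T, |v p.1 - v p.2| ≤ d) {L : ℝ}
    (hL : ∫⁻ p in T, ENNReal.ofReal (((p.1 - p.2) ^ 2)⁻¹) ∂(volume.prod volume) ≤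
      ENNReal.ofReal L) :
    ∫⁻ p in T, gagliardoDensity c v p ∂(volume.prod volume) ≤ ENNReal.ofReal (c * d ^ 2 * L) := by
  rw [ENNReal.ofReal_mul (by positivity)]
  calc _ ≤ ∫⁻ p in T, ENNReal.ofReal (c * d ^ 2) * ENNReal.ofReal (((p.1 - p.2) ^ 2)⁻¹)
        ∂(volume.prod volume) := setLIntegral_mono' hT fun p hp => gagliardoDensity_le hc (h p hp)
    _ ≤ _ := by
        rw [lintegral_const_mul _ (by fun_prop)]
        gcongr

/-- Pairs that, up to exchanging the two points, contribute to the energy of the competitor. -/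
def interactionSet (ρ : ℝ) (v : ℝ → ℝ) : Set (ℝ × ℝ) :=
  transitionSet ρ ×ˢ univ ∪ (Icc 1 ρ ×ˢ Iic (-1) ∪ (Icc (-ρ) (-1) ×ˢ Ici ρ ∪
    (Icc 1 (ρ - 2) ×ˢ Ici ρ ∪ (Icc (2 - ρ) (-1) ×ˢ Iic (-ρ) ∪ {p | v p.1 = v p.2}))))

lemma mem_interactionSet (hodd : ∀ x, u (-x) = -u x) (hρ : 0 ≤ u ρ) {x : ℝ}
    (hx : x ∈ Ioo (-ρ) ρ) (y : ℝ) :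
    (x, y) ∈ interactionSet ρ (competitor u ρ) ∨ (y, x) ∈ interactionSet ρ (competitor u ρ) := by
  simp only [interactionSet, mem_union, mem_prod, mem_univ, and_true, mem_Icc, mem_Iic, mem_Ici,
    mem_ofPred_eq]
  by_cases hxJ : x ∈ transitionSet ρ
  · exact Or.inl (Or.inl hxJ)
  by_cases hyJ : y ∈ transitionSet ρ
  · exact Or.inr (Or.inl hyJ)
  rcases mem_Ioo_of_notMem_transitionSet hx hxJ with ⟨hx1, hx2⟩ | ⟨hx1, hx2⟩
  · left
    rcases le_or_gt y (-1) with hy | hy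
    · exact Or.inr (Or.inl ⟨⟨hx1.le, hx.2.le⟩, hy⟩)
    rcases le_or_gt ρ y with hy' | hy'
    · exact Or.inr (Or.inr (Or.inr (Or.inl ⟨⟨hx1.le, hx2.le⟩, hy'⟩)))
    rcases mem_Ioo_of_notMem_transitionSet ⟨by linarith, hy'⟩ hyJ with ⟨hy1, hy2⟩ | ⟨hy1, hy2⟩
    · right; right; right; right; right
      rw [competitor_eq_one hρ hx1.le hx2.le, competitor_eq_one hρ hy1.le hy2.le]
    · linarith
  · rcases le_or_gt ρ y with hy | hy
    · exact Or.inl (Or.inr (Or.inr (Or.inl ⟨⟨by linarith, hx2.le⟩, hy⟩)))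
    rcases le_or_gt y (-ρ) with hy' | hy'
    · exact Or.inl (Or.inr (Or.inr (Or.inr (Or.inr (Or.inl ⟨⟨hx1.le, hx2.le⟩, hy'⟩)))))
    rcases mem_Ioo_of_notMem_transitionSet ⟨hy', hy⟩ hyJ with ⟨hy1, hy2⟩ | ⟨hy1, hy2⟩
    · exact Or.inr (Or.inr (Or.inl ⟨⟨hy1.le, hy.le⟩, hx2.le⟩))
    · left; right; right; right; right; right
      rw [competitor_eq_neg_one hodd hρ hx2.le hx1.le, competitor_eq_neg_one hodd hρ hy2.le hy1.le]

lemma measurableSet_interactionSet (ρ : ℝ) {v : ℝ → ℝ} (hv : Measurable v) :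
    MeasurableSet (interactionSet ρ v) :=
  ((measurableSet_transitionSet ρ).prod .univ).union <|
    (measurableSet_Icc.prod measurableSet_Iic).union <|
    (measurableSet_Icc.prod measurableSet_Ici).union <|
    (measurableSet_Icc.prod measurableSet_Ici).union <|
    (measurableSet_Icc.prod measurableSet_Iic).union <|
    measurableSet_eq_fun (by fun_prop) (by fun_prop)

lemma lintegral_interactionSet_le {c : ℝ} (hc : 0 ≤ c) (hmono : Monotone u)
    (hodd : ∀ x, u (-x) = -u x) (hbd : ∀ x, |u x| ≤ 1) (hρ : 0 ≤ u ρ) (hρ4 : 4 ≤ ρ)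
    (hgrow : ∀ y, ρ ≤ y → u y ≤ u ρ + (y - ρ)) :
    ∫⁻ p in interactionSet ρ (competitor u ρ), gagliardoDensity c (competitor u ρ) p
        ∂(volume.prod volume) ≤
      ENNReal.ofReal (30 * c * Real.pi + 4 * c * Real.log ρ + 4 * c * Real.log 2
        + 2 * c * (1 - u ρ) ^ 2 * Real.log ρ) := by
  set v := competitor u ρ with hv
  have hvmeas : Measurable v := measurable_competitor hmono.measurable
  have hv1 : ∀ x, |v x| ≤ 1 := abs_competitor_le_one hbd hρ
  have hv2 : ∀ x y, |v x - v y| ≤ 2 := fun x y =>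
    (abs_sub _ _).trans (by linarith [hv1 x, hv1 y])
  have hlogρ : 0 ≤ Real.log ρ := Real.log_nonneg (by linarith)
  have hlog2 : 0 ≤ Real.log 2 := Real.log_nonneg (by norm_num)
  have huρ : u ρ ≤ 1 := (abs_le.1 (hbd ρ)).2
  have htrans : ∫⁻ p in transitionSet ρ ×ˢ univ, gagliardoDensity c v p ∂(volume.prod volume) ≤
      ENNReal.ofReal (30 * c * Real.pi) := by
    calc _ ≤ ∫⁻ p in transitionSet ρ ×ˢ univ,
          ENNReal.ofReal (5 * c * (1 + (p.1 - p.2) ^ 2)⁻¹) ∂(volume.prod volume) :=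
          setLIntegral_mono' ((measurableSet_transitionSet ρ).prod .univ) fun p hp =>
            gagliardoDensity_le_of_lipschitz hc (hv2 _ _) (abs_competitor_sub_le hmono hodd hbd hρ
              (by linarith) hgrow (abs_lt_of_mem_transitionSet hρ4 hp.1) _)
      _ ≤ ENNReal.ofReal (5 * c * Real.pi) * ENNReal.ofReal 6 := by
          rw [lintegral_prod_univ_inv_one_add_sq _ (by positivity)]
          gcongr
          exact volume_transitionSet_le ρ
      _ = _ := by
          rw [← ENNReal.ofReal_mul (by positivity)]
          congr 1
          ring
  have hcross : ∫⁻ p in Icc 1 ρ ×ˢ Iic (-1), gagliardoDensity c v p ∂(volume.prod volume) ≤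
      ENNReal.ofReal (c * 2 ^ 2 * Real.log ρ) := by
    refine setLIntegral_gagliardoDensity_le hc (measurableSet_Icc.prod measurableSet_Iic)
      (fun p _ => hv2 _ _) ?_
    rw [lintegral_Icc_prod_Iic (by linarith) (by norm_num)]
    refine ENNReal.ofReal_le_ofReal (Real.log_le_log (div_pos (by linarith) (by norm_num)) ?_)
    rw [div_le_iff₀ (by norm_num)]
    linarith
  have hcross' : ∫⁻ p in Icc (-ρ) (-1) ×ˢ Ici ρ, gagliardoDensity c v p ∂(volume.prod volume) ≤
      ENNReal.ofReal (c * 2 ^ 2 * Real.log 2) := by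
    refine setLIntegral_gagliardoDensity_le hc (measurableSet_Icc.prod measurableSet_Ici)
      (fun p _ => hv2 _ _) ?_
    rw [lintegral_Icc_prod_Ici (by linarith) (by linarith)]
    refine ENNReal.ofReal_le_ofReal
      (Real.log_le_log (div_pos (by linarith) (by linarith)) ?_)
    rw [div_le_iff₀ (by linarith)]
    linarith
  have hright : ∫⁻ p in Icc 1 (ρ - 2) ×ˢ Ici ρ, gagliardoDensity c v p ∂(volume.prod volume) ≤
      ENNReal.ofReal (c * (1 - u ρ) ^ 2 * Real.log ρ) := by
    refine setLIntegral_gagliardoDensity_le hc (measurableSet_Icc.prod measurableSet_Ici)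
      (fun p hp => ?_) ?_
    · rw [hv, competitor_eq_one hρ hp.1.1 hp.1.2,
        competitor_of_le p.2 ((mem_Ici.1 hp.2).trans (le_abs_self _)),
        abs_of_nonneg (by linarith [(abs_le.1 (hbd p.2)).2])]
      linarith [hmono (mem_Ici.1 hp.2)]
    rw [lintegral_Icc_prod_Ici (by linarith) (by linarith)]
    refine ENNReal.ofReal_le_ofReal
      (Real.log_le_log (div_pos (by linarith) (by linarith)) ?_)
    rw [div_le_iff₀ (by linarith)]
    linarith
  have hleft : ∫⁻ p in Icc (2 - ρ) (-1) ×ˢ Iic (-ρ), gagliardoDensity c v p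
      ∂(volume.prod volume) ≤ ENNReal.ofReal (c * (1 - u ρ) ^ 2 * Real.log ρ) := by
    refine setLIntegral_gagliardoDensity_le hc (measurableSet_Icc.prod measurableSet_Iic)
      (fun p hp => ?_) ?_
    · have h2 : p.2 ≤ -ρ := hp.2
      have h3 := hmono h2
      rw [hodd] at h3
      rw [hv, competitor_eq_neg_one hodd hρ hp.1.2 hp.1.1,
        competitor_of_le p.2 ((le_neg.1 h2).trans (neg_le_abs _)), abs_sub_comm,
        abs_of_nonneg (by linarith [(abs_le.1 (hbd p.2)).1])]
      linarith
    rw [lintegral_Icc_prod_Iic (by linarith) (by linarith)]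
    refine ENNReal.ofReal_le_ofReal
      (Real.log_le_log (div_pos (by linarith) (by linarith)) ?_)
    rw [div_le_iff₀ (by linarith)]
    linarith
  have hflat : ∫⁻ p in {p : ℝ × ℝ | v p.1 = v p.2}, gagliardoDensity c v p
      ∂(volume.prod volume) ≤ ENNReal.ofReal 0 := by
    rw [ENNReal.ofReal_zero, ← lintegral_zero
      (μ := (volume.prod volume).restrict {p : ℝ × ℝ | v p.1 = v p.2})]
    refine setLIntegral_mono' (measurableSet_eq_fun (by fun_prop) (by fun_prop)) fun p hp => ?_
    have hp' : v p.1 = v p.2 := hp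
    simp [gagliardoDensity, hp']
  refine (lintegral_union_le _ _ _).trans <| (add_le_add htrans <|
    (lintegral_union_le _ _ _).trans <| add_le_add hcross <|
    (lintegral_union_le _ _ _).trans <| add_le_add hcross' <|
    (lintegral_union_le _ _ _).trans <| add_le_add hright <|
    (lintegral_union_le _ _ _).trans <| add_le_add hleft hflat).trans ?_
  rw [← ENNReal.ofReal_add (by positivity) le_rfl, ← ENNReal.ofReal_add (by positivity)
    (by positivity), ← ENNReal.ofReal_add (by positivity) (by positivity),
    ← ENNReal.ofReal_add (by positivity) (by positivity),
    ← ENNReal.ofReal_add (by positivity) (by positivity)]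
  exact ENNReal.ofReal_le_ofReal (by linarith)

lemma nlEnergy_competitor_le {c : ℝ} (hc : 0 ≤ c) {K : ℝ → ℝ}
    (hK : ∀ᵐ z : ℝ, K z = c * |z| ^ (-(2 : ℝ))) {W : ℝ → ℝ} {M : ℝ}
    (hWM : ∀ r, |r| ≤ 1 → W r ≤ M) (hM : 0 ≤ M) (hWp : W 1 = 0) (hWm : W (-1) = 0)
    (hmono : Monotone u) (hodd : ∀ x, u (-x) = -u x) (hbd : ∀ x, |u x| ≤ 1) (hρ : 0 ≤ u ρ)
    (hρ4 : 4 ≤ ρ) (hgrow : ∀ y, ρ ≤ y → u y ≤ u ρ + (y - ρ)) :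
    nlEnergy volume K W (competitor u ρ) (Ioo (-ρ) ρ) ≤
      ENNReal.ofReal ((2 * c + c * (1 - u ρ) ^ 2) * Real.log ρ
        + (15 * c * Real.pi + 2 * c * Real.log 2 + 6 * M)) := by
  set v := competitor u ρ with hv
  have hvmeas : Measurable v := measurable_competitor hmono.measurable
  have hlogρ : 0 ≤ Real.log ρ := Real.log_nonneg (by linarith)
  have hlog2 : 0 ≤ Real.log 2 := Real.log_nonneg (by norm_num)
  set T := interactionSet ρ v with hTdef
  have hT : MeasurableSet T := measurableSet_interactionSet ρ hvmeas
  have hsub : (((Ioo (-ρ) ρ)ᶜ ×ˢ (Ioo (-ρ) ρ)ᶜ)ᶜ : Set (ℝ × ℝ)) ⊆ T ∪ Prod.swap ⁻¹' T := by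
    intro p hp
    have hp' : p.1 ∈ Ioo (-ρ) ρ ∨ p.2 ∈ Ioo (-ρ) ρ := by
      by_contra! h
      exact hp ⟨h.1, h.2⟩
    rcases hp' with h | h
    · exact mem_interactionSet hodd hρ h p.2
    · exact (mem_interactionSet hodd hρ h p.1).symm
  set B := 30 * c * Real.pi + 4 * c * Real.log ρ + 4 * c * Real.log 2
    + 2 * c * (1 - u ρ) ^ 2 * Real.log ρ with hB
  have hdouble : ∫⁻ p in (((Ioo (-ρ) ρ)ᶜ ×ˢ (Ioo (-ρ) ρ)ᶜ)ᶜ : Set (ℝ × ℝ)),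
      gagliardoDensity c v p ∂(volume.prod volume) ≤ ENNReal.ofReal B + ENNReal.ofReal B := by
    refine (lintegral_mono_set hsub).trans ((lintegral_union_le _ _ _).trans ?_)
    rw [setLIntegral_preimage_swap (measurable_gagliardoDensity c hvmeas)
      (gagliardoDensity_swap c v) hT]
    have := lintegral_interactionSet_le hc hmono hodd hbd hρ hρ4 hgrow
    exact add_le_add this this
  have hB0 : 0 ≤ B := by positivity
  rw [nlEnergy_eq hK]
  calc _ ≤ (1 / 4) * (ENNReal.ofReal B + ENNReal.ofReal B) + ENNReal.ofReal (6 * M) := by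
        gcongr
        exact lintegral_potential_competitor_le hWM hM hWp hWm hodd hbd hρ
    _ = _ := by
        rw [show (1 / 4 : ℝ≥0∞) = ENNReal.ofReal (1 / 4) by
            rw [ENNReal.ofReal_div_of_pos (by norm_num)]; simp,
          ← ENNReal.ofReal_add hB0 hB0, ← ENNReal.ofReal_mul (by norm_num),
          ← ENNReal.ofReal_add (by positivity) (by positivity)]
        congr 1
        rw [hB]
        ring

end CompetitorEnergy

lemma IsClassAMinimizer.nlEnergy_Icc_le {c : ℝ} (hc : 0 ≤ c) {K : ℝ → ℝ}
    (hK : ∀ᵐ z : ℝ, K z = c * |z| ^ (-(2 : ℝ))) {W : ℝ → ℝ} {M : ℝ}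
    (hWM : ∀ r, |r| ≤ 1 → W r ≤ M) (hM : 0 ≤ M) (hWp : W 1 = 0) (hWm : W (-1) = 0) {u : ℝ → ℝ}
    (hmin : IsClassAMinimizer volume K W u) (hcont : Continuous u) (hmono : Monotone u)
    (hodd : ∀ x, u (-x) = -u x) (hbd : ∀ x, |u x| ≤ 1) (hu0 : 0 ≤ u 0) {R : ℝ} (hR : 4 ≤ R) :
    nlEnergy volume K W u (Icc (-R) R) ≤
      ENNReal.ofReal ((2 * c + c * (1 - u R) ^ 2) * (Real.log R + Real.log 2)
        + (15 * c * Real.pi + 2 * c * Real.log 2 + 6 * M)) := by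
  have hle1 : ∀ x, u x ≤ 1 := fun x => (abs_le.1 (hbd x)).2
  obtain ⟨ρ, ⟨hρ1, hρ2⟩, hgrow⟩ := exists_slope_le_one (R := R + 1) hcont hle1
    (hu0.trans (hmono (by linarith)))
  have huρ : 0 ≤ u ρ := hu0.trans (hmono (by linarith))
  have hmin' := (hmin (Ioo (-ρ) ρ) isOpen_Ioo (isConnected_Ioo (by linarith))
    (Metric.isBounded_Ioo _ _)).2 (competitor u ρ) (measurable_competitor hmono.measurable)
    (.of_forall fun x hx => competitor_of_le x (by
      by_contra! h
      exact hx (abs_lt.1 h)))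
  have hsub : Icc (-R) R ⊆ Ioo (-ρ) ρ := Icc_subset_Ioo (by linarith) (by linarith)
  refine (nlEnergy_mono_set K W u hsub).trans
    (hmin'.trans ((nlEnergy_competitor_le hc hK hWM hM hWp hWm hmono hodd hbd huρ (by linarith)
      hgrow).trans (ENNReal.ofReal_le_ofReal ?_)))
  have hlog : Real.log ρ ≤ Real.log R + Real.log 2 := by
    rw [← Real.log_mul (by linarith) (by norm_num)]
    exact Real.log_le_log (by linarith) (by linarith)
  have hsq : (1 - u ρ) ^ 2 ≤ (1 - u R) ^ 2 := by
    have := hmono (show R ≤ ρ by linarith)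
    have := hle1 ρ
    gcongr
  have hlogρ : 0 ≤ Real.log ρ := Real.log_nonneg (by linarith)
  gcongr

lemma tendsto_upper_quotient {u : ℝ → ℝ} (hu : Tendsto u atTop (𝓝 1)) (c C : ℝ) :
    Tendsto (fun R : ℝ => ((2 * c + c * (1 - u R) ^ 2) * (Real.log R + Real.log 2) + C)
      / Real.log R) atTop (𝓝 (2 * c)) := by
  have hinv : Tendsto (fun R : ℝ => (Real.log R)⁻¹) atTop (𝓝 0) :=
    tendsto_inv_atTop_zero.comp Real.tendsto_log_atTop
  have h := ((((hu.const_sub 1).pow 2).const_mul c).const_add (2 * c)).mul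
    ((hinv.const_mul (Real.log 2)).const_add 1) |>.add (hinv.const_mul C)
  rw [show (2 * c + c * (1 - 1) ^ 2) * (1 + Real.log 2 * 0) + C * 0 = 2 * c by ring] at h
  refine h.congr' ?_
  filter_upwards [eventually_gt_atTop 1] with R hR
  have := (Real.log_pos hR).ne'
  field_simp

lemma tendsto_lower_quotient {u : ℝ → ℝ} (hu : Tendsto u atTop (𝓝 1)) (c : ℝ) :
    Tendsto (fun R : ℝ => (2 * c * u (Real.log R) ^ 2 *
      (Real.log R - Real.log 2 - Real.log (Real.log R))) / Real.log R) atTop (𝓝 (2 * c)) := by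
  have hinv : Tendsto (fun R : ℝ => (Real.log R)⁻¹) atTop (𝓝 0) :=
    tendsto_inv_atTop_zero.comp Real.tendsto_log_atTop
  have hloglog : Tendsto (fun R : ℝ => Real.log (Real.log R) / Real.log R) atTop (𝓝 0) :=
    Real.isLittleO_log_id_atTop.tendsto_div_nhds_zero.comp Real.tendsto_log_atTop
  have h := (((hu.comp Real.tendsto_log_atTop).pow 2).const_mul (2 * c)).mul
    (((hinv.const_mul (Real.log 2)).const_sub 1).sub hloglog)
  rw [show 2 * c * 1 ^ 2 * (1 - Real.log 2 * 0 - 0) = 2 * c by ring] at h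
  refine h.congr' ?_
  filter_upwards [eventually_gt_atTop 1] with R hR
  have := (Real.log_pos hR).ne'
  simp only [Function.comp_apply]
  field_simp

/-- For `s = 1/2` and the homogeneous kernel `K(z) = λ⋆ |z|^{-2}`, the limit
`G(u₀) = lim_{R→∞} E_K(u₀,[-R,R]) / log R` exists, is finite and equals
`(λ⋆/2)(lim_{+∞} u₀ - lim_{-∞} u₀)² = 2 λ⋆`. -/
theorem theorem1_energy_limit_s_one_half
    (lamstar : ℝ) (hlamstar : 0 < lamstar)
    (K : ℝ → ℝ) (hKmeas : Measurable K)
    (hK : ∀ᵐ z : ℝ, K z = lamstar * |z| ^ (-(2 : ℝ)))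
    (W : ℝ → ℝ) (hWreg : ∃ β > 0, IsC2HolderLoc β W)
    (hWnonneg : ∀ r, 0 ≤ W r)
    (hW1 : ∀ r ∈ Ioo (-1 : ℝ) 1, 0 < W r)
    (hW2a : W 1 = 0) (hW2b : W (-1) = 0)
    (hW2c : deriv W 1 = 0) (hW2d : deriv W (-1) = 0)
    (hW3a : 0 < deriv (deriv W) 1) (hW3b : 0 < deriv (deriv W) (-1))
    (hW4 : ∀ r ∈ Icc (-1 : ℝ) 1, W (-r) = W r)
    -- `u₀` is the minimizer given by Theorem 1 (with `s = 1/2`, so `1 + 2s + α = 2 + α`):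
    (u0 : ℝ → ℝ)
    (hu0range : ∀ x, u0 x ∈ Ioo (-1 : ℝ) 1)
    (hu0odd : ∀ x, u0 (-x) = -u0 x)
    (hu0mono : StrictMono u0)
    (hu0zero : u0 0 = 0)
    (hu0top : Tendsto u0 atTop (𝓝 1)) (hu0bot : Tendsto u0 atBot (𝓝 (-1)))
    (hu0reg : ∃ α > 0, IsCHolder (2 + α) u0)
    (hu0min : IsClassAMinimizer volume K W u0)
    (hu0sol : ∀ x : ℝ, opLK volume K u0 x = deriv W (u0 x)) :
    Tendsto (fun R : ℝ => nlEnergy volume K W u0 (Icc (-R) R) / ENNReal.ofReal (Real.log R))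
        atTop (𝓝 (ENNReal.ofReal (2 * lamstar))) ∧
      lamstar / 2 * (1 - (-1) : ℝ) ^ 2 = 2 * lamstar := by
  refine ⟨?_, by ring⟩
  have hbd : ∀ x, |u0 x| ≤ 1 := fun x => abs_le.2 ⟨(hu0range x).1.le, (hu0range x).2.le⟩
  have hcont : Continuous u0 := by
    obtain ⟨α, -, h, -⟩ := hu0reg
    exact h.continuous
  have hWcont : Continuous W := by
    obtain ⟨β, -, h, -⟩ := hWreg
    exact h.continuous
  obtain ⟨M, hM⟩ := (isCompact_Icc (a := (-1 : ℝ)) (b := 1)).exists_bound_of_continuousOn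
    hWcont.continuousOn
  have hM0 : 0 ≤ M := (norm_nonneg _).trans (hM 0 (by simp))
  have hWM : ∀ r, |r| ≤ 1 → W r ≤ M := fun r hr => (le_abs_self _).trans (hM r (abs_le.1 hr))
  set C := 15 * lamstar * Real.pi + 2 * lamstar * Real.log 2 + 6 * M with hC
  refine tendsto_of_tendsto_of_tendsto_of_le_of_le'
    (ENNReal.tendsto_ofReal (tendsto_lower_quotient hu0top lamstar))
    (ENNReal.tendsto_ofReal (tendsto_upper_quotient hu0top lamstar C)) ?_ ?_
  · filter_upwards [eventually_gt_atTop 1] with R hR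
    have hlog : 0 < Real.log R := Real.log_pos hR
    have hlogR : Real.log R ≤ R := (Real.log_le_sub_one_of_pos (by linarith)).trans (by linarith)
    have hu : 0 ≤ u0 (Real.log R) := hu0zero ▸ hu0mono.monotone hlog.le
    rw [ENNReal.ofReal_div_of_pos hlog]
    gcongr
    refine le_trans (ENNReal.ofReal_le_ofReal ?_)
      (le_nlEnergy_Icc hlamstar hK W hu0mono.monotone hu0odd hlog hlogR hu)
    gcongr
    rw [Real.log_div (by linarith) (by linarith), Real.log_mul (by norm_num) hlog.ne', sub_sub]
    gcongr
    linarith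
  · filter_upwards [eventually_ge_atTop 4] with R hR
    have hlog : 0 < Real.log R := Real.log_pos (by linarith)
    rw [ENNReal.ofReal_div_of_pos hlog]
    gcongr
    exact hu0min.nlEnergy_Icc_le hlamstar.le hK hWM hM0 hW2a hW2b hcont hu0mono.monotone hu0odd
      hbd hu0zero.ge hR

end
end

section
/- Let N ≥ 1 and s ∈ (0,1). Assume K satisfies (K1) and (K2), and W : ℝ → [0,∞) is of class C^{2,β}_loc(ℝ) for some β > 0 and satisfies (W2): W(±1) = W'(±1) = 0. Let Ω ⊂ ℝ^N be a bounded Lipschitz domain and w0 : ℝ^N → [−1,1] a measurable function, and suppose there exists a measurable function w which coincides with w0 in ℝ^N ∖ Ω and satisfies E_K(w, Ω) < +∞. Then there exists a local minimizer u⋆ : ℝ^N → [−1,1] for E_K in Ω which coincides with w0 in ℝ^N ∖ Ω. -/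
open MeasureTheory Filter Topology Set
open scoped ENNReal NNReal

noncomputable section

section Truncation

variable {E : Type*} [MeasurableSpace E] [Sub E] {μ : Measure E}
  {K : E → ℝ} {W : ℝ → ℝ} {Ω : Set E}

/-- Pointwise truncation to `[-1, 1]` does not increase the energy. -/
lemma nlEnergy_le_of_ae_eq_projIcc (hW : ∀ r, 0 ≤ W r) (hW1 : W 1 = 0) (hW2 : W (-1) = 0)
    {u v : E → ℝ}
    (h : ∀ᵐ x ∂μ, u x = projIcc (-1 : ℝ) 1 (by norm_num) (v x)) :
    nlEnergy μ K W u Ω ≤ nlEnergy μ K W v Ω := by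
  have hWp : ∀ t : ℝ, W (projIcc (-1 : ℝ) 1 (by norm_num) t) ≤ W t := by
    intro t
    rcases le_total t (-1) with ht | ht
    · rw [projIcc_of_le_left _ ht, hW2]; exact hW t
    rcases le_total 1 t with ht' | ht'
    · rw [projIcc_of_right_le _ ht', hW1]; exact hW t
    · rw [projIcc_of_mem _ ⟨ht, ht'⟩]
  have h1 : ∀ᵐ p ∂(μ.prod μ), u p.1 = projIcc (-1 : ℝ) 1 (by norm_num) (v p.1) :=
    Measure.quasiMeasurePreserving_fst.ae h
  have h2 : ∀ᵐ p ∂(μ.prod μ), u p.2 = projIcc (-1 : ℝ) 1 (by norm_num) (v p.2) :=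
    Measure.quasiMeasurePreserving_snd.ae h
  unfold nlEnergy
  gcongr 1 / 4 * ?_ + ?_
  · apply lintegral_mono_ae
    filter_upwards [ae_restrict_of_ae h1, ae_restrict_of_ae h2] with p hp1 hp2
    rw [hp1, hp2]
    have hsq := sq_le_sq.2 (abs_projIcc_sub_projIcc (a := (-1 : ℝ)) (b := 1)
      (c := v p.1) (d := v p.2) (by norm_num))
    rw [ENNReal.ofReal_mul (sq_nonneg _), ENNReal.ofReal_mul (sq_nonneg _)]
    gcongr
  · apply lintegral_mono_ae
    filter_upwards [ae_restrict_of_ae h] with x hx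
    rw [hx]
    exact ENNReal.ofReal_le_ofReal (hWp _)

end Truncation

section LowerSemicontinuity

lemma ENNReal.liminf_nat_add_le (a b : ℕ → ℝ≥0∞) :
    liminf a atTop + liminf b atTop ≤ liminf (fun n => a n + b n) atTop := by
  simp only [liminf_eq_iSup_iInf_of_nat]
  rw [ENNReal.iSup_add_iSup_of_monotone]
  · refine iSup_mono fun n => le_iInf₂ fun i hi => ?_
    exact add_le_add (iInf₂_le i hi) (iInf₂_le i hi)
  · exact fun m n hmn => le_iInf₂ fun i hi => iInf₂_le i (hmn.trans hi)
  · exact fun m n hmn => le_iInf₂ fun i hi => iInf₂_le i (hmn.trans hi)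

variable {E : Type*} [AddGroup E] [MeasurableSpace E] [MeasurableSub₂ E] {μ : Measure E}
  {K : E → ℝ} {W : ℝ → ℝ} {Ω : Set E}

/-- The energy is lower semicontinuous along sequences converging almost everywhere. -/
lemma nlEnergy_le_liminf (hK : Measurable K) (hW : Continuous W) {u : ℕ → E → ℝ} {v : E → ℝ}
    (hu : ∀ k, Measurable (u k)) (h : ∀ᵐ x ∂μ, Tendsto (fun k => u k x) atTop (𝓝 (v x))) :
    nlEnergy μ K W v Ω ≤ liminf (fun k => nlEnergy μ K W (u k) Ω) atTop := by
  have h1 : ∀ᵐ p ∂(μ.prod μ), Tendsto (fun k => u k p.1) atTop (𝓝 (v p.1)) :=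
    Measure.quasiMeasurePreserving_fst.ae h
  have h2 : ∀ᵐ p ∂(μ.prod μ), Tendsto (fun k => u k p.2) atTop (𝓝 (v p.2)) :=
    Measure.quasiMeasurePreserving_snd.ae h
  have hmeas : ∀ k, Measurable fun p : E × E =>
      ENNReal.ofReal ((u k p.1 - u k p.2) ^ 2 * K (p.1 - p.2)) := fun k =>
    (((((hu k).comp measurable_fst).sub ((hu k).comp measurable_snd)).pow_const 2).mul
      (hK.comp (measurable_fst.sub measurable_snd))).ennreal_ofReal
  have hmeasW : ∀ k, Measurable fun x : E => ENNReal.ofReal (W (u k x)) := fun k =>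
    (hW.measurable.comp (hu k)).ennreal_ofReal
  unfold nlEnergy
  refine le_trans (add_le_add ?_ ?_) (ENNReal.liminf_nat_add_le _ _)
  · refine le_trans ?_ (lintegral_liminf_le' (fun k => ((hmeas k).const_mul _).aemeasurable) |>.trans
      (le_of_eq ?_)) (b := ∫⁻ p in ((Ωᶜ ×ˢ Ωᶜ)ᶜ : Set (E × E)), liminf (fun k => (1 / 4) *
        ENNReal.ofReal ((u k p.1 - u k p.2) ^ 2 * K (p.1 - p.2))) atTop ∂(μ.prod μ))
    · rw [← lintegral_const_mul' _ _ (by simp)]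
      apply lintegral_mono_ae
      filter_upwards [ae_restrict_of_ae h1, ae_restrict_of_ae h2] with p hp1 hp2
      refine (Tendsto.liminf_eq ?_).ge
      exact ENNReal.Tendsto.const_mul
        (ENNReal.tendsto_ofReal (((hp1.sub hp2).pow 2).mul_const _)) (Or.inr (by simp))
    · congr 1
      funext k
      exact lintegral_const_mul _ (hmeas k)
  · refine le_trans ?_ (lintegral_liminf_le' (fun k => (hmeasW k).aemeasurable))
    apply lintegral_mono_ae
    filter_upwards [ae_restrict_of_ae h] with x hx
    exact (ENNReal.tendsto_ofReal ((hW.tendsto _).comp hx)).liminf_eq.ge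

end LowerSemicontinuity

section Average

variable {α : Type*} [MeasurableSpace α] {μ : Measure α}

lemma integrableOn_of_forall_mem_Icc {u : α → ℝ} (hu : Measurable u)
    (hub : ∀ x, u x ∈ Icc (-1 : ℝ) 1) {s : Set α} (hs : μ s ≠ ⊤) : IntegrableOn u s μ :=
  Measure.integrableOn_of_bounded (M := 1) hs hu.aestronglyMeasurable
    (Eventually.of_forall fun x => abs_le.2 (hub x))

/-- Jensen's inequality for the squared deviation of a value from an average. -/
lemma measure_mul_ofReal_sq_sub_setAverage_le {u : α → ℝ} (hu : Measurable u)
    (hub : ∀ x, u x ∈ Icc (-1 : ℝ) 1) {s : Set α} (hs0 : μ s ≠ 0) (hs : μ s ≠ ⊤) (x : α) :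
    μ s * ENNReal.ofReal ((u x - ⨍ y in s, u y ∂μ) ^ 2)
      ≤ ∫⁻ y in s, ENNReal.ofReal ((u x - u y) ^ 2) ∂μ := by
  have hint : IntegrableOn (fun y => (u x - u y) ^ 2) s μ := by
    refine Measure.integrableOn_of_bounded (M := 4) hs
      ((hu.const_sub _).pow_const 2).aestronglyMeasurable (Eventually.of_forall fun y => ?_)
    have h1 := hub x
    have h2 := hub y
    rw [Real.norm_of_nonneg (sq_nonneg _)]
    nlinarith [h1.1, h1.2, h2.1, h2.2]
  have hconv : ConvexOn ℝ univ fun t : ℝ => (u x - t) ^ 2 := by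
    refine ⟨convex_univ, fun a _ b _ p q hp hq hpq => ?_⟩
    simp only [smul_eq_mul]
    obtain rfl : q = 1 - p := by linarith
    nlinarith [mul_nonneg (mul_nonneg hp hq) (sq_nonneg (a - b))]
  have hJ := hconv.map_set_average_le (t := s) (μ := μ) (f := u) (by fun_prop) isClosed_univ hs0 hs
    (by simp) (integrableOn_of_forall_mem_Icc hu hub hs) hint
  have hpos : 0 < μ.real s := ENNReal.toReal_pos hs0 hs
  rw [setAverage_eq _ (fun y => (u x - u y) ^ 2), smul_eq_mul, ← div_eq_inv_mul,
    le_div_iff₀ hpos] at hJ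
  rw [← ofReal_integral_eq_lintegral_ofReal hint (Eventually.of_forall fun y => sq_nonneg _),
    ← ENNReal.ofReal_toReal hs, ← ENNReal.ofReal_mul ENNReal.toReal_nonneg]
  apply ENNReal.ofReal_le_ofReal
  rw [mul_comm]
  exact hJ

end Average

section Compactness

variable {E : Type*} [NormedAddCommGroup E] [NormedSpace ℝ E] [FiniteDimensional ℝ E]
  [MeasurableSpace E] [BorelSpace E] {μ : Measure E} [μ.IsAddHaarMeasure]
  {K : E → ℝ} {W : ℝ → ℝ} {Ω : Set E}

/-- Replacing a function by its averages on nearby balls of radius `r` costs an amount of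
`L²` norm controlled by its energy. -/
lemma lintegral_sq_sub_setAverage_le (hKm : Measurable K) {c r : ℝ} (hr : 0 < r)
    (hK : ∀ᵐ z ∂μ, z ≠ 0 → ‖z‖ < 2 * r → c ≤ K z) {u : E → ℝ} (hu : Measurable u)
    (hub : ∀ x, u x ∈ Icc (-1 : ℝ) 1) {q : E → E} (hq : ∀ x, dist x (q x) < r) :
    μ (Metric.ball 0 r) * ENNReal.ofReal c *
        ∫⁻ x in Ω, ENNReal.ofReal ((u x - ⨍ y in Metric.ball (q x) r, u y ∂μ) ^ 2) ∂μ
      ≤ 4 * nlEnergy μ K W u Ω := by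
  set F : E × E → ℝ≥0∞ := fun p => ENNReal.ofReal ((u p.1 - u p.2) ^ 2 * K (p.1 - p.2)) with hF
  have hFm : Measurable F :=
    ((((hu.comp measurable_fst).sub (hu.comp measurable_snd)).pow_const 2).mul
      (hKm.comp (measurable_fst.sub measurable_snd))).ennreal_ofReal
  have hpt : ∀ x, μ (Metric.ball 0 r) * ENNReal.ofReal c *
      ENNReal.ofReal ((u x - ⨍ y in Metric.ball (q x) r, u y ∂μ) ^ 2) ≤ ∫⁻ y, F (x, y) ∂μ := by
    intro x
    have hJ := measure_mul_ofReal_sq_sub_setAverage_le (μ := μ) hu hub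
      (Metric.measure_ball_pos μ (q x) hr).ne' measure_ball_lt_top.ne x
    rw [Measure.addHaar_ball_center] at hJ
    calc _ = ENNReal.ofReal c * (μ (Metric.ball 0 r) *
          ENNReal.ofReal ((u x - ⨍ y in Metric.ball (q x) r, u y ∂μ) ^ 2)) := by ring
      _ ≤ ENNReal.ofReal c * ∫⁻ y in Metric.ball (q x) r, ENNReal.ofReal ((u x - u y) ^ 2) ∂μ := by
          gcongr
      _ ≤ ∫⁻ y in Metric.ball (q x) r, ENNReal.ofReal c * ENNReal.ofReal ((u x - u y) ^ 2) ∂μ :=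
          lintegral_const_mul_le _ _
      _ ≤ ∫⁻ y in Metric.ball (q x) r, F (x, y) ∂μ := by
          apply lintegral_mono_ae
          have hKx : ∀ᵐ y ∂μ, x - y ≠ 0 → ‖x - y‖ < 2 * r → c ≤ K (x - y) :=
            (Measure.measurePreserving_sub_left μ x).quasiMeasurePreserving.ae hK
          filter_upwards [ae_restrict_of_ae hKx, ae_restrict_mem measurableSet_ball] with y hy hyb
          rw [mul_comm, ← ENNReal.ofReal_mul (sq_nonneg _)]
          apply ENNReal.ofReal_le_ofReal
          rcases eq_or_ne x y with rfl | hxy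
          · simp
          · refine mul_le_mul_of_nonneg_left (hy (sub_ne_zero.2 hxy) ?_) (sq_nonneg _)
            rw [← dist_eq_norm]
            have := dist_triangle_right x y (q x)
            have := hq x
            rw [Metric.mem_ball] at hyb
            linarith
      _ ≤ _ := setLIntegral_le_lintegral _ _
  calc _ ≤ ∫⁻ x in Ω, μ (Metric.ball 0 r) * ENNReal.ofReal c *
        ENNReal.ofReal ((u x - ⨍ y in Metric.ball (q x) r, u y ∂μ) ^ 2) ∂μ :=
        lintegral_const_mul_le _ _
    _ ≤ ∫⁻ x in Ω, ∫⁻ y, F (x, y) ∂μ ∂μ := lintegral_mono hpt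
    _ = ∫⁻ p in Ω ×ˢ univ, F p ∂(μ.prod μ) := by
        rw [← Measure.prod_restrict, Measure.restrict_univ, lintegral_prod _ hFm.aemeasurable]
    _ ≤ ∫⁻ p in ((Ωᶜ ×ˢ Ωᶜ)ᶜ : Set (E × E)), F p ∂(μ.prod μ) :=
        lintegral_mono_set fun p hp hp' => hp'.1 hp.1
    _ = 4 * ((1 / 4) * ∫⁻ p in ((Ωᶜ ×ˢ Ωᶜ)ᶜ : Set (E × E)), F p ∂(μ.prod μ)) := by
        rw [← mul_assoc, one_div, ENNReal.mul_inv_cancel (by simp) (by simp), one_mul]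
    _ ≤ _ := by
        unfold nlEnergy
        gcongr
        exact le_self_add

/-- `K` is bounded below by `c` near the origin, at scales `r` for which `c` times the volume of
the ball of radius `r` is arbitrarily large. -/
def IsSingularKernel (μ : Measure E) (K : E → ℝ) : Prop :=
  ∀ M : ℝ≥0∞, M ≠ ⊤ → ∃ r > 0, ∃ c : ℝ, M ≤ μ (Metric.ball 0 r) * ENNReal.ofReal c ∧
    ∀ᵐ z ∂μ, z ≠ 0 → ‖z‖ < 2 * r → c ≤ K z

lemma KernelK2.isSingularKernel [Nontrivial E] {s lam Lam r0 : ℝ} (hs : 0 < s) (hlam : 0 < lam)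
    (hr0 : 0 < r0) (hK : KernelK2 μ K (Module.finrank ℝ E) s lam Lam r0) :
    IsSingularKernel μ K := by
  intro M hM
  set n := Module.finrank ℝ E
  set m := μ (Metric.ball (0 : E) 1)
  have hm0 : m ≠ 0 := (Metric.measure_ball_pos μ 0 one_pos).ne'
  have hconst : (0 : ℝ) < lam * 2 ^ (-(n : ℝ) - 2 * s) := by positivity
  have hlim : Tendsto (fun r : ℝ => m * ENNReal.ofReal
      (lam * 2 ^ (-(n : ℝ) - 2 * s) * r ^ (-(2 * s)))) (𝓝[>] 0) (𝓝 ⊤) := by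
    have h1 := ENNReal.tendsto_ofReal_atTop.comp
      ((tendsto_rpow_neg_nhdsGT_zero (y := -(2 * s)) (by linarith)).const_mul_atTop hconst)
    have h2 := ENNReal.Tendsto.const_mul h1 (Or.inl ENNReal.top_ne_zero) (a := m)
    rwa [ENNReal.mul_top hm0] at h2
  have hev := (hlim.eventually (eventually_gt_nhds hM.lt_top)).and
    (Ioo_mem_nhdsGT (half_pos hr0))
  obtain ⟨r, hMr, hr, hrr0⟩ := hev.exists
  refine ⟨r, hr, lam * (2 * r) ^ (-(n : ℝ) - 2 * s), ?_, ?_⟩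
  · refine hMr.le.trans (le_of_eq ?_)
    rw [Measure.addHaar_ball μ _ hr.le, mul_comm _ m, mul_assoc m,
      ← ENNReal.ofReal_mul (by positivity)]
    congr 2
    rw [Real.mul_rpow zero_le_two hr.le, ← Real.rpow_natCast r]
    have : r ^ (-(2 * s)) = r ^ (n : ℝ) * r ^ (-(n : ℝ) - 2 * s) := by
      rw [← Real.rpow_add hr]; congr 1; ring
    rw [this]; ring
  · filter_upwards [hK] with z hz hz0 hzr
    refine le_trans ?_ (hz.2 (by linarith))
    refine mul_le_mul_of_nonneg_left ?_ hlam.le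
    exact Real.rpow_le_rpow_of_nonpos (norm_pos_iff.2 hz0) hzr.le (by
      have : (0 : ℝ) ≤ n := Nat.cast_nonneg n
      linarith)

lemma eLpNorm_two_le_of_lintegral_sq_le {α : Type*} [MeasurableSpace α] {ν : Measure α}
    {f : α → ℝ} {ε : ℝ≥0∞} (h : ∫⁻ x, ENNReal.ofReal (f x ^ 2) ∂ν ≤ ε ^ 2) :
    eLpNorm f 2 ν ≤ ε := by
  have h2 := eLpNorm_nnreal_pow_eq_lintegral (μ := ν) (f := f) (p := 2) two_ne_zero
  have h3 : ∀ x, ‖f x‖ₑ ^ ((2 : ℝ≥0) : ℝ) = ENNReal.ofReal (f x ^ 2) := fun x => by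
    rw [← sq_abs, ← Real.norm_eq_abs, ENNReal.ofReal_pow (norm_nonneg _), ofReal_norm]
    simp
  simp only [h3] at h2
  have h4 : eLpNorm f 2 ν ^ 2 ≤ ε ^ 2 := by
    refine le_trans (le_of_eq ?_) h
    rw [← h2]
    simp
  exact (ENNReal.pow_le_pow_left_iff two_ne_zero).1 h4

/-- Any sequence with bounded energy has a subsequence converging almost everywhere in `Ω`. -/
lemma exists_subseq_ae_tendsto (hKm : Measurable K) (hK : IsSingularKernel μ K)
    (hΩ : μ Ω ≠ ⊤) {u : ℕ → E → ℝ} (hu : ∀ k, Measurable (u k))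
    (hub : ∀ k x, u k x ∈ Icc (-1 : ℝ) 1) {C : ℝ≥0∞} (hC : C ≠ ⊤)
    (hE : ∀ k, nlEnergy μ K W (u k) Ω ≤ C) :
    ∃ φ : ℕ → ℕ, StrictMono φ ∧
      ∀ᵐ x ∂(μ.restrict Ω), ∃ l, Tendsto (fun k => u (φ k) x) atTop (𝓝 l) := by
  classical
  have : IsFiniteMeasure (μ.restrict Ω) := ⟨by simpa using hΩ.lt_top⟩
  have hscale : ∀ n : ℕ, ∃ r > 0, ∃ c : ℝ,
      (4 * C + 1) * (n + 1) ^ 2 ≤ μ (Metric.ball 0 r) * ENNReal.ofReal c ∧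
      ∀ᵐ z ∂μ, z ≠ 0 → ‖z‖ < 2 * r → c ≤ K z := fun n =>
    hK _ (by finiteness)
  choose r hr c hrc hKc using hscale
  set d : ℕ → E := TopologicalSpace.denseSeq E
  have hex : ∀ n x, ∃ i, dist x (d i) < r n := fun n x => by
    exact (TopologicalSpace.denseRange_denseSeq E).exists_dist_lt x (hr n)
  set j : ℕ → E → ℕ := fun n x => Nat.find (hex n x)
  have hjm : ∀ n, Measurable (j n) := fun n =>
    measurable_find (hex n) fun i => measurableSet_lt (by fun_prop) measurable_const
  have hjd : ∀ n x, dist x (d (j n x)) < r n := fun n x => Nat.find_spec (hex n x)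
  set A : ℕ → ℕ × ℕ → ℝ := fun k p => ⨍ y in Metric.ball (d p.2) (r p.1), u k y ∂μ
  have hAmem : ∀ k p, A k p ∈ Icc (-1 : ℝ) 1 := fun k p =>
    (convex_Icc (-1 : ℝ) 1).set_average_mem isClosed_Icc (Metric.measure_ball_pos μ _ (hr _)).ne'
      measure_ball_lt_top.ne (Eventually.of_forall (hub k))
      (integrableOn_of_forall_mem_Icc (hu k) (hub k) measure_ball_lt_top.ne)
  obtain ⟨a, -, φ, hφ, hlim⟩ := (isCompact_univ_pi fun _ : ℕ × ℕ =>
    isCompact_Icc (a := (-1 : ℝ)) (b := 1)).tendsto_subseq (x := A) fun k p _ => hAmem k p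
  have hlimp : ∀ p, Tendsto (fun k => A (φ k) p) atTop (𝓝 (a p)) := fun p =>
    (tendsto_pi_nhds.1 hlim) p
  set P : ℕ → ℕ → E → ℝ := fun n k x => A (φ k) (n, j n x) with hP
  have hPm : ∀ n k, Measurable (P n k) := fun n k =>
    (measurable_of_countable fun i => A (φ k) (n, i)).comp (hjm n)
  set g : ℕ → E → ℝ := fun n x => a (n, j n x) with hg
  have hgm : ∀ n, Measurable (g n) := fun n =>
    (measurable_of_countable fun i => a (n, i)).comp (hjm n)
  have hanear : ∀ n k, eLpNorm (u (φ k) - P n k) 2 (μ.restrict Ω) ≤ ((n : ℝ≥0∞) + 1)⁻¹ := by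
    intro n k
    apply eLpNorm_two_le_of_lintegral_sq_le
    set I := ∫⁻ x in Ω, ENNReal.ofReal ((u (φ k) - P n k) x ^ 2) ∂μ
    have h1 : μ (Metric.ball 0 (r n)) * ENNReal.ofReal (c n) * I ≤ 4 * nlEnergy μ K W (u (φ k)) Ω :=
      lintegral_sq_sub_setAverage_le hKm (hr n) (hKc n) (hu _) (hub _) (hjd n)
    have h2 : (4 * C + 1) * ((n + 1) ^ 2 * I) ≤ (4 * C + 1) * 1 := by
      calc _ = (4 * C + 1) * (n + 1) ^ 2 * I := by ring
        _ ≤ _ := mul_le_mul_left (hrc n) I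
        _ ≤ _ := h1
        _ ≤ 4 * C := by gcongr; exact hE _
        _ ≤ _ := by rw [mul_one]; exact le_self_add
    have h3 : ((n : ℝ≥0∞) + 1) ^ 2 * I ≤ 1 :=
      (ENNReal.mul_le_mul_iff_right (by simp) (by finiteness)).1 h2
    rw [← ENNReal.inv_pow, ENNReal.le_inv_iff_mul_le, mul_comm]
    exact h3
  have hmean : ∀ n, Tendsto (fun k => eLpNorm (P n k - g n) 2 (μ.restrict Ω)) atTop (𝓝 0) := by
    intro n
    have hL : Tendsto (fun k => ∫⁻ x in Ω, ENNReal.ofReal ((P n k - g n) x ^ 2) ∂μ) atTop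
        (𝓝 (∫⁻ x in Ω, 0 ∂μ)) := by
      refine tendsto_lintegral_of_dominated_convergence (fun _ => 4)
        (fun k => (((hPm n k).sub (hgm n)).pow_const 2).ennreal_ofReal) (fun k => ?_) ?_ ?_
      · refine Eventually.of_forall fun x => ?_
        have h1 := hAmem (φ k) (n, j n x)
        have h2 : a (n, j n x) ∈ Icc (-1 : ℝ) 1 :=
          isClosed_Icc.mem_of_tendsto (hlimp _) (Eventually.of_forall fun k => hAmem _ _)
        refine ENNReal.ofReal_le_of_le_toReal ?_
        simp only [hP, hg, Pi.sub_apply, ENNReal.toReal_ofNat]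
        nlinarith [h1.1, h1.2, h2.1, h2.2]
      · simpa using ENNReal.mul_ne_top (by simp) hΩ
      · refine Eventually.of_forall fun x => ?_
        have h1 := ENNReal.tendsto_ofReal (((hlimp (n, j n x)).sub_const (a (n, j n x))).pow 2)
        simpa using h1
    rw [lintegral_zero] at hL
    rw [ENNReal.tendsto_nhds_zero] at hL ⊢
    intro ε hε
    filter_upwards [hL (ε ^ 2) (pos_iff_ne_zero.2 (pow_ne_zero 2 hε.ne'))] with k hk
    exact eLpNorm_two_le_of_lintegral_sq_le hk
  have hmem : ∀ k, MemLp (u (φ k)) 2 (μ.restrict Ω) := fun k =>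
    MemLp.of_bound (hu _).aestronglyMeasurable 1 (Eventually.of_forall fun x => abs_le.2 (hub _ x))
  set f : ℕ → Lp ℝ 2 (μ.restrict Ω) := fun k => (hmem k).toLp
  have hcauchy : CauchySeq f := by
    rw [EMetric.cauchySeq_iff]
    intro ε hε
    have hε4 : ε / 4 ≠ 0 := (ENNReal.div_pos hε.ne' (by simp)).ne'
    obtain ⟨n, hn⟩ := ENNReal.exists_inv_nat_lt hε4
    have hn' : ((n : ℝ≥0∞) + 1)⁻¹ < ε / 4 :=
      lt_of_le_of_lt (ENNReal.inv_le_inv.2 le_self_add) hn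
    have hev : ∀ᶠ k in atTop, eLpNorm (P n k - g n) 2 (μ.restrict Ω) < ε / 4 :=
      (hmean n).eventually (eventually_lt_nhds (pos_iff_ne_zero.2 hε4))
    obtain ⟨k₀, hk₀⟩ := eventually_atTop.1 hev
    have hdist : ∀ k, k₀ ≤ k → eLpNorm (u (φ k) - g n) 2 (μ.restrict Ω) < ε / 2 := fun k hk => by
      have : u (φ k) - g n = (u (φ k) - P n k) + (P n k - g n) := by abel
      rw [this]
      refine (eLpNorm_add_le ((hu _).sub (hPm _ _)).aestronglyMeasurable
        ((hPm _ _).sub (hgm _)).aestronglyMeasurable one_le_two).trans_lt ?_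
      have h4 : ε / 2 = ε / 4 + ε / 4 := by
        rw [← two_mul, ENNReal.div_eq_inv_mul, ENNReal.div_eq_inv_mul, ← mul_assoc]
        congr 1
        rw [show (4 : ℝ≥0∞) = 2 * 2 by norm_num, ENNReal.mul_inv (by simp) (by simp), ← mul_assoc,
          ENNReal.mul_inv_cancel (by simp) (by simp), one_mul]
      rw [h4]
      exact ENNReal.add_lt_add ((hanear n k).trans_lt hn') (hk₀ k hk)
    refine ⟨k₀, fun k hk l hl => ?_⟩
    rw [Lp.edist_toLp_toLp]
    have : u (φ k) - u (φ l) = (u (φ k) - g n) - (u (φ l) - g n) := by abel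
    rw [this]
    refine (eLpNorm_sub_le ((hu _).sub (hgm _)).aestronglyMeasurable
      ((hu _).sub (hgm _)).aestronglyMeasurable one_le_two).trans_lt ?_
    exact (ENNReal.add_lt_add (hdist k hk) (hdist l hl)).trans_eq (ENNReal.add_halves ε)
  obtain ⟨v, hv⟩ := cauchySeq_tendsto_of_complete hcauchy
  obtain ⟨ψ, hψ, hψv⟩ := (tendstoInMeasure_of_tendsto_Lp hv).exists_seq_tendsto_ae
  refine ⟨φ ∘ ψ, hφ.comp hψ, ?_⟩
  filter_upwards [hψv, ae_all_iff.2 fun k => (hmem k).coeFn_toLp] with x hx hfx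
  exact ⟨v x, hx.congr fun i => hfx (ψ i)⟩

end Compactness

/-- Lemma 4.6 (existence of local minimizers with prescribed exterior datum): if some extension
`w` of `w₀` has finite energy in a bounded domain `Ω`, then there is a local minimizer
`u⋆ : ℝ^N → [-1,1]` of `E_K` in `Ω` agreeing with `w₀` outside `Ω`. -/
theorem existence_local_minimizer
    (N : ℕ) (hN : 1 ≤ N) (s lam Lam r0 : ℝ) (hs0 : 0 < s) (hs1 : s < 1)
    (hlam : 0 < lam) (hlamLam : lam ≤ Lam) (hr0 : 0 < r0)
    (K : EuclideanSpace ℝ (Fin N) → ℝ) (hKmeas : Measurable K)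
    (hK1 : KernelSymm volume K) (hK2 : KernelK2 volume K N s lam Lam r0)
    (W : ℝ → ℝ) (hWreg : ∃ β > 0, IsC2HolderLoc β W)
    (hWnonneg : ∀ r, 0 ≤ W r)
    (hW2a : W 1 = 0) (hW2b : W (-1) = 0)
    (hW2c : deriv W 1 = 0) (hW2d : deriv W (-1) = 0)
    (Ω : Set (EuclideanSpace ℝ (Fin N)))
    (hΩopen : IsOpen Ω) (hΩconn : IsConnected Ω) (hΩbd : Bornology.IsBounded Ω)
    (w0 : EuclideanSpace ℝ (Fin N) → ℝ) (hw0meas : Measurable w0)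
    (hw0range : ∀ x, w0 x ∈ Icc (-1 : ℝ) 1)
    (w : EuclideanSpace ℝ (Fin N) → ℝ) (hwmeas : Measurable w)
    (hww0 : ∀ x ∉ Ω, w x = w0 x)
    (hwfin : nlEnergy volume K W w Ω ≠ ⊤) :
    ∃ ustar : EuclideanSpace ℝ (Fin N) → ℝ,
      Measurable ustar ∧
      (∀ x, ustar x ∈ Icc (-1 : ℝ) 1) ∧
      (∀ x ∉ Ω, ustar x = w0 x) ∧
      IsLocalMinimizer volume K W ustar Ω := by
  have hΩ := hΩopen.measurableSet
  have hle : (-1 : ℝ) ≤ 1 := by norm_num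
  have : Nontrivial (EuclideanSpace ℝ (Fin N)) :=
    Module.nontrivial_of_finrank_pos (R := ℝ) (by simpa using Nat.lt_of_succ_le hN)
  have hsing : IsSingularKernel volume K :=
    KernelK2.isSingularKernel hs0 hlam hr0 (by simpa using hK2)
  have hWcont : Continuous W := by
    obtain ⟨β, -, hβ, -⟩ := hWreg
    exact hβ.continuous
  set S : Set (EuclideanSpace ℝ (Fin N) → ℝ) :=
    {u | Measurable u ∧ (∀ x, u x ∈ Icc (-1 : ℝ) 1) ∧ ∀ x ∉ Ω, u x = w0 x} with hS
  have htrunc : ∀ v : EuclideanSpace ℝ (Fin N) → ℝ, Measurable v →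
      (∀ᵐ x, x ∉ Ω → v x = w0 x) → ∃ u ∈ S, nlEnergy volume K W u Ω ≤ nlEnergy volume K W v Ω := by
    classical
    intro v hv hvw
    refine ⟨Ω.piecewise (fun x => projIcc (-1 : ℝ) 1 hle (v x)) w0, ⟨?_, fun x => ?_, fun x hx => ?_⟩,
      nlEnergy_le_of_ae_eq_projIcc hWnonneg hW2a hW2b ?_⟩
    · exact Measurable.piecewise hΩ
        ((continuous_subtype_val.comp continuous_projIcc).measurable.comp hv) hw0meas
    · by_cases hx : x ∈ Ω
      · rw [piecewise_eq_of_mem _ _ _ hx]; exact Subtype.coe_prop _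
      · rw [piecewise_eq_of_notMem _ _ _ hx]; exact hw0range x
    · exact piecewise_eq_of_notMem _ _ _ hx
    · filter_upwards [hvw] with x hxw
      by_cases hx : x ∈ Ω
      · rw [piecewise_eq_of_mem _ _ _ hx]
      · rw [piecewise_eq_of_notMem _ _ _ hx, hxw hx, projIcc_of_mem _ (hw0range x)]
  set T : Set ℝ≥0∞ := (fun u => nlEnergy volume K W u Ω) '' S
  obtain ⟨u₀, hu₀, hu₀w⟩ := htrunc w hwmeas (Eventually.of_forall hww0)
  obtain ⟨t, ht_anti, ht_lim, htT⟩ := exists_seq_tendsto_sInf (S := T)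
    ⟨_, mem_image_of_mem _ hu₀⟩ (OrderBot.bddBelow _)
  have hinf_top : sInf T ≠ ⊤ :=
    ne_top_of_le_ne_top hwfin ((sInf_le (mem_image_of_mem _ hu₀)).trans hu₀w)
  obtain ⟨k₀, hk₀⟩ := (ht_lim.eventually (eventually_lt_nhds hinf_top.lt_top)).exists
  choose u huS hut using fun k => htT (k + k₀)
  obtain ⟨φ, hφ, hconv⟩ := exists_subseq_ae_tendsto (W := W) hKmeas hsing hΩbd.measure_lt_top.ne
    (fun k => (huS k).1) (fun k => (huS k).2.1) hk₀.ne
    (fun k => (hut k).trans_le (ht_anti (Nat.le_add_left k₀ k)))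
  have hconv' : ∀ᵐ x, ∃ l, Tendsto (fun k => u (φ k) x) atTop (𝓝 l) := by
    filter_upwards [(ae_restrict_iff' hΩ).1 hconv] with x hx
    by_cases hxΩ : x ∈ Ω
    · exact hx hxΩ
    · exact ⟨w0 x, tendsto_const_nhds.congr fun k => ((huS _).2.2 x hxΩ).symm⟩
  obtain ⟨v, hvm, hv⟩ := measurable_limit_of_tendsto_metrizable_ae
    (fun k => (huS (φ k)).1.aemeasurable) hconv'
  have hvw0 : ∀ᵐ x, x ∉ Ω → v x = w0 x := by
    filter_upwards [hv] with x hx hxΩ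
    exact tendsto_nhds_unique hx (tendsto_const_nhds.congr fun k => ((huS _).2.2 x hxΩ).symm)
  have hvinf : nlEnergy volume K W v Ω ≤ sInf T := by
    refine (nlEnergy_le_liminf hKmeas hWcont (fun k => (huS (φ k)).1) hv).trans (le_of_eq ?_)
    refine (Tendsto.congr (fun k => (hut (φ k)).symm) ?_).liminf_eq
    exact ht_lim.comp ((tendsto_add_atTop_nat k₀).comp hφ.tendsto_atTop)
  obtain ⟨ustar, ⟨hm, hrange, hext⟩, hustar⟩ := htrunc v hvm hvw0
  refine ⟨ustar, hm, hrange, hext, ne_top_of_le_ne_top hinf_top (hustar.trans hvinf), ?_⟩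
  intro y hy hyu
  obtain ⟨y', hy', hyy'⟩ := htrunc y hy (by
    filter_upwards [hyu] with x hx hxΩ
    rw [hx hxΩ, hext x hxΩ])
  exact (hustar.trans hvinf).trans ((sInf_le (mem_image_of_mem _ hy')).trans hyy')

end
end
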